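/- Let g ≥ 5 be a Sophie Germain prime and let h denote the cardinality of the class group of the order ℤ[√-(2g+1)] (this equals the class number h(-8g-4) of primitive positive definite binary quadratic forms of discriminant -(8g+4)). Then the ratio f_g(x) = #{p ≤ x : p prime, p = x₀² + (2g+1)y₀² for some integers x₀, y₀, p ≠ 2g+1, and p ≢ 1 (mod 2g+1)} / #{p ≤ x : p prime} tends to (1/(2h))·(1 − 1/g) as x → ∞. -/

import Mathlib

open MeasureTheory Filter Topology Set in
theorem tendsto_integral_mul_kernel {D : ℝ → ℝ} (hDm : Measurable D) {M : ℝ}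
    (hD : ∀ u, |D u| ≤ M) {H : ℂ → ℂ} (hH : ContinuousOn H {s | 0 ≤ s.re})
    (hEq : ∀ s : ℂ, 0 < s.re → ∫ u in Ioi (0 : ℝ), (D u : ℂ) * Complex.exp (-s * u) = H s)
    {w : ℝ → ℂ} (hw : Continuous w) {R : ℝ} (hwR : ∀ τ, R < |τ| → w τ = 0) {k : ℝ → ℂ}
    (hk : Integrable k) (hkw : ∀ v : ℝ, k v = ∫ τ : ℝ, w τ * Complex.exp (τ * v * Complex.I)) :
    Tendsto (fun y : ℝ => ∫ u in Ioi (0 : ℝ), (D u : ℂ) * k (y - u)) atTop (𝓝 0) := by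
  have hM : 0 ≤ M := (abs_nonneg _).trans (hD 0)
  have hwc : HasCompactSupport w :=
    HasCompactSupport.of_support_subset_isCompact (isCompact_Icc (a := -R) (b := R)) (by
      intro τ hτ
      by_contra h
      exact hτ (hwR τ (by
        by_contra h'
        exact h (abs_le.1 (not_lt.1 h')))))
  have hwi : Integrable w := hw.integrable_of_hasCompactSupport hwc
  have hline (δ : ℝ) (hδ : 0 ≤ δ) : Continuous fun τ : ℝ => H (δ + τ * Complex.I) := by
    refine hH.comp_continuous (by fun_prop) ?_
    intro τ
    simpa using hδ
  -- the identity for positive abscissa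
  have key (y δ : ℝ) (hδ : 0 < δ) :
      ∫ τ : ℝ, w τ * Complex.exp (τ * y * Complex.I) * H (δ + τ * Complex.I) =
        ∫ u in Ioi (0 : ℝ), (D u : ℂ) * Complex.exp (-δ * u) * k (y - u) := by
    have h1 (τ : ℝ) : w τ * Complex.exp (τ * y * Complex.I) * H (δ + τ * Complex.I) =
        ∫ u in Ioi (0 : ℝ), w τ * Complex.exp (τ * y * Complex.I) *
          ((D u : ℂ) * Complex.exp (-(δ + τ * Complex.I) * u)) := by
      rw [integral_const_mul, hEq _ (by simpa using hδ)]
    simp_rw [h1]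
    rw [integral_integral_swap]
    · refine integral_congr_ae (Eventually.of_forall fun u => ?_)
      simp only
      rw [hkw, ← integral_const_mul]
      refine integral_congr_ae (Eventually.of_forall fun τ => ?_)
      simp only
      have : Complex.exp (τ * y * Complex.I) * Complex.exp (-(δ + τ * Complex.I) * u) =
          Complex.exp (-δ * u) * Complex.exp (τ * (y - u : ℝ) * Complex.I) := by
        rw [← Complex.exp_add, ← Complex.exp_add]
        congr 1
        push_cast
        ring
      linear_combination (w τ * D u) * this
    · have hb : Integrable (fun u : ℝ => M * Real.exp (-δ * u)) (volume.restrict (Ioi 0)) :=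
        (integrableOn_exp_mul_Ioi (by linarith) 0).const_mul M
      refine (hwi.norm.mul_prod hb).mono' ?_ ?_
      · apply Measurable.aestronglyMeasurable
        have : Measurable w := hw.measurable
        fun_prop
      · refine Eventually.of_forall fun p => ?_
        rcases p with ⟨τ, u⟩
        simp only [Function.uncurry, norm_mul, Complex.norm_exp]
        simp
        exact mul_le_mul_of_nonneg_left (mul_le_mul_of_nonneg_right (hD u) (Real.exp_pos _).le)
          (norm_nonneg _)
  have key0 (y : ℝ) : ∫ τ : ℝ, w τ * Complex.exp (τ * y * Complex.I) * H (τ * Complex.I) =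
        ∫ u in Ioi (0 : ℝ), (D u : ℂ) * k (y - u) := by
    have hK : IsCompact (Icc (0 : ℝ) 1 ×ℂ Icc (-R) R) := isCompact_Icc.reProdIm isCompact_Icc
    obtain ⟨B, hB⟩ := hK.exists_bound_of_continuousOn (f := H) (hH.mono (by
      intro s hs
      exact (Complex.mem_reProdIm.1 hs).1.1))
    have hlim1 : Tendsto (fun δ : ℝ =>
        ∫ τ : ℝ, w τ * Complex.exp (τ * y * Complex.I) * H (δ + τ * Complex.I)) (𝓝[>] 0)
        (𝓝 (∫ τ : ℝ, w τ * Complex.exp (τ * y * Complex.I) * H (τ * Complex.I))) := by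
      have hmem : ∀ᶠ δ : ℝ in 𝓝[>] 0, δ ∈ Ioo (0 : ℝ) 1 := Ioo_mem_nhdsGT one_pos
      refine tendsto_integral_filter_of_dominated_convergence (fun τ => ‖w τ‖ * B) ?_ ?_
        (hwi.norm.mul_const B) ?_
      · filter_upwards [hmem] with δ hδ
        have := hline δ hδ.1.le
        exact ((hw.mul (by fun_prop)).mul this).aestronglyMeasurable
      · filter_upwards [hmem] with δ hδ
        refine Eventually.of_forall fun τ => ?_
        by_cases hτ : R < |τ|
        · simp [hwR τ hτ]
        · rw [norm_mul, norm_mul]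
          have e1 : ‖Complex.exp (τ * y * Complex.I)‖ = 1 := by
            have := Complex.norm_exp_ofReal_mul_I (τ * y)
            push_cast at this
            exact this
          rw [e1, mul_one]
          refine mul_le_mul_of_nonneg_left (hB _ ?_) (norm_nonneg _)
          rw [Complex.mem_reProdIm]
          have := abs_le.1 (not_lt.1 hτ)
          simp
          exact ⟨⟨hδ.1.le, hδ.2.le⟩, this⟩
      · refine Eventually.of_forall fun τ => ?_
        refine Tendsto.const_mul _ ?_
        have h0 : ContinuousWithinAt H {s | 0 ≤ s.re} (τ * Complex.I) := hH _ (by simp)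
        refine h0.tendsto.comp ?_
        rw [tendsto_nhdsWithin_iff]
        constructor
        · have : Tendsto (fun δ : ℝ => (δ : ℂ) + τ * Complex.I) (𝓝 0)
              (𝓝 (((0 : ℝ) : ℂ) + τ * Complex.I)) := (by fun_prop : Continuous
                (fun δ : ℝ => (δ : ℂ) + τ * Complex.I)).tendsto 0
          simpa using this.mono_left nhdsWithin_le_nhds
        · filter_upwards [hmem] with δ hδ
          simpa using hδ.1.le
    have hlim2 : Tendsto (fun δ : ℝ =>
        ∫ u in Ioi (0 : ℝ), (D u : ℂ) * Complex.exp (-δ * u) * k (y - u)) (𝓝[>] 0)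
        (𝓝 (∫ u in Ioi (0 : ℝ), (D u : ℂ) * k (y - u))) := by
      have hki : Integrable (fun u => k (y - u)) := hk.comp_sub_left y
      refine tendsto_integral_filter_of_dominated_convergence (fun u => M * ‖k (y - u)‖) ?_ ?_
        (hki.norm.const_mul M).restrict ?_
      · refine Eventually.of_forall fun δ => ?_
        refine AEStronglyMeasurable.mul ?_ hki.restrict.aestronglyMeasurable
        apply Measurable.aestronglyMeasurable
        fun_prop
      · filter_upwards [self_mem_nhdsWithin] with δ hδ
        filter_upwards [ae_restrict_mem measurableSet_Ioi] with u hu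
        rw [norm_mul, norm_mul, Complex.norm_exp]
        refine mul_le_mul_of_nonneg_right ?_ (norm_nonneg _)
        have : Real.exp (-(δ : ℂ) * u).re ≤ 1 := by
          rw [Real.exp_le_one_iff]
          simp
          exact mul_nonneg (le_of_lt hδ) (le_of_lt hu)
        calc ‖(D u : ℂ)‖ * _ ≤ M * 1 := by
              refine mul_le_mul ?_ this (Real.exp_pos _).le hM
              simpa using hD u
          _ = M := mul_one M
      · refine Eventually.of_forall fun u => ?_
        refine Tendsto.mul_const _ ?_
        have : Tendsto (fun δ : ℝ => (D u : ℂ) * Complex.exp (-δ * u)) (𝓝 0)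
              (𝓝 ((D u : ℂ) * Complex.exp (-(0 : ℝ) * u))) := (by fun_prop : Continuous
                (fun δ : ℝ => (D u : ℂ) * Complex.exp (-δ * u))).tendsto 0
        simpa using this.mono_left nhdsWithin_le_nhds
    refine tendsto_nhds_unique hlim1 (hlim2.congr' ?_)
    filter_upwards [self_mem_nhdsWithin] with δ hδ
    exact (key y δ hδ).symm
  simp_rw [← key0]
  have RL := Real.tendsto_integral_exp_smul_cocompact (fun τ : ℝ => w τ * H (τ * Complex.I))
  have hsc : Tendsto (fun y : ℝ => -y / (2 * Real.pi)) atTop (cocompact ℝ) := by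
    refine Tendsto.mono_right ?_ atBot_le_cocompact
    exact (tendsto_neg_atTop_atBot).atBot_div_const (by positivity)
  refine (RL.comp hsc).congr fun y => ?_
  refine integral_congr_ae (Eventually.of_forall fun τ => ?_)
  simp only [Circle.smul_def, Real.fourierChar_apply, smul_eq_mul]
  have : (((2 * Real.pi * -(τ * (-y / (2 * Real.pi))) : ℝ)) : ℂ) = τ * y := by
    have hp : (2 * Real.pi) ≠ 0 := by positivity
    rw [← Complex.ofReal_mul]
    congr 1
    field_simp
  rw [this]
  ring

open MeasureTheory Filter Topology Set in
theorem integrable_sinc_sq : Integrable fun x : ℝ => Real.sinc x ^ 2 := by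
  refine (integrable_inv_one_add_sq.const_mul 2).mono'
    (Real.continuous_sinc.pow 2).aestronglyMeasurable (Eventually.of_forall fun x => ?_)
  rw [Real.norm_of_nonneg (sq_nonneg _), ← div_eq_mul_inv, le_div_iff₀ (by positivity)]
  have h1 : Real.sinc x ^ 2 ≤ 1 := by
    rw [sq_le_one_iff_abs_le_one]
    exact Real.abs_sinc_le_one x
  have h2 : Real.sinc x ^ 2 * x ^ 2 ≤ 1 := by
    rcases eq_or_ne x 0 with rfl | hx
    · simp
    · rw [Real.sinc_of_ne_zero hx, div_pow, div_mul_cancel₀ _ (by positivity)]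
      exact Real.sin_sq_le_one x
  nlinarith

open MeasureTheory Filter Topology Set in
theorem integral_sinc_sq_pos : 0 < ∫ x : ℝ, Real.sinc x ^ 2 := by
  rw [integral_pos_iff_support_of_nonneg (fun x => sq_nonneg _) integrable_sinc_sq]
  refine IsOpen.measure_pos _ ?_ ⟨0, by simp⟩
  exact (Real.continuous_sinc.pow 2).isOpen_support

open MeasureTheory Filter Topology Set in
theorem integral_triangle_mul_exp (v : ℝ) :
    ∫ τ : ℝ, ((max 0 (1 - |τ| / 2) / 2 : ℝ) : ℂ) * Complex.exp (τ * v * Complex.I) =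
      ((Real.sinc v ^ 2 : ℝ) : ℂ) := by
  set f : ℝ → ℂ := fun τ => ((max 0 (1 - |τ| / 2) / 2 : ℝ) : ℂ) * Complex.exp (τ * v * Complex.I)
    with hf
  have hfc : Continuous f := by fun_prop
  have h1 : ∫ τ : ℝ, f τ = ∫ τ in (-2 : ℝ)..2, f τ := by
    rw [intervalIntegral.integral_of_le (by norm_num), setIntegral_eq_integral_of_forall_compl_eq_zero]
    intro τ hτ
    have : max 0 (1 - |τ| / 2) = 0 := by
      refine max_eq_left ?_
      by_contra h
      have h3 : |τ| < 2 := by linarith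
      exact hτ ⟨(abs_lt.1 h3).1, (abs_lt.1 h3).2.le⟩
    simp [hf, this]
  rw [h1, ← intervalIntegral.integral_add_adjacent_intervals (b := 0)
    (hfc.intervalIntegrable _ _) (hfc.intervalIntegrable _ _)]
  have e1 : ∫ τ in (-2 : ℝ)..0, f τ =
      ∫ τ in (-2 : ℝ)..0, (1 + (τ : ℂ) / 2) / 2 * Complex.exp (τ * v * Complex.I) := by
    refine intervalIntegral.integral_congr fun τ hτ => ?_
    rw [uIcc_of_le (by norm_num)] at hτ
    have h3 : max 0 (1 - |τ| / 2) = 1 + τ / 2 := by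
      rw [abs_of_nonpos hτ.2, max_eq_right (by linarith [hτ.1])]
      ring
    simp only [hf, h3]
    push_cast
    rfl
  have e2 : ∫ τ in (0 : ℝ)..2, f τ =
      ∫ τ in (0 : ℝ)..2, (1 - (τ : ℂ) / 2) / 2 * Complex.exp (τ * v * Complex.I) := by
    refine intervalIntegral.integral_congr fun τ hτ => ?_
    rw [uIcc_of_le (by norm_num)] at hτ
    have h3 : max 0 (1 - |τ| / 2) = 1 - τ / 2 := by
      rw [abs_of_nonneg hτ.1, max_eq_right (by linarith [hτ.2])]
    simp only [hf, h3]
    push_cast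
    rfl
  have hd (τ : ℝ) : HasDerivAt (fun τ : ℝ => (τ : ℂ)) 1 τ := Complex.ofRealCLM.hasDerivAt
  rw [e1, e2]
  rcases eq_or_ne v 0 with rfl | hv
  · have g1 : ∫ τ in (-2 : ℝ)..0, (1 + (τ : ℂ) / 2) / 2 * Complex.exp (τ * (0 : ℝ) * Complex.I) =
        1 / 2 := by
      rw [intervalIntegral.integral_eq_sub_of_hasDerivAt
        (f := fun τ : ℝ => (τ : ℂ) / 2 + (τ : ℂ) ^ 2 / 8)]
      · push_cast; ring
      · intro τ _
        refine HasDerivAt.congr_deriv (((hd τ).div_const 2).add (((hd τ).pow 2).div_const 8)) ?_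
        simp; ring
      · exact Continuous.intervalIntegrable (by fun_prop) _ _
    have g2 : ∫ τ in (0 : ℝ)..2, (1 - (τ : ℂ) / 2) / 2 * Complex.exp (τ * (0 : ℝ) * Complex.I) =
        1 / 2 := by
      rw [intervalIntegral.integral_eq_sub_of_hasDerivAt
        (f := fun τ : ℝ => (τ : ℂ) / 2 - (τ : ℂ) ^ 2 / 8)]
      · push_cast; ring
      · intro τ _
        refine HasDerivAt.congr_deriv (((hd τ).div_const 2).sub (((hd τ).pow 2).div_const 8)) ?_
        simp; ring
      · exact Continuous.intervalIntegrable (by fun_prop) _ _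
    rw [g1, g2]
    norm_num
  · have hvc : (v : ℂ) ≠ 0 := by simpa using hv
    have hv' : (v : ℂ) * Complex.I ≠ 0 := by simp [hv]
    have hE (τ : ℝ) : HasDerivAt (fun τ : ℝ => Complex.exp (τ * v * Complex.I))
        (v * Complex.I * Complex.exp (τ * v * Complex.I)) τ := by
      convert (((hd τ).mul_const (v : ℂ)).mul_const Complex.I).cexp using 1
      ring
    have g1 : ∫ τ in (-2 : ℝ)..0, (1 + (τ : ℂ) / 2) / 2 * Complex.exp (τ * v * Complex.I) =
        1 / 2 * (1 / (v * Complex.I) - 1 / 2 / (v * Complex.I) ^ 2 +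
          1 / 2 * Complex.exp (-2 * v * Complex.I) / (v * Complex.I) ^ 2) := by
      rw [intervalIntegral.integral_eq_sub_of_hasDerivAt
        (f := fun τ : ℝ => 1 / 2 * (((1 + (τ : ℂ) / 2) / (v * Complex.I) -
          1 / 2 / (v * Complex.I) ^ 2) * Complex.exp (τ * v * Complex.I)))]
      · simp
        ring
      · intro τ _
        refine HasDerivAt.congr_deriv (((((((hd τ).div_const 2).const_add 1).div_const (v * Complex.I)).sub_const
          (1 / 2 / (v * Complex.I) ^ 2)).mul (hE τ)).const_mul (1 / 2 : ℂ)) ?_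
        field_simp
        ring
      · exact Continuous.intervalIntegrable (by fun_prop) _ _
    have g2 : ∫ τ in (0 : ℝ)..2, (1 - (τ : ℂ) / 2) / 2 * Complex.exp (τ * v * Complex.I) =
        1 / 2 * (1 / 2 * Complex.exp (2 * v * Complex.I) / (v * Complex.I) ^ 2 -
          1 / (v * Complex.I) - 1 / 2 / (v * Complex.I) ^ 2) := by
      rw [intervalIntegral.integral_eq_sub_of_hasDerivAt
        (f := fun τ : ℝ => 1 / 2 * (((1 - (τ : ℂ) / 2) / (v * Complex.I) +
          1 / 2 / (v * Complex.I) ^ 2) * Complex.exp (τ * v * Complex.I)))]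
      · simp
        ring
      · intro τ _
        refine HasDerivAt.congr_deriv (((((((hd τ).div_const 2).const_sub 1).div_const (v * Complex.I)).add_const
          (1 / 2 / (v * Complex.I) ^ 2)).mul (hE τ)).const_mul (1 / 2 : ℂ)) ?_
        field_simp
        ring
      · exact Continuous.intervalIntegrable (by fun_prop) _ _
    rw [g1, g2, Real.sinc_of_ne_zero hv]
    push_cast
    have hs : Complex.sin v = (Complex.exp (-v * Complex.I) - Complex.exp (v * Complex.I)) *
      Complex.I / 2 := rfl
    have x1 : Complex.exp (2 * v * Complex.I) = Complex.exp (v * Complex.I) ^ 2 := by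
      rw [← Complex.exp_nat_mul]; congr 1; push_cast; ring
    have x2 : Complex.exp (-2 * v * Complex.I) = Complex.exp (-v * Complex.I) ^ 2 := by
      rw [← Complex.exp_nat_mul]; congr 1; push_cast; ring
    have x3 : Complex.exp (v * Complex.I) * Complex.exp (-v * Complex.I) = 1 := by
      rw [← Complex.exp_add]; simp
    rw [hs, x1, x2]
    rw [neg_mul] at x3 ⊢
    have hI : Complex.I ^ 2 = -1 := Complex.I_sq
    field_simp
    rw [show Complex.I ^ 4 = 1 by simp]
    linear_combination (2 : ℂ) * x3

open MeasureTheory Filter Topology Set in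
/-- The scaled Fejér kernel is the Fourier transform of a triangle function. -/
theorem mul_sinc_sq_eq_integral {μ : ℝ} (hμ : 0 < μ) (v : ℝ) :
    ((μ * Real.sinc (μ * v) ^ 2 : ℝ) : ℂ) =
      ∫ τ : ℝ, ((max 0 (1 - |τ / μ| / 2) / 2 : ℝ) : ℂ) * Complex.exp (τ * v * Complex.I) := by
  have := Measure.integral_comp_div (fun τ : ℝ => ((max 0 (1 - |τ| / 2) / 2 : ℝ) : ℂ) *
    Complex.exp (τ * (μ * v : ℝ) * Complex.I)) μ
  rw [integral_triangle_mul_exp, abs_of_pos hμ] at this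
  rw [Complex.ofReal_mul, ← Complex.real_smul, ← this]
  congr 1
  ext τ
  congr 2
  have : (μ : ℂ) ≠ 0 := by exact_mod_cast hμ.ne'
  push_cast
  field_simp

open MeasureTheory Filter Topology Set in
theorem tendsto_of_tendsto_integral_sinc_sq {B : ℝ → ℝ} (hBm : Measurable B) {C : ℝ}
    (hB0 : ∀ u, 0 ≤ B u) (hBC : ∀ u, B u ≤ C)
    (hBg : ∀ y u, 0 ≤ y → y ≤ u → B y * Real.exp (-(u - y)) ≤ B u) {A : ℝ}
    (h : ∀ μ : ℝ, 0 < μ → Tendsto (fun y : ℝ =>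
      ∫ u in Ioi (0 : ℝ), (B u - A) * (μ * Real.sinc (μ * (y - u)) ^ 2)) atTop (𝓝 0)) :
    Tendsto B atTop (𝓝 A) := by
  have hC : 0 ≤ C := (hB0 0).trans (hBC 0)
  set c : ℝ := ∫ x : ℝ, Real.sinc x ^ 2 with hc
  have hcpos : 0 < c := integral_sinc_sq_pos
  set κ : ℝ → ℝ → ℝ := fun μ v => μ * Real.sinc (μ * v) ^ 2 with hκ
  have hκ0 (μ v : ℝ) (hμ : 0 < μ) : 0 ≤ κ μ v := by positivity
  have hκi (μ : ℝ) (hμ : 0 < μ) : Integrable (κ μ) :=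
    (integrable_sinc_sq.comp_mul_left' hμ.ne').const_mul μ
  have hκc (μ : ℝ) (hμ : 0 < μ) : ∫ v, κ μ v = c := by
    simp only [hκ]
    rw [integral_const_mul, Measure.integral_comp_mul_left (fun x => Real.sinc x ^ 2) μ,
      abs_of_pos (inv_pos.2 hμ), smul_eq_mul, ← mul_assoc, mul_inv_cancel₀ hμ.ne', one_mul]
  have hκy (μ y : ℝ) (hμ : 0 < μ) : Integrable (fun u => κ μ (y - u)) := (hκi μ hμ).comp_sub_left y
  have hBκ (μ y : ℝ) (hμ : 0 < μ) : Integrable (fun u => B u * κ μ (y - u)) := by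
    refine (hκy μ y hμ).bdd_mul (c := C) hBm.aestronglyMeasurable (Eventually.of_forall fun u => ?_)
    rw [Real.norm_of_nonneg (hB0 u)]
    exact hBC u
  -- the smoothed averages converge
  have hJ (μ : ℝ) (hμ : 0 < μ) : Tendsto (fun y : ℝ => ∫ u in Ioi (0 : ℝ), B u * κ μ (y - u)) atTop
      (𝓝 (A * c)) := by
    have h1 : Tendsto (fun y : ℝ => ∫ u in Ioi (0 : ℝ), κ μ (y - u)) atTop (𝓝 c) := by
      have h2 : ∀ y : ℝ, ∫ u in Ioi (0 : ℝ), κ μ (y - u) = ∫ v, (Iio y).indicator (κ μ) v := by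
        intro y
        rw [← integral_sub_left_eq_self _ volume y, ← integral_indicator measurableSet_Ioi]
        congr 1
        ext u
        by_cases hu : 0 < u
        · rw [indicator_of_mem (by exact hu), indicator_of_mem (by simpa using hu)]
        · rw [indicator_of_notMem (by exact hu), indicator_of_notMem (by simpa using hu)]
      simp_rw [h2]
      rw [← hκc μ hμ]
      refine tendsto_integral_filter_of_dominated_convergence (κ μ) ?_ ?_ (hκi μ hμ) ?_
      · exact Eventually.of_forall fun y =>
          ((hκi μ hμ).indicator measurableSet_Iio).aestronglyMeasurable
      · refine Eventually.of_forall fun y => Eventually.of_forall fun v => ?_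
        rw [norm_indicator_eq_indicator_norm]
        refine (indicator_le_self' (fun _ _ => norm_nonneg _) v).trans ?_
        rw [Real.norm_of_nonneg (hκ0 μ v hμ)]
      · refine Eventually.of_forall fun v => tendsto_const_nhds.congr' ?_
        filter_upwards [eventually_gt_atTop v] with y hy
        rw [indicator_of_mem (by exact hy)]
    have h3 := (h μ hμ).add (h1.const_mul A)
    rw [zero_add] at h3
    refine h3.congr fun y => ?_
    rw [← integral_const_mul, ← integral_add]
    · congr 1
      ext u
      simp only [hκ]
      ring
    · simp_rw [sub_mul]
      exact ((hBκ μ y hμ).sub ((hκy μ y hμ).const_mul A)).restrict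
    · exact ((hκy μ y hμ).const_mul A).restrict
  set d : ℝ → ℝ := fun m => ∫ v in (-m)..m, Real.sinc v ^ 2 with hd
  have hdc : Tendsto (fun n : ℕ => d n) atTop (𝓝 c) :=
    intervalIntegral_tendsto_integral integrable_sinc_sq
      (tendsto_neg_atTop_atBot.comp tendsto_natCast_atTop_atTop) tendsto_natCast_atTop_atTop
  have hwin (μ δ y : ℝ) (hμ : 0 < μ) (hδ : 0 < δ) :
      ∫ u in Ioc (y - δ) (y + δ), κ μ (y - u) = d (μ * δ) := by
    rw [← intervalIntegral.integral_of_le (by linarith)]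
    rw [intervalIntegral.integral_comp_sub_left (κ μ) y]
    simp only [hκ, hd]
    rw [intervalIntegral.integral_const_mul,
      intervalIntegral.mul_integral_comp_mul_left (f := fun x => Real.sinc x ^ 2)]
    congr 1 <;> ring
  have upper (μ δ y : ℝ) (hμ : 0 < μ) (hδ : 0 < δ) (hy : 0 < y) :
      B y * Real.exp (-(2 * δ)) * d (μ * δ) ≤ ∫ u in Ioi (0 : ℝ), B u * κ μ ((y + δ) - u) := by
    rw [← hwin μ δ (y + δ) hμ hδ, ← integral_const_mul]
    have hsub : Ioc (y + δ - δ) (y + δ + δ) ⊆ Ioi (0 : ℝ) := fun u hu => by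
      have := hu.1
      simp only [mem_Ioi]
      linarith
    refine le_trans ?_ (setIntegral_mono_set (hBκ μ (y + δ) hμ).integrableOn
      (Eventually.of_forall fun u => mul_nonneg (hB0 u) (hκ0 _ _ hμ))
      (LE.le.eventuallyLE hsub))
    refine setIntegral_mono_on ((hκy μ _ hμ).const_mul _).integrableOn
      (hBκ μ (y + δ) hμ).integrableOn measurableSet_Ioc fun u hu => ?_
    refine mul_le_mul_of_nonneg_right ?_ (hκ0 _ _ hμ)
    have h1 := hu.1
    have h2 := hu.2
    refine le_trans ?_ (hBg y u hy.le (by linarith))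
    refine mul_le_mul_of_nonneg_left (Real.exp_le_exp.2 (by linarith)) (hB0 y)
  have lower (μ δ y : ℝ) (hμ : 0 < μ) (hδ : 0 < δ) (hy : 2 * δ < y) :
      ∫ u in Ioi (0 : ℝ), B u * κ μ ((y - δ) - u) ≤
        B y * Real.exp (2 * δ) * c + C * (c - d (μ * δ)) := by
    have hc' : ∫ u, κ μ ((y - δ) - u) = c := by
      rw [integral_sub_left_eq_self (κ μ) volume, hκc μ hμ]
    set W := Ioc (y - δ - δ) (y - δ + δ) with hW
    have hsplit : c - d (μ * δ) = ∫ u, Wᶜ.indicator (fun u => κ μ ((y - δ) - u)) u := by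
      rw [integral_indicator measurableSet_Ioc.compl, ← hwin μ δ (y - δ) hμ hδ, ← hc']
      rw [← integral_add_compl (measurableSet_Ioc (a := y - δ - δ) (b := y - δ + δ))
        (hκy μ (y - δ) hμ)]
      ring
    have hi2 : Integrable (Wᶜ.indicator (fun u => κ μ ((y - δ) - u))) :=
      (hκy μ (y - δ) hμ).indicator measurableSet_Ioc.compl
    calc _ ≤ ∫ u in Ioi (0 : ℝ), (B y * Real.exp (2 * δ) * κ μ ((y - δ) - u) +
          C * Wᶜ.indicator (fun u => κ μ ((y - δ) - u)) u) := by
          refine setIntegral_mono_on (hBκ μ _ hμ).integrableOn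
            (((hκy μ _ hμ).const_mul _).add (hi2.const_mul C)).integrableOn measurableSet_Ioi
            fun u hu => ?_
          have hu0 : 0 < u := hu
          by_cases huW : u ∈ W
          · rw [indicator_of_notMem (by simpa using huW), mul_zero, add_zero]
            refine mul_le_mul_of_nonneg_right ?_ (hκ0 _ _ hμ)
            have h1 := huW.1
            have h2 := huW.2
            have h3 := hBg u y hu0.le (by linarith)
            rw [Real.exp_neg, ← div_eq_mul_inv, div_le_iff₀ (Real.exp_pos _)] at h3
            refine h3.trans (mul_le_mul_of_nonneg_left (Real.exp_le_exp.2 (by linarith)) (hB0 y))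
          · rw [indicator_of_mem (by simpa using huW)]
            have := mul_le_mul_of_nonneg_right (hBC u) (hκ0 μ ((y - δ) - u) hμ)
            have : 0 ≤ B y * Real.exp (2 * δ) * κ μ ((y - δ) - u) :=
              mul_nonneg (mul_nonneg (hB0 y) (Real.exp_pos _).le) (hκ0 _ _ hμ)
            linarith
      _ ≤ ∫ u, (B y * Real.exp (2 * δ) * κ μ ((y - δ) - u) +
          C * Wᶜ.indicator (fun u => κ μ ((y - δ) - u)) u) := by
          refine setIntegral_le_integral (((hκy μ _ hμ).const_mul _).add (hi2.const_mul C))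
            (Eventually.of_forall fun u => ?_)
          exact add_nonneg (mul_nonneg (mul_nonneg (hB0 y) (Real.exp_pos _).le) (hκ0 _ _ hμ))
            (mul_nonneg hC (indicator_nonneg (fun _ _ => hκ0 _ _ hμ) _))
      _ = _ := by
          rw [integral_add ((hκy μ _ hμ).const_mul _) (hi2.const_mul C),
            integral_const_mul (B y * Real.exp (2 * δ)) (fun u => κ μ ((y - δ) - u)),
            integral_const_mul C, hc', ← hsplit]
  -- choose parameters
  have hinv : Tendsto (fun n : ℕ => (1 : ℝ) / n) atTop (𝓝 0) := tendsto_one_div_atTop_nhds_zero_nat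
  rw [tendsto_order]
  constructor
  · intro a ha
    have hlim : Tendsto (fun n : ℕ => Real.exp (-(2 * ((1 : ℝ) / n))) *
        ((A * c - 1 / n - C * (c - d n)) / c)) atTop
        (𝓝 (Real.exp (-(2 * 0)) * ((A * c - 0 - C * (c - c)) / c))) := by
      refine Tendsto.mul ?_ ?_
      · exact (Real.continuous_exp.tendsto _).comp (hinv.const_mul 2).neg
      · exact ((hinv.const_sub _).sub ((hdc.const_sub c).const_mul C)).div_const c
    have hval : Real.exp (-(2 * 0)) * ((A * c - 0 - C * (c - c)) / c) = A := by
      simp; field_simp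
    rw [hval] at hlim
    obtain ⟨n, hn, hn1⟩ := ((hlim.eventually (lt_mem_nhds ha)).and (eventually_ge_atTop 1)).exists
    have hnpos : (0 : ℝ) < n := by exact_mod_cast hn1
    have hμ : (0 : ℝ) < (n : ℝ) ^ 2 := by positivity
    have hδ : (0 : ℝ) < 1 / n := by positivity
    have hmn : (n : ℝ) ^ 2 * (1 / n) = n := by field_simp
    have hshift : Tendsto (fun y : ℝ => y - 1 / n) atTop atTop :=
      tendsto_atTop_add_const_right _ (-(1 / (n : ℝ))) tendsto_id
    have hev := ((hJ _ hμ).comp hshift).eventually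
      (lt_mem_nhds (show A * c - 1 / n < A * c by linarith))
    filter_upwards [hev, eventually_gt_atTop (2 * (1 / (n : ℝ)))] with y hy1 hy2
    have h1 := lower _ _ y hμ hδ hy2
    rw [hmn] at h1
    refine hn.trans_le ?_
    simp only [Function.comp] at hy1
    rw [Real.exp_neg, mul_comm, ← div_eq_mul_inv, div_div, div_le_iff₀ (by positivity)]
    nlinarith [hy1, h1]
  · intro a ha
    have hlim : Tendsto (fun n : ℕ => Real.exp (2 * ((1 : ℝ) / n)) *
        ((A * c + 1 / n) / d n)) atTop
        (𝓝 (Real.exp (2 * 0) * ((A * c + 0) / c))) := by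
      refine Tendsto.mul ?_ ?_
      · exact (Real.continuous_exp.tendsto _).comp (hinv.const_mul 2)
      · exact (hinv.const_add _).div hdc hcpos.ne'
    have hval : Real.exp (2 * 0) * ((A * c + 0) / c) = A := by
      simp; field_simp
    rw [hval] at hlim
    obtain ⟨n, ⟨hn, hn1⟩, hdn⟩ := (((hlim.eventually (gt_mem_nhds ha)).and
      (eventually_ge_atTop 1)).and (hdc.eventually (lt_mem_nhds hcpos))).exists
    have hnpos : (0 : ℝ) < n := by exact_mod_cast hn1
    have hμ : (0 : ℝ) < (n : ℝ) ^ 2 := by positivity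
    have hδ : (0 : ℝ) < 1 / n := by positivity
    have hmn : (n : ℝ) ^ 2 * (1 / n) = n := by field_simp
    have hshift : Tendsto (fun y : ℝ => y + 1 / n) atTop atTop :=
      tendsto_atTop_add_const_right _ ((1 / (n : ℝ))) tendsto_id
    have hev := ((hJ _ hμ).comp hshift).eventually
      (gt_mem_nhds (show A * c < A * c + 1 / n by linarith))
    filter_upwards [hev, eventually_gt_atTop 0] with y hy1 hy2
    have h1 := upper _ _ y hμ hδ hy2
    rw [hmn] at h1
    refine lt_of_le_of_lt ?_ hn
    simp only [Function.comp] at hy1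
    rw [← mul_div_assoc, le_div_iff₀ hdn]
    have h2 : B y * Real.exp (-(2 * (1 / (n : ℝ)))) * d n ≤ A * c + 1 / n := by linarith
    rw [Real.exp_neg] at h2
    have h3 := mul_le_mul_of_nonneg_left h2 (Real.exp_pos (2 * (1 / (n : ℝ)))).le
    refine le_trans (le_of_eq ?_) h3
    field_simp

open MeasureTheory Filter Topology Set in
theorem integral_Ioi_one_mul_cpow_eq_integral_exp (S : ℝ → ℂ) (s : ℂ) :
    ∫ t in Ioi (1 : ℝ), S t * (t : ℂ) ^ (-(s + 1)) =
      ∫ u in Ioi (0 : ℝ), S (Real.exp u) * Complex.exp (-s * u) := by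
  have himg : Ioi (1 : ℝ) = Real.exp '' Ioi (0 : ℝ) := by
    ext t
    constructor
    · intro ht
      exact ⟨Real.log t, Real.log_pos ht, Real.exp_log (zero_lt_one.trans ht)⟩
    · rintro ⟨u, hu, rfl⟩
      exact Real.one_lt_exp_iff.2 hu
  rw [himg, integral_image_eq_integral_abs_deriv_smul measurableSet_Ioi
    (fun x _ => (Real.hasDerivAt_exp x).hasDerivWithinAt) Real.exp_injective.injOn]
  refine setIntegral_congr_fun measurableSet_Ioi fun u _ => ?_
  simp only [abs_of_pos (Real.exp_pos u), Complex.real_smul]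
  rw [mul_left_comm]
  congr 1
  rw [Complex.cpow_def_of_ne_zero (by exact_mod_cast (Real.exp_pos u).ne'), ← Complex.ofReal_log
    (Real.exp_pos u).le, Real.log_exp, Complex.ofReal_exp, ← Complex.exp_add]
  congr 1
  ring

open MeasureTheory Filter Topology Set in
/-- The **Wiener–Ikehara theorem**, for nonnegative coefficients satisfying a Chebyshev bound. -/
theorem tendsto_sum_div_of_LSeries_continuousOn {f : ℕ → ℝ} (hf : ∀ n, 0 ≤ f n) {C : ℝ}
    (hC : ∀ n : ℕ, ∑ k ∈ Finset.Icc 1 n, f k ≤ C * n) {A : ℝ} {G : ℂ → ℂ}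
    (hG : ContinuousOn G {s | 1 ≤ s.re})
    (hfG : ∀ s : ℂ, 1 < s.re → LSeries (fun n => (f n : ℂ)) s = G s + A / (s - 1)) :
    Tendsto (fun n : ℕ => (∑ k ∈ Finset.Icc 1 n, f k) / (n : ℝ)) atTop (𝓝 A) := by
  set S : ℝ → ℝ := fun t => ∑ k ∈ Finset.Icc 1 ⌊t⌋₊, f k with hS
  have hSmono : Monotone S := fun a b hab =>
    Finset.sum_le_sum_of_subset_of_nonneg (Finset.Icc_subset_Icc_right (Nat.floor_le_floor hab))
      fun k _ _ => hf k
  have hS0 (t : ℝ) : 0 ≤ S t := Finset.sum_nonneg fun k _ => hf k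
  have hC0 : 0 ≤ C := by
    have := (Finset.sum_nonneg fun k (_ : k ∈ Finset.Icc 1 1) => hf k).trans (hC 1)
    simpa using this
  have hSC (t : ℝ) (ht : 0 ≤ t) : S t ≤ C * t :=
    (hC _).trans (mul_le_mul_of_nonneg_left (Nat.floor_le ht) hC0)
  set B : ℝ → ℝ := fun u => S (Real.exp u) * Real.exp (-u) with hB
  have hBm : Measurable B :=
    (hSmono.measurable.comp Real.measurable_exp).mul (Real.measurable_exp.comp measurable_neg)
  have hB0 (u : ℝ) : 0 ≤ B u := mul_nonneg (hS0 _) (Real.exp_pos _).le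
  have hBC (u : ℝ) : B u ≤ C := by
    have := mul_le_mul_of_nonneg_right (hSC _ (Real.exp_pos u).le) (Real.exp_pos (-u)).le
    rwa [mul_assoc, ← Real.exp_add, add_neg_cancel, Real.exp_zero, mul_one] at this
  have hBg (y u : ℝ) (_ : 0 ≤ y) (hyu : y ≤ u) : B y * Real.exp (-(u - y)) ≤ B u := by
    simp only [hB]
    rw [mul_assoc, ← Real.exp_add, show -y + -(u - y) = -u by ring]
    exact mul_le_mul_of_nonneg_right (hSmono (Real.exp_le_exp.2 hyu)) (Real.exp_pos _).le
  have hDm : Measurable fun u => B u - A := hBm.sub_const A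
  have hDb (u : ℝ) : |B u - A| ≤ C + |A| := by
    refine (abs_sub _ _).trans ?_
    rw [abs_of_nonneg (hB0 u)]
    linarith [hBC u]
  have hint (s : ℂ) (hs : 0 < s.re) :
      IntegrableOn (fun u : ℝ => Complex.exp (-s * u)) (Ioi 0) := by
    have := integrableOn_exp_mul_complex_Ioi (a := -s) (by simpa using hs) 0
    simpa using this
  have hEq (s : ℂ) (hs : 0 < s.re) :
      ∫ u in Ioi (0 : ℝ), ((B u - A : ℝ) : ℂ) * Complex.exp (-s * u) =
        (G (1 + s) - A) / (1 + s) := by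
    have hs0 : s ≠ 0 := by rintro rfl; simp at hs
    have hs1 : 1 + s ≠ 0 := by
      intro h
      have := congrArg Complex.re h
      simp at this
      linarith
    have h1 : ∫ u in Ioi (0 : ℝ), (B u : ℂ) * Complex.exp (-s * u) =
        LSeries (fun n => (f n : ℂ)) (1 + s) / (1 + s) := by
      rw [LSeries_eq_mul_integral_of_nonneg f zero_le_one (by simpa using hs) ?_ hf,
        mul_div_cancel_left₀ _ hs1]
      · have := integral_Ioi_one_mul_cpow_eq_integral_exp (fun t => (S t : ℂ)) (1 + s)
        simp only [hS, Complex.ofReal_sum] at this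
        rw [this]
        refine setIntegral_congr_fun measurableSet_Ioi fun u _ => ?_
        simp only [hB, hS]
        push_cast
        rw [mul_assoc, ← Complex.exp_add]
        congr 2
        ring
      · refine Asymptotics.IsBigO.of_bound C (Eventually.of_forall fun n => ?_)
        rw [Real.norm_of_nonneg (Finset.sum_nonneg fun k _ => hf k), Real.rpow_one,
          Real.norm_of_nonneg (Nat.cast_nonneg n)]
        exact hC n
    have h2 : ∫ u in Ioi (0 : ℝ), (A : ℂ) * Complex.exp (-s * u) = A / s := by
      rw [integral_const_mul, integral_exp_mul_complex_Ioi (by simpa using hs)]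
      simp [div_eq_mul_inv]
    have hBi : IntegrableOn (fun u : ℝ => (B u : ℂ) * Complex.exp (-s * u)) (Ioi 0) := by
      refine (hint s hs).bdd_mul (c := C)
        (Complex.measurable_ofReal.comp hBm).aestronglyMeasurable (Eventually.of_forall fun u => ?_)
      rw [Complex.norm_of_nonneg (hB0 u)]
      exact hBC u
    simp_rw [Complex.ofReal_sub, sub_mul]
    rw [integral_sub hBi ((hint s hs).const_mul _), h1, h2, hfG _ (by simpa using hs), add_sub_cancel_left]
    field_simp
    ring
  have hBt : Tendsto B atTop (𝓝 A) := by
    refine tendsto_of_tendsto_integral_sinc_sq hBm hB0 hBC hBg fun μ hμ => ?_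
    have h := tendsto_integral_mul_kernel hDm hDb (H := fun s => (G (1 + s) - A) / (1 + s)) ?_ hEq
      (w := fun τ => ((max 0 (1 - |τ / μ| / 2) / 2 : ℝ) : ℂ)) (by fun_prop) (R := 2 * μ) ?_
      (k := fun v => ((μ * Real.sinc (μ * v) ^ 2 : ℝ) : ℂ)) ?_ (mul_sinc_sq_eq_integral hμ)
    · have h' := (Complex.continuous_re.tendsto 0).comp h
      refine (h'.congr fun y => ?_)
      simp only [Function.comp]
      rw [← Complex.ofReal_re (∫ u in Ioi (0 : ℝ), (B u - A) * (μ * Real.sinc (μ * (y - u)) ^ 2)),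
        ← integral_complex_ofReal]
      congr 2
      ext u
      push_cast
      ring
    · refine ContinuousOn.div ((hG.comp (by fun_prop) fun s hs => ?_).sub continuousOn_const)
        (by fun_prop) fun s hs h => ?_
      · simpa using hs
      · have := congrArg Complex.re h
        simp at this hs
        linarith
    · intro τ hτ
      rw [max_eq_left, zero_div, Complex.ofReal_zero]
      rw [abs_div, abs_of_pos hμ, sub_nonpos, div_div, le_div_iff₀ (by positivity)]
      linarith
    · exact ((integrable_sinc_sq.comp_mul_left' hμ.ne').const_mul μ).ofReal
  have := hBt.comp (Real.tendsto_log_atTop.comp tendsto_natCast_atTop_atTop)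
  refine this.congr' ?_
  filter_upwards [eventually_gt_atTop 0] with n hn
  have hn' : (0 : ℝ) < n := by exact_mod_cast hn
  simp only [Function.comp, hB, hS]
  rw [Real.exp_neg, Real.exp_log hn', Nat.floor_natCast, div_eq_mul_inv]

open MeasureTheory Filter Topology Set in
theorem Ioc_zero_eq_Icc_one (n : ℕ) : Finset.Ioc 0 n = Finset.Icc 1 n := by
  ext k
  simp only [Finset.mem_Ioc, Finset.mem_Icc]
  omega

open MeasureTheory Filter Topology Set in
theorem sum_Icc_vonMangoldt_le (n : ℕ) :
    ∑ k ∈ Finset.Icc 1 n, ArithmeticFunction.vonMangoldt k ≤ (Real.log 4 + 4) * n := by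
  have := Chebyshev.psi_le_const_mul_self (Nat.cast_nonneg n : (0 : ℝ) ≤ n)
  rwa [Chebyshev.psi, Nat.floor_natCast, Ioc_zero_eq_Icc_one] at this

open MeasureTheory Filter Topology Set in
/-- The **prime number theorem** for the Chebyshev function. -/
theorem tendsto_sum_vonMangoldt_div :
    Tendsto (fun n : ℕ => (∑ k ∈ Finset.Icc 1 n, ArithmeticFunction.vonMangoldt k) / (n : ℝ))
      atTop (𝓝 1) := by
  have hres : (ArithmeticFunction.vonMangoldt.residueClass (1 : ZMod 1)) =
      fun n => ArithmeticFunction.vonMangoldt n := by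
    ext n
    exact indicator_of_mem (s := {n : ℕ | (n : ZMod 1) = 1}) (Subsingleton.elim (n : ZMod 1) 1)
      fun n => ArithmeticFunction.vonMangoldt n
  refine tendsto_sum_div_of_LSeries_continuousOn
    (fun n => ArithmeticFunction.vonMangoldt_nonneg) sum_Icc_vonMangoldt_le
    (ArithmeticFunction.vonMangoldt.continuousOn_LFunctionResidueClassAux (1 : ZMod 1))
    fun s hs => ?_
  have := ArithmeticFunction.vonMangoldt.eqOn_LFunctionResidueClassAux
    (q := 1) (a := 1) isUnit_one hs
  rw [hres] at this
  rw [this]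
  simp

open MeasureTheory Filter Topology Set in
/-- Partial summation: removing a logarithmic weight from a sum with linear growth. -/
theorem tendsto_sum_mul_log_div {a : ℕ → ℝ} {M : ℝ} (ha0 : ∀ k, 0 ≤ a k) (haM : ∀ k, a k ≤ M)
    {A : ℝ} (h : Tendsto (fun n : ℕ => (∑ k ∈ Finset.Icc 1 n, a k * Real.log k) / (n : ℝ))
      atTop (𝓝 A)) :
    Tendsto (fun n : ℕ => (∑ k ∈ Finset.Icc 1 n, a k) * Real.log n / (n : ℝ)) atTop (𝓝 A) := by
  have hM : 0 ≤ M := (ha0 0).trans (haM 0)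
  have hlogn : Tendsto (fun n : ℕ => Real.log n) atTop atTop :=
    Real.tendsto_log_atTop.comp tendsto_natCast_atTop_atTop
  have hll : Tendsto (fun n : ℕ => Real.log (Real.log n) / Real.log n) atTop (𝓝 0) :=
    Real.isLittleO_log_id_atTop.tendsto_div_nhds_zero.comp hlogn
  have hup : Tendsto (fun n : ℕ => (∑ k ∈ Finset.Icc 1 n, a k * Real.log k) / (n : ℝ) +
      (M * (Real.log n)⁻¹ + 4 * (Real.log (Real.log n) / Real.log n) *
        ((∑ k ∈ Finset.Icc 1 n, a k * Real.log k) / (n : ℝ)))) atTop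
      (𝓝 (A + (M * 0 + 4 * 0 * A))) :=
    h.add (((tendsto_inv_atTop_zero.comp hlogn).const_mul M).add ((hll.const_mul 4).mul h))
  rw [show A + (M * 0 + 4 * 0 * A) = A by ring] at hup
  refine tendsto_of_tendsto_of_tendsto_of_le_of_le' h hup ?_ ?_
  · refine Eventually.of_forall fun n => ?_
    refine div_le_div_of_nonneg_right ?_ (Nat.cast_nonneg n)
    rw [Finset.sum_mul]
    refine Finset.sum_le_sum fun k hk => mul_le_mul_of_nonneg_left ?_ (ha0 k)
    rw [Finset.mem_Icc] at hk
    exact Real.log_le_log (by exact_mod_cast hk.1) (by exact_mod_cast hk.2)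
  · filter_upwards [hlogn.eventually_gt_atTop 1, hll.eventually (gt_mem_nhds
      (show (0 : ℝ) < 1 / 4 by norm_num)), eventually_gt_atTop 0] with n hL hl4 hn
    have hn' : (0 : ℝ) < n := by exact_mod_cast hn
    set L := Real.log n with hLdef
    have hL0 : 0 < L := by linarith
    set l := Real.log L with hl
    have hl0 : 0 < l := Real.log_pos hL
    rw [div_lt_iff₀ hL0] at hl4
    have hpt : ∀ k ∈ Finset.Icc 1 n, a k * L ≤ a k * Real.log k +
        ((if (k : ℝ) ≤ n / L ^ 2 then M * L else 0) + 4 * (l / L) * (a k * Real.log k)) := by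
      intro k hk
      rw [Finset.mem_Icc] at hk
      have hk1 : (1 : ℝ) ≤ k := by exact_mod_cast hk.1
      have hlk : 0 ≤ Real.log k := Real.log_nonneg hk1
      have h4 : 0 ≤ 4 * (l / L) * (a k * Real.log k) := by
        have := ha0 k
        positivity
      split_ifs with hkn
      · have h1 : a k * L ≤ M * L := mul_le_mul_of_nonneg_right (haM k) hL0.le
        have h2 : 0 ≤ a k * Real.log k := mul_nonneg (ha0 k) hlk
        linarith
      · rw [not_le, div_lt_iff₀ (by positivity)] at hkn
        have h1 : L ≤ Real.log k + 2 * l := by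
          have := Real.log_le_log hn' hkn.le
          rw [Real.log_mul (by positivity) (by positivity), Real.log_pow] at this
          exact_mod_cast this
        have h2 : L / 2 ≤ Real.log k := by linarith
        have h3 : 2 * l ≤ 4 * (l / L) * Real.log k := by
          have : 4 * (l / L) * (L / 2) ≤ 4 * (l / L) * Real.log k :=
            mul_le_mul_of_nonneg_left h2 (by positivity)
          refine le_trans (le_of_eq ?_) this
          field_simp
          norm_num
        have h5 := mul_le_mul_of_nonneg_left (show L ≤ Real.log k + 4 * (l / L) * Real.log k by
          linarith) (ha0 k)
        linarith
    have hsum := Finset.sum_le_sum hpt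
    rw [← Finset.sum_mul, Finset.sum_add_distrib, Finset.sum_add_distrib, ← Finset.mul_sum,
      ← Finset.sum_filter, Finset.sum_const, nsmul_eq_mul] at hsum
    have hcard : (((Finset.Icc 1 n).filter fun k : ℕ => (k : ℝ) ≤ n / L ^ 2).card : ℝ) ≤
        n / L ^ 2 := by
      have hsub : ((Finset.Icc 1 n).filter fun k : ℕ => (k : ℝ) ≤ n / L ^ 2) ⊆
          Finset.Icc 1 ⌊(n : ℝ) / L ^ 2⌋₊ := by
        intro k hk
        rw [Finset.mem_filter, Finset.mem_Icc] at hk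
        exact Finset.mem_Icc.2 ⟨hk.1.1, Nat.le_floor hk.2⟩
      have := Finset.card_le_card hsub
      rw [Nat.card_Icc, Nat.add_sub_cancel] at this
      exact (Nat.cast_le.2 this).trans (Nat.floor_le (by positivity))
    have hcard' := mul_le_mul_of_nonneg_right hcard (show 0 ≤ M * L by positivity)
    rw [div_le_iff₀ hn']
    refine hsum.trans ?_
    have e1 : n / L ^ 2 * (M * L) = M * L⁻¹ * n := by field_simp
    have e2 : ∀ Θ : ℝ, (Θ / n + (M * L⁻¹ + 4 * (l / L) * (Θ / n))) * n =
        Θ + (M * L⁻¹ * n + 4 * (l / L) * Θ) := by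
      intro Θ
      field_simp
    rw [e2]
    linarith

open MeasureTheory Filter Topology Set in
theorem tendsto_sum_prime_div {f : ℕ → ℝ} {C : ℝ}
    (hf : ∀ k, |f k| ≤ C * ArithmeticFunction.vonMangoldt k) {A : ℝ}
    (h : Tendsto (fun n : ℕ => (∑ k ∈ Finset.Icc 1 n, f k) / (n : ℝ)) atTop (𝓝 A)) :
    Tendsto (fun n : ℕ => (∑ k ∈ Finset.Icc 1 n, if k.Prime then f k else 0) / (n : ℝ))
      atTop (𝓝 A) := by
  have hC : 0 ≤ C := by
    have := (abs_nonneg _).trans (hf 2)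
    rw [ArithmeticFunction.vonMangoldt_apply_prime Nat.prime_two] at this
    exact nonneg_of_mul_nonneg_left this (Real.log_pos (by norm_num))
  have hz : Tendsto (fun n : ℕ => (∑ k ∈ Finset.Icc 1 n, if k.Prime then 0 else f k) / (n : ℝ))
      atTop (𝓝 0) := by
    have hlim : Tendsto (fun n : ℕ => C * (2 * (Real.log n / (n : ℝ) ^ (1 / 2 : ℝ)))) atTop
        (𝓝 (C * (2 * 0))) := by
      refine ((Tendsto.const_mul 2 ?_)).const_mul C
      exact (isLittleO_log_rpow_atTop (show (0 : ℝ) < 1 / 2 by norm_num)).tendsto_div_nhds_zero.comp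
        tendsto_natCast_atTop_atTop
    rw [mul_zero, mul_zero] at hlim
    refine squeeze_zero_norm' ?_ hlim
    filter_upwards [eventually_ge_atTop 1] with n hn
    have hn' : (1 : ℝ) ≤ n := by exact_mod_cast hn
    have h1 := Chebyshev.abs_psi_sub_theta_le_sqrt_mul_log hn'
    rw [Chebyshev.psi, Chebyshev.theta, Nat.floor_natCast, Ioc_zero_eq_Icc_one, Finset.sum_filter,
      ← Finset.sum_sub_distrib] at h1
    have h2 : |∑ k ∈ Finset.Icc 1 n, if k.Prime then 0 else f k| ≤
        C * ∑ k ∈ Finset.Icc 1 n, (ArithmeticFunction.vonMangoldt k -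
          if k.Prime then Real.log k else 0) := by
      refine (Finset.abs_sum_le_sum_abs _ _).trans ?_
      rw [Finset.mul_sum]
      refine Finset.sum_le_sum fun k _ => ?_
      split_ifs with hk
      · rw [ArithmeticFunction.vonMangoldt_apply_prime hk]
        simp
      · rw [sub_zero]
        exact hf k
    rw [norm_div, Real.norm_eq_abs, Real.norm_of_nonneg (Nat.cast_nonneg n),
      div_le_iff₀ (by linarith)]
    refine h2.trans ?_
    rw [mul_assoc]
    refine mul_le_mul_of_nonneg_left (((le_abs_self _).trans h1).trans (le_of_eq ?_)) hC
    rw [← Real.sqrt_eq_rpow]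
    have hs : 0 < √(n : ℝ) := Real.sqrt_pos.2 (by linarith)
    have hs2 : √(n : ℝ) * √(n : ℝ) = n := Real.mul_self_sqrt (by linarith)
    field_simp
    rw [pow_two, hs2, mul_comm]

  have := h.sub hz
  rw [sub_zero] at this
  refine this.congr fun n => ?_
  rw [← sub_div, ← Finset.sum_sub_distrib]
  congr 1
  refine Finset.sum_congr rfl fun k _ => ?_
  split_ifs <;> simp

open MeasureTheory Filter Topology Set in
theorem ncard_setOf_le_eq_sum (P : ℕ → Prop) [DecidablePred P] (hP : ¬ P 0) (n : ℕ) :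
    ({k : ℕ | k ≤ n ∧ P k}.ncard : ℝ) = ∑ k ∈ Finset.Icc 1 n, if P k then (1 : ℝ) else 0 := by
  rw [Finset.sum_boole, ← Set.ncard_coe_finset]
  congr 2
  ext k
  simp only [mem_ofPred_eq, Finset.coe_filter, Finset.mem_Icc]
  constructor
  · rintro ⟨h1, h2⟩
    refine ⟨⟨Nat.pos_of_ne_zero ?_, h1⟩, h2⟩
    rintro rfl
    exact hP h2
  · rintro ⟨⟨_, h1⟩, h2⟩
    exact ⟨h1, h2⟩

open MeasureTheory Filter Topology Set in
/-- Natural density of a set of primes, from the asymptotics of a weighted Chebyshev function. -/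
theorem tendsto_ncard_prime_div {f : ℕ → ℝ} {C : ℝ}
    (hf : ∀ k, |f k| ≤ C * ArithmeticFunction.vonMangoldt k) {A : ℝ}
    (h : Tendsto (fun n : ℕ => (∑ k ∈ Finset.Icc 1 n, f k) / (n : ℝ)) atTop (𝓝 A))
    {P : ℕ → Prop} {c : ℝ} (hc : 0 < c)
    (hP : ∀ p, p.Prime → P p → f p = c * Real.log p) (hP' : ∀ p, p.Prime → ¬ P p → f p = 0) :
    Tendsto (fun n : ℕ => ({p : ℕ | p ≤ n ∧ p.Prime ∧ P p}.ncard : ℝ) /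
      ({p : ℕ | p ≤ n ∧ p.Prime}.ncard : ℝ)) atTop (𝓝 (A / c)) := by
  classical
  have key {f : ℕ → ℝ} {C : ℝ} (hf : ∀ k, |f k| ≤ C * ArithmeticFunction.vonMangoldt k) {A : ℝ}
    (h : Tendsto (fun n : ℕ => (∑ k ∈ Finset.Icc 1 n, f k) / (n : ℝ)) atTop (𝓝 A))
    {P : ℕ → Prop} {c : ℝ} (hc : 0 < c)
    (hP : ∀ p, p.Prime → P p → f p = c * Real.log p) (hP' : ∀ p, p.Prime → ¬ P p → f p = 0) :
    Tendsto (fun n : ℕ => ({p : ℕ | p ≤ n ∧ p.Prime ∧ P p}.ncard : ℝ) * Real.log n / n) atTop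
      (𝓝 (A / c)) := by
    have h1 := (tendsto_sum_prime_div hf h).div_const c
    have h2 : Tendsto (fun n : ℕ => (∑ k ∈ Finset.Icc 1 n,
        (if k.Prime ∧ P k then (1 : ℝ) else 0) * Real.log k) / (n : ℝ)) atTop (𝓝 (A / c)) := by
      refine h1.congr fun n => ?_
      rw [div_right_comm, Finset.sum_div]
      congr 1
      refine Finset.sum_congr rfl fun k _ => ?_
      by_cases hk : k.Prime
      · by_cases hPk : P k
        · rw [if_pos hk, if_pos ⟨hk, hPk⟩, hP k hk hPk]
          field_simp
        · rw [if_pos hk, if_neg fun h => hPk h.2, hP' k hk hPk]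
          simp
      · rw [if_neg hk, if_neg fun h => hk h.1]
        simp
    refine (tendsto_sum_mul_log_div (M := 1) (fun k => ?_) (fun k => ?_) h2).congr fun n => ?_
    · split_ifs <;> norm_num
    · split_ifs <;> norm_num
    · rw [ncard_setOf_le_eq_sum _ fun h => Nat.not_prime_zero h.1]
  have hS := key hf h hc hP hP'
  have hpi := key (f := fun k => ArithmeticFunction.vonMangoldt k) (C := 1) (fun k => by
    rw [abs_of_nonneg ArithmeticFunction.vonMangoldt_nonneg, one_mul]) tendsto_sum_vonMangoldt_div
    (P := fun _ => True) one_pos (fun p hp _ => by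
      rw [one_mul, ArithmeticFunction.vonMangoldt_apply_prime hp]) (by simp)
  have hq := hS.div hpi (by norm_num)
  rw [div_one, div_one] at hq
  refine hq.congr' ?_
  filter_upwards [eventually_gt_atTop 1] with n hn
  have hn' : (1 : ℝ) < n := by exact_mod_cast hn
  have hlog : Real.log n ≠ 0 := (Real.log_pos hn').ne'
  simp only [and_true, Pi.div_apply]
  rw [mul_div_assoc, mul_div_assoc _ _ (n : ℝ), mul_div_mul_right]
  exact div_ne_zero hlog (by linarith)

open MeasureTheory Filter Topology Set in
/-- An `L`-series whose partial sums are `c n + O(√n)` continues to `1 / 2 < re s`, up to the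
principal part `c / (s - 1)`. -/
theorem exists_LSeries_eq_add_div {a : ℕ → ℂ} {c : ℂ} {K C : ℝ}
    (hS : ∀ n : ℕ, ‖∑ k ∈ Finset.Icc 1 n, a k - c * n‖ ≤ K * √n)
    (hC : ∀ n : ℕ, ∑ k ∈ Finset.Icc 1 n, ‖a k‖ ≤ C * n) :
    ∃ E : ℂ → ℂ, DifferentiableOn ℂ E {s | 1 / 2 < s.re} ∧
      ∀ s : ℂ, 1 < s.re → LSeries a s = E s + c / (s - 1) := by
  have hK : 0 ≤ K := by
    have := (norm_nonneg _).trans (hS 1)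
    simpa using this
  set S : ℝ → ℂ := fun t => ∑ k ∈ Finset.Icc 1 ⌊t⌋₊, a k with hSdef
  have hSm : Measurable S :=
    (measurable_from_nat (f := fun n => ∑ k ∈ Finset.Icc 1 n, a k)).comp Nat.measurable_floor
  set f : ℝ → ℂ := (Ioi (1 : ℝ)).indicator fun t => S t - c * t with hf
  have hfm : Measurable f :=
    (hSm.sub (Complex.measurable_ofReal.const_mul c)).indicator measurableSet_Ioi
  have hfb (t : ℝ) : ‖f t‖ ≤ (K + ‖c‖) * √t := by
    simp only [hf]
    by_cases ht : 1 < t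
    · rw [indicator_of_mem (by exact ht)]
      have hfl : (⌊t⌋₊ : ℝ) ≤ t := Nat.floor_le (by linarith)
      have h1 : ‖S t - c * ⌊t⌋₊‖ ≤ K * √t :=
        (hS _).trans (mul_le_mul_of_nonneg_left (Real.sqrt_le_sqrt hfl) hK)
      have h2 : ‖c * ((⌊t⌋₊ : ℝ) - t : ℝ)‖ ≤ ‖c‖ * √t := by
        rw [norm_mul, Complex.norm_real]
        refine mul_le_mul_of_nonneg_left ?_ (norm_nonneg c)
        have h3 : 1 ≤ √t := Real.one_le_sqrt.2 ht.le
        have h4 := Nat.lt_floor_add_one t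
        rw [Real.norm_eq_abs, abs_le]
        constructor <;> linarith
      have e : S t - c * t = (S t - c * ⌊t⌋₊) + c * ((⌊t⌋₊ : ℝ) - t : ℝ) := by
        push_cast
        ring
      rw [e, add_mul]
      exact (norm_add_le _ _).trans (add_le_add h1 h2)
    · rw [indicator_of_notMem (by exact ht), norm_zero]
      positivity
  have hfl : LocallyIntegrableOn f (Ioi 0) := by
    have h1 : LocallyIntegrable (fun t : ℝ => (K + ‖c‖) * √t) :=
      Continuous.locallyIntegrable (by fun_prop)
    refine (h1.locallyIntegrableOn _).mono hfm.aestronglyMeasurable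
      (Eventually.of_forall fun t => (hfb t).trans (le_abs_self _))
  have hdiff (s : ℂ) (hs : 1 / 2 < s.re) : DifferentiableAt ℂ (mellin f) (-s) := by
    refine mellin_differentiableAt_of_isBigO_rpow (a := -(1 / 2)) (b := (-s).re - 1) hfl ?_ ?_ ?_ ?_
    · refine Asymptotics.IsBigO.of_bound (K + ‖c‖) ?_
      filter_upwards [eventually_ge_atTop 0] with t ht
      rw [neg_neg, ← Real.sqrt_eq_rpow, Real.norm_of_nonneg (Real.sqrt_nonneg t)]
      exact hfb t
    · simpa using hs
    · refine (Asymptotics.isBigO_zero _ _).congr' ?_ EventuallyEq.rfl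
      have : Iio (1 : ℝ) ∈ 𝓝[>] (0 : ℝ) :=
        mem_nhdsWithin_of_mem_nhds (Iio_mem_nhds (by norm_num))
      filter_upwards [this] with t ht
      rw [hf, indicator_of_notMem]
      simpa using (mem_Iio.1 ht).le
    · linarith
  refine ⟨fun s => c + s * mellin f (-s), ?_, ?_⟩
  · intro s hs
    refine DifferentiableAt.differentiableWithinAt ?_
    exact (differentiableAt_id.mul ((hdiff s hs).comp s differentiableAt_id.neg)).const_add c
  · intro s hs
    have hs0 : s - 1 ≠ 0 := by
      intro h
      have := congrArg Complex.re h
      simp at this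
      linarith
    have hsre : (-(s + 1) + 1).re = - s.re := by simp
    have hL : LSeries a s = s * ∫ t in Ioi (1 : ℝ), S t * (t : ℂ) ^ (-(s + 1)) := by
      refine LSeries_eq_mul_integral' a zero_le_one hs ?_
      refine Asymptotics.IsBigO.of_bound C (Eventually.of_forall fun n => ?_)
      rw [Real.norm_of_nonneg (Finset.sum_nonneg fun k _ => norm_nonneg _), Real.rpow_one,
        Real.norm_of_nonneg (Nat.cast_nonneg n)]
      exact hC n
    have hm : mellin f (-s) = ∫ t in Ioi (1 : ℝ), (S t - c * t) * (t : ℂ) ^ (-(s + 1)) := by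
      have : (∫ t in Ioi (1 : ℝ), (S t - c * t) * (t : ℂ) ^ (-(s + 1))) =
          ∫ t in Ioi (0 : ℝ), (Ioi (1 : ℝ)).indicator
            (fun t : ℝ => (S t - c * t) * (t : ℂ) ^ (-(s + 1))) t := by
        rw [setIntegral_indicator measurableSet_Ioi]
        congr 2
        rw [Ioi_inter_Ioi, max_eq_right zero_le_one]
      rw [this, mellin]
      refine setIntegral_congr_fun measurableSet_Ioi fun t _ => ?_
      simp only [smul_eq_mul, hf]
      by_cases ht : 1 < t
      · rw [indicator_of_mem (by exact ht), indicator_of_mem (by exact ht), mul_comm]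
        congr 2
        ring
      · rw [indicator_of_notMem (by exact ht), indicator_of_notMem (by exact ht), mul_zero]
    have hi1 : IntegrableOn (fun t : ℝ => (S t - c * t) * (t : ℂ) ^ (-(s + 1))) (Ioi 1) := by
      have hb : IntegrableOn (fun t : ℝ => (K + ‖c‖) * t ^ (-(s.re + 1) + 1 / 2)) (Ioi 1) :=
        (integrableOn_Ioi_rpow_of_lt (by linarith) one_pos).const_mul _
      refine Integrable.mono' hb ?_ ?_
      · refine ((hSm.sub (Complex.measurable_ofReal.const_mul c)).mul ?_).aestronglyMeasurable
        exact Complex.measurable_ofReal.pow_const _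
      · refine (ae_restrict_mem measurableSet_Ioi).mono fun t ht => ?_
        have ht0 : 0 < t := zero_lt_one.trans ht
        have h1 := hfb t
        rw [hf, indicator_of_mem (by exact ht)] at h1
        rw [norm_mul, Complex.norm_cpow_eq_rpow_re_of_pos ht0, Real.rpow_add ht0,
          ← Real.sqrt_eq_rpow]
        refine (mul_le_mul_of_nonneg_right h1 (Real.rpow_nonneg ht0.le _)).trans (le_of_eq ?_)
        simp only [Complex.neg_re, Complex.add_re, Complex.one_re]
        ring
    have e2 (t : ℝ) (ht : t ∈ Ioi (1 : ℝ)) :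
        c * t * (t : ℂ) ^ (-(s + 1)) = c * (t : ℂ) ^ (-s) := by
      have ht0 : (t : ℂ) ≠ 0 := by exact_mod_cast (zero_lt_one.trans ht).ne'
      rw [show -s = -(s + 1) + 1 by ring, Complex.cpow_add _ _ ht0, Complex.cpow_one]
      ring
    have hi2' : IntegrableOn (fun t : ℝ => c * (t : ℂ) ^ (-s)) (Ioi 1) :=
      (integrableOn_Ioi_cpow_of_lt (by simpa using hs) one_pos).const_mul c
    have hi2 : IntegrableOn (fun t : ℝ => c * t * (t : ℂ) ^ (-(s + 1))) (Ioi 1) :=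
      hi2'.congr_fun (fun t ht => (e2 t ht).symm) measurableSet_Ioi
    have h2 : ∫ t in Ioi (1 : ℝ), c * t * (t : ℂ) ^ (-(s + 1)) = c / (s - 1) := by
      rw [setIntegral_congr_fun measurableSet_Ioi e2, integral_const_mul,
        integral_Ioi_cpow_of_lt (by simpa using hs) one_pos, Complex.ofReal_one, Complex.one_cpow,
        show -s + 1 = -(s - 1) by ring, neg_div_neg_eq]
      ring
    have hsplit : ∫ t in Ioi (1 : ℝ), S t * (t : ℂ) ^ (-(s + 1)) = mellin f (-s) + c / (s - 1) := by
      rw [hm, ← h2, ← integral_add hi1 hi2]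
      refine setIntegral_congr_fun measurableSet_Ioi fun t _ => ?_
      ring
    rw [hL, hsplit]
    field_simp
    ring

open MeasureTheory Filter Topology Set in
theorem exists_tendsto_mul_logDeriv {E : ℂ → ℂ} {z : ℂ} (hE : AnalyticAt ℂ E z)
    (hne : ¬ ∀ᶠ s in 𝓝 z, E s = 0) :
    ∃ m : ℕ, (m = 0 ↔ E z ≠ 0) ∧ (∀ᶠ s in 𝓝[≠] z, E s ≠ 0) ∧
      Tendsto (fun s => (s - z) * (deriv E s / E s)) (𝓝[≠] z) (𝓝 m) := by
  obtain ⟨m, h, hh, hz, hEq⟩ := hE.exists_eventuallyEq_pow_smul_nonzero_iff.2 hne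
  have hEq' : ∀ᶠ s in 𝓝[≠] z, E s = (s - z) ^ m * h s ∧
      deriv E s = deriv (fun s => (s - z) ^ m * h s) s ∧ h s ≠ 0 ∧ DifferentiableAt ℂ h s ∧
        s ≠ z := by
    have h1 := hEq.eventually_nhds
    have h2 := hh.continuousAt.eventually_ne hz
    have h3 := hh.eventually_analyticAt
    filter_upwards [nhdsWithin_le_nhds h1, nhdsWithin_le_nhds h2, nhdsWithin_le_nhds h3,
      self_mem_nhdsWithin] with s a1 a2 a3 a4
    exact ⟨a1.self_of_nhds, EventuallyEq.deriv_eq a1, a2, a3.differentiableAt, a4⟩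
  refine ⟨m, ?_, ?_, ?_⟩
  · rw [hEq.self_of_nhds]
    rcases Nat.eq_zero_or_pos m with rfl | hm
    · simpa using hz
    · simp [hm.ne']
  · filter_upwards [hEq'] with s hs
    rw [hs.1]
    exact mul_ne_zero (pow_ne_zero _ (sub_ne_zero.2 hs.2.2.2.2)) hs.2.2.1
  · have hlim : Tendsto (fun s => (m : ℂ) + (s - z) * (deriv h s / h s)) (𝓝[≠] z)
        (𝓝 (m + (z - z) * (deriv h z / h z))) := by
      refine Tendsto.mono_left ?_ nhdsWithin_le_nhds
      have : ContinuousAt (fun s => (m : ℂ) + (s - z) * (deriv h s / h s)) z := by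
        refine continuousAt_const.add ((continuousAt_id.sub continuousAt_const).mul
          (hh.deriv.continuousAt.div hh.continuousAt hz))
      exact this
    rw [sub_self, zero_mul, add_zero] at hlim
    refine hlim.congr' ?_
    filter_upwards [hEq'] with s hs
    obtain ⟨h1, h2, h3, h4, h5⟩ := hs
    have hsz : s - z ≠ 0 := sub_ne_zero.2 h5
    have hd : deriv (fun s => (s - z) ^ m * h s) s =
        m * (s - z) ^ (m - 1) * h s + (s - z) ^ m * deriv h s := by
      have hp : HasDerivAt (fun s : ℂ => (s - z) ^ m) (m * (s - z) ^ (m - 1) * 1) s :=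
        ((hasDerivAt_id s).sub_const z).pow m
      rw [mul_one] at hp
      exact (hp.mul h4.hasDerivAt).deriv
    rw [h1, h2, hd]
    rcases Nat.eq_zero_or_pos m with rfl | hm
    · field_simp
      simp
    · have e : (s - z) ^ m = (s - z) ^ (m - 1) * (s - z) := by
        rw [← pow_succ, Nat.sub_add_cancel hm]
      rw [e]
      have := pow_ne_zero (m - 1) hsz
      field_simp

/-- The sum of `ψ (φ m)` over the multisets `m` of primes with norm `n`. -/
noncomputable def normCoeff {P A : Type*} [AddCommMonoid A] (N : P → ℕ) (φ : P → A) (ψ : A → ℂ)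
    (n : ℕ) : ℂ :=
  ∑ᶠ m ∈ {m : Multiset P | (m.map N).prod = n}, ψ (m.map φ).sum

/-- The sum of `ψ (k φ(p)) log (N p)` over the prime powers `p ^ k` with norm `n`. -/
noncomputable def mangoldtCoeff {P A : Type*} [AddCommMonoid A] (N : P → ℕ) (φ : P → A)
    (ψ : A → ℂ) (n : ℕ) : ℂ :=
  ∑ᶠ e ∈ {e : P × ℕ | 0 < e.2 ∧ N e.1 ^ e.2 = n}, ψ (e.2 • φ e.1) * Real.log (N e.1)

theorem finite_primePowers_of_norm {P : Type*} {N : P → ℕ}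
    (hfin : ∀ n, {m : Multiset P | (m.map N).prod = n}.Finite) (n : ℕ) :
    {e : P × ℕ | 0 < e.2 ∧ N e.1 ^ e.2 = n}.Finite := by
  refine Set.Finite.of_finite_image (f := fun e : P × ℕ => Multiset.replicate e.2 e.1)
    ((hfin n).subset ?_) ?_
  · rintro _ ⟨e, ⟨_, he⟩, rfl⟩
    simpa using he
  · rintro ⟨p, k⟩ ⟨hk, _⟩ ⟨p', k'⟩ ⟨hk', _⟩ h
    simp only at h hk hk'
    have h1 := congrArg Multiset.card h
    simp only [Multiset.card_replicate] at h1
    subst h1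
    have h2 : p ∈ Multiset.replicate k p' := by
      rw [← h]
      exact Multiset.mem_replicate.2 ⟨hk.ne', rfl⟩
    rw [Multiset.eq_of_mem_replicate h2]

theorem log_prod_map_eq_sum {P : Type*} [DecidableEq P] {N : P → ℕ} (hN : ∀ p, 2 ≤ N p)
    (m : Multiset P) :
    Real.log ((m.map N).prod : ℕ) =
      ∑ p ∈ m.toFinset, ∑ _k ∈ Finset.Icc 1 (m.count p), Real.log (N p) := by
  have h1 : ∀ m : Multiset P, Real.log ((m.map N).prod : ℕ) =
      (m.map fun p => Real.log (N p)).sum := by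
    intro m
    induction m using Multiset.induction_on with
    | empty => simp
    | cons p m ih =>
      rw [Multiset.map_cons, Multiset.prod_cons, Multiset.map_cons, Multiset.sum_cons, ← ih,
        Nat.cast_mul, Real.log_mul]
      · exact_mod_cast (by have := hN p; omega : N p ≠ 0)
      · rw [Nat.cast_ne_zero]
        refine Multiset.prod_ne_zero fun h => ?_
        obtain ⟨p, _, hp⟩ := Multiset.mem_map.1 h
        have := hN p
        omega
  rw [h1, Finset.sum_multiset_map_count]
  refine Finset.sum_congr rfl fun p _ => ?_
  simp

theorem normCoeff_mul_log {P A : Type*} [AddCommGroup A] {N : P → ℕ} (φ : P → A)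
    (hN : ∀ p, 2 ≤ N p) (hfin : ∀ n, {m : Multiset P | (m.map N).prod = n}.Finite)
    (ψ : AddChar A ℂ) (n : ℕ) :
    normCoeff N φ ψ n * Real.log n =
      ∑ d ∈ n.divisorsAntidiagonal, mangoldtCoeff N φ ψ d.1 * normCoeff N φ ψ d.2 := by
  classical
  have hE := finite_primePowers_of_norm hfin
  simp only [normCoeff, mangoldtCoeff]
  simp only [finsum_mem_eq_finite_toFinset_sum _ (hfin _), finsum_mem_eq_finite_toFinset_sum _ (hE _)]
  simp only [Finset.sum_mul_sum, ← Finset.sum_product']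
  rw [Finset.sum_mul, Finset.sum_sigma']
  have hlhs : ∑ m ∈ (hfin n).toFinset, ψ (m.map φ).sum * (Real.log n : ℂ) =
      ∑ x ∈ (hfin n).toFinset.sigma fun m => m.toFinset.sigma fun p => Finset.Icc 1 (m.count p),
        ψ (x.1.map φ).sum * (Real.log (N x.2.1) : ℂ) := by
    rw [Finset.sum_sigma]
    refine Finset.sum_congr rfl fun m hm => ?_
    rw [Set.Finite.mem_toFinset, Set.mem_ofPred_eq] at hm
    rw [← hm, log_prod_map_eq_sum hN, Finset.sum_sigma, Complex.ofReal_sum, Finset.mul_sum]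
    refine Finset.sum_congr rfl fun p _ => ?_
    rw [Complex.ofReal_sum, Finset.mul_sum]
  rw [hlhs]
  refine Finset.sum_bij' (i := fun x _ => ⟨(N x.2.1 ^ x.2.2,
      ((x.1 - Multiset.replicate x.2.2 x.2.1).map N).prod), ((x.2.1, x.2.2),
      x.1 - Multiset.replicate x.2.2 x.2.1)⟩)
    (j := fun y _ => ⟨y.2.2 + Multiset.replicate y.2.1.2 y.2.1.1, y.2.1.1, y.2.1.2⟩) ?_ ?_ ?_ ?_ ?_
  · rintro ⟨m, p, k⟩ h
    simp only [Finset.mem_sigma, Set.Finite.mem_toFinset, Set.mem_ofPred_eq,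
      Multiset.mem_toFinset, Finset.mem_Icc] at h
    obtain ⟨hm, hp, hk1, hk2⟩ := h
    have hle : Multiset.replicate k p ≤ m := Multiset.le_count_iff_replicate_le.1 hk2
    have hn : N p ^ k * ((m - Multiset.replicate k p).map N).prod = n := by
      conv_rhs => rw [← hm, ← Multiset.sub_add_cancel hle, Multiset.map_add, Multiset.prod_add,
        Multiset.map_replicate, Multiset.prod_replicate, mul_comm]
    have hn0 : n ≠ 0 := by
      rw [← hm]
      refine Multiset.prod_ne_zero fun h => ?_
      obtain ⟨p, _, hp⟩ := Multiset.mem_map.1 h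
      have := hN p
      omega
    simp only [Finset.mem_sigma, Nat.mem_divisorsAntidiagonal, Finset.mem_product,
      Set.Finite.mem_toFinset, Set.mem_ofPred_eq]
    exact ⟨⟨hn, hn0⟩, ⟨hk1, trivial⟩, trivial⟩
  · rintro ⟨⟨d, e⟩, ⟨p, k⟩, m⟩ h
    simp only [Finset.mem_sigma, Nat.mem_divisorsAntidiagonal, Finset.mem_product,
      Set.Finite.mem_toFinset, Set.mem_ofPred_eq] at h
    obtain ⟨⟨hde, hn0⟩, ⟨hk, hd⟩, he⟩ := h
    simp only [Finset.mem_sigma, Set.Finite.mem_toFinset, Set.mem_ofPred_eq,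
      Multiset.mem_toFinset, Finset.mem_Icc]
    refine ⟨?_, ?_, hk, ?_⟩
    · rw [Multiset.map_add, Multiset.prod_add, Multiset.map_replicate, Multiset.prod_replicate,
        he, hd, mul_comm, hde]
    · exact Multiset.mem_add.2 (Or.inr (Multiset.mem_replicate.2 ⟨hk.ne', rfl⟩))
    · rw [Multiset.count_add, Multiset.count_replicate_self]
      omega
  · rintro ⟨m, p, k⟩ h
    simp only [Finset.mem_sigma, Set.Finite.mem_toFinset, Set.mem_ofPred_eq,
      Multiset.mem_toFinset, Finset.mem_Icc] at h
    have hle : Multiset.replicate k p ≤ m := Multiset.le_count_iff_replicate_le.1 h.2.2.2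
    simp only [Multiset.sub_add_cancel hle]
  · rintro ⟨⟨d, e⟩, ⟨p, k⟩, m⟩ h
    simp only [Finset.mem_sigma, Nat.mem_divisorsAntidiagonal, Finset.mem_product,
      Set.Finite.mem_toFinset, Set.mem_ofPred_eq] at h
    obtain ⟨⟨hde, hn0⟩, ⟨hk, hd⟩, he⟩ := h
    subst hd he
    simp only [Multiset.add_sub_cancel_right]
  · rintro ⟨m, p, k⟩ h
    simp only [Finset.mem_sigma, Set.Finite.mem_toFinset, Set.mem_ofPred_eq,
      Multiset.mem_toFinset, Finset.mem_Icc] at h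
    have hle : Multiset.replicate k p ≤ m := Multiset.le_count_iff_replicate_le.1 h.2.2.2
    have : (m.map φ).sum = k • φ p + ((m - Multiset.replicate k p).map φ).sum := by
      conv_lhs => rw [← Multiset.sub_add_cancel hle, Multiset.map_add, Multiset.sum_add,
        Multiset.map_replicate, Multiset.sum_replicate, add_comm]
    simp only [this, AddChar.map_add_eq_mul]
    ring

open MeasureTheory Filter Topology Set in
theorem normCoeff_eq_sum {P A : Type*} [AddCommGroup A] {N : P → ℕ} (φ : P → A)
    (hfin : ∀ n, {m : Multiset P | (m.map N).prod = n}.Finite) (ψ : A → ℂ) (n : ℕ) :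
    normCoeff N φ ψ n = ∑ m ∈ (hfin n).toFinset, ψ (m.map φ).sum :=
  finsum_mem_eq_finite_toFinset_sum _ (hfin n)

theorem normCoeff_one {P A : Type*} [AddCommGroup A] {N : P → ℕ} (φ : P → A)
    (hN : ∀ p, 2 ≤ N p) (ψ : AddChar A ℂ) : normCoeff N φ ψ 1 = 1 := by
  have : {m : Multiset P | (m.map N).prod = 1} = {0} := by
    ext m
    simp only [Set.mem_ofPred_eq, Set.mem_singleton_iff]
    constructor
    · intro h
      by_contra h0
      obtain ⟨p, hp⟩ := Multiset.exists_mem_of_ne_zero h0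
      have h1 : N p ∣ 1 := h ▸ Multiset.dvd_prod (Multiset.mem_map_of_mem N hp)
      have := hN p
      have := Nat.dvd_one.1 h1
      omega
    · rintro rfl
      simp
  rw [normCoeff, this, finsum_mem_singleton]
  simp

open MeasureTheory Filter Topology Set in
theorem sum_normCoeff {P A : Type*} [AddCommGroup A] [Fintype A] {N : P → ℕ} (φ : P → A)
    (hN : ∀ p, 2 ≤ N p) (hfin : ∀ n, {m : Multiset P | (m.map N).prod = n}.Finite)
    (ψ : A → ℂ) (x : ℕ) :
    ∑ n ∈ Finset.Icc 1 x, normCoeff N φ ψ n =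
      ∑ a, ψ a * ({m : Multiset P | (m.map N).prod ≤ x ∧ (m.map φ).sum = a}.ncard : ℂ) := by
  classical
  have hpos (m : Multiset P) : 1 ≤ (m.map N).prod := by
    refine Nat.pos_of_ne_zero (Multiset.prod_ne_zero fun h => ?_)
    obtain ⟨p, _, hp⟩ := Multiset.mem_map.1 h
    have := hN p
    omega
  set F : Finset (Multiset P) := (Finset.Icc 1 x).biUnion fun n => (hfin n).toFinset with hF
  have hmem (m : Multiset P) : m ∈ F ↔ (m.map N).prod ≤ x := by
    simp only [hF, Finset.mem_biUnion, Finset.mem_Icc, Set.Finite.mem_toFinset, mem_ofPred_eq]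
    exact ⟨fun ⟨n, hn, h⟩ => h ▸ hn.2, fun h => ⟨_, ⟨hpos m, h⟩, rfl⟩⟩
  calc _ = ∑ m ∈ F, ψ (m.map φ).sum := by
        rw [hF, Finset.sum_biUnion]
        · exact Finset.sum_congr rfl fun n _ => normCoeff_eq_sum φ hfin ψ n
        · intro i _ j _ hij
          rw [Function.onFun, Finset.disjoint_left]
          intro m hi hj
          rw [Set.Finite.mem_toFinset, mem_ofPred_eq] at hi hj
          exact hij (hi.symm.trans hj)
    _ = ∑ a, ∑ m ∈ F with (m.map φ).sum = a, ψ (m.map φ).sum :=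
        (Finset.sum_fiberwise F (fun m => (m.map φ).sum) _).symm
    _ = _ := by
        refine Finset.sum_congr rfl fun a _ => ?_
        rw [Finset.sum_congr rfl (g := fun _ => ψ a) fun m hm => by
          rw [(Finset.mem_filter.1 hm).2], Finset.sum_const, nsmul_eq_mul, mul_comm,
          ← Set.ncard_coe_finset]
        congr 3
        ext m
        simp only [Finset.coe_filter, mem_ofPred_eq, hmem]

open MeasureTheory Filter Topology Set in
theorem norm_normCoeff_le {P A : Type*} [AddCommGroup A] [Finite A] {N : P → ℕ} (φ : P → A)
    (hfin : ∀ n, {m : Multiset P | (m.map N).prod = n}.Finite) (ψ : AddChar A ℂ) (n : ℕ) :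
    ‖normCoeff N φ ψ n‖ ≤ (normCoeff N φ (fun _ => 1) n).re := by
  rw [normCoeff_eq_sum φ hfin, normCoeff_eq_sum φ hfin, Complex.re_sum]
  refine (norm_sum_le _ _).trans (Finset.sum_le_sum fun m _ => ?_)
  rw [AddChar.norm_apply, Complex.one_re]

open MeasureTheory Filter Topology Set in
theorem sum_norm_normCoeff_le {P A : Type*} [AddCommGroup A] [Fintype A] {N : P → ℕ} {φ : P → A}
    (hN : ∀ p, 2 ≤ N p) (hfin : ∀ n, {m : Multiset P | (m.map N).prod = n}.Finite) {κ K : ℝ}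
    (hcount : ∀ (a : A) (x : ℕ), |({m : Multiset P | (m.map N).prod ≤ x ∧
      (m.map φ).sum = a}.ncard : ℝ) - κ * x| ≤ K * √x) (ψ : AddChar A ℂ) (x : ℕ) :
    ∑ n ∈ Finset.Icc 1 x, ‖normCoeff N φ ψ n‖ ≤ (Fintype.card A * (κ + K)) * x := by
  have hK : 0 ≤ K := by
    have := (abs_nonneg _).trans (hcount 0 1)
    simpa using this
  refine (Finset.sum_le_sum fun n _ => norm_normCoeff_le φ hfin ψ n).trans ?_
  rw [← Complex.re_sum, sum_normCoeff φ hN hfin, Complex.re_sum]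
  have : ∀ a : A, ((1 : ℂ) * ({m : Multiset P | (m.map N).prod ≤ x ∧
      (m.map φ).sum = a}.ncard : ℂ)).re ≤ (κ + K) * x := by
    intro a
    rw [one_mul, Complex.natCast_re]
    have h1 := (abs_le.1 (hcount a x)).2
    have h2 : √(x : ℝ) ≤ x := by
      rcases Nat.eq_zero_or_pos x with rfl | hx
      · simp
      · have : (1 : ℝ) ≤ x := by exact_mod_cast hx
        exact Real.sqrt_le_self_iff.2 (Or.inr this)
    have h3 := mul_le_mul_of_nonneg_left h2 hK
    linarith
  refine (Finset.sum_le_sum fun a _ => this a).trans (le_of_eq ?_)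
  rw [Finset.sum_const, Finset.card_univ, nsmul_eq_mul, mul_assoc]

theorem norm_mangoldtCoeff_le {P A : Type*} [AddCommGroup A] [Finite A] {N : P → ℕ} (φ : P → A)
    (hN : ∀ p, 2 ≤ N p) (hfin : ∀ n, {m : Multiset P | (m.map N).prod = n}.Finite) {C : ℝ}
    (hcheb : ∀ n, ∑ᶠ e ∈ {e : P × ℕ | 0 < e.2 ∧ N e.1 ^ e.2 = n}, Real.log (N e.1) ≤
      C * ArithmeticFunction.vonMangoldt n) (ψ : AddChar A ℂ) (n : ℕ) :
    ‖mangoldtCoeff N φ ψ n‖ ≤ C * ArithmeticFunction.vonMangoldt n := by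
  have hE := finite_primePowers_of_norm hfin
  refine le_trans ?_ (hcheb n)
  rw [mangoldtCoeff, finsum_mem_eq_finite_toFinset_sum _ (hE n),
    finsum_mem_eq_finite_toFinset_sum _ (hE n)]
  refine (norm_sum_le _ _).trans (Finset.sum_le_sum fun e _ => ?_)
  rw [norm_mul, AddChar.norm_apply, one_mul, Complex.norm_real, Real.norm_of_nonneg]
  exact Real.log_nonneg (by exact_mod_cast (by have := hN e.1; omega : 1 ≤ N e.1))

open MeasureTheory Filter Topology Set in
theorem LSeriesSummable_of_sum_norm_le {f : ℕ → ℂ} {C : ℝ}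
    (hf : ∀ n : ℕ, ∑ k ∈ Finset.Icc 1 n, ‖f k‖ ≤ C * n) {s : ℂ} (hs : 1 < s.re) :
    LSeriesSummable f s := by
  refine LSeriesSummable_of_sum_norm_bigO (r := 1) ?_ zero_le_one hs
  refine Asymptotics.IsBigO.of_bound C (Eventually.of_forall fun n => ?_)
  rw [Real.norm_of_nonneg (Finset.sum_nonneg fun k _ => norm_nonneg _), Real.rpow_one,
    Real.norm_of_nonneg (Nat.cast_nonneg n)]
  exact hf n

open MeasureTheory Filter Topology Set in
theorem abscissaOfAbsConv_le_one_of_sum_norm_le {f : ℕ → ℂ} {C : ℝ}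
    (hf : ∀ n : ℕ, ∑ k ∈ Finset.Icc 1 n, ‖f k‖ ≤ C * n) : LSeries.abscissaOfAbsConv f ≤ 1 := by
  have := LSeries.abscissaOfAbsConv_le_of_forall_lt_LSeriesSummable (f := f) (x := 1)
    fun y hy => LSeriesSummable_of_sum_norm_le hf (by simpa using hy)
  simpa using this

theorem sum_norm_mangoldtCoeff_le {P A : Type*} [AddCommGroup A] [Finite A] {N : P → ℕ}
    (φ : P → A)
    (hN : ∀ p, 2 ≤ N p) (hfin : ∀ n, {m : Multiset P | (m.map N).prod = n}.Finite) {C : ℝ}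
    (hcheb : ∀ n, ∑ᶠ e ∈ {e : P × ℕ | 0 < e.2 ∧ N e.1 ^ e.2 = n}, Real.log (N e.1) ≤
      C * ArithmeticFunction.vonMangoldt n) (ψ : AddChar A ℂ) (n : ℕ) :
    ∑ k ∈ Finset.Icc 1 n, ‖mangoldtCoeff N φ ψ k‖ ≤ (C * (Real.log 4 + 4)) * n := by
  have hC : 0 ≤ C := by
    have := (norm_nonneg _).trans (norm_mangoldtCoeff_le φ hN hfin hcheb ψ 2)
    rw [ArithmeticFunction.vonMangoldt_apply_prime Nat.prime_two] at this
    exact nonneg_of_mul_nonneg_left this (Real.log_pos (by norm_num))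
  refine (Finset.sum_le_sum fun k _ => norm_mangoldtCoeff_le φ hN hfin hcheb ψ k).trans ?_
  rw [← Finset.mul_sum, mul_assoc]
  exact mul_le_mul_of_nonneg_left (sum_Icc_vonMangoldt_le n) hC

open MeasureTheory Filter Topology Set in
theorem neg_deriv_LSeries_normCoeff {P A : Type*} [AddCommGroup A] [Fintype A] {N : P → ℕ}
    {φ : P → A}
    (hN : ∀ p, 2 ≤ N p) (hfin : ∀ n, {m : Multiset P | (m.map N).prod = n}.Finite) {κ K C : ℝ}
    (hcount : ∀ (a : A) (x : ℕ), |({m : Multiset P | (m.map N).prod ≤ x ∧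
      (m.map φ).sum = a}.ncard : ℝ) - κ * x| ≤ K * √x)
    (hcheb : ∀ n, ∑ᶠ e ∈ {e : P × ℕ | 0 < e.2 ∧ N e.1 ^ e.2 = n}, Real.log (N e.1) ≤
      C * ArithmeticFunction.vonMangoldt n) (ψ : AddChar A ℂ) {s : ℂ} (hs : 1 < s.re) :
    -deriv (LSeries (normCoeff N φ ψ)) s =
      LSeries (mangoldtCoeff N φ ψ) s * LSeries (normCoeff N φ ψ) s := by
  have h1 := sum_norm_normCoeff_le hN hfin hcount ψ
  have h2 := sum_norm_mangoldtCoeff_le φ hN hfin hcheb ψ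
  rw [LSeries_deriv ((abscissaOfAbsConv_le_one_of_sum_norm_le h1).trans_lt (by exact_mod_cast hs)),
    neg_neg, ← LSeries_convolution' (LSeriesSummable_of_sum_norm_le h2 hs)
      (LSeriesSummable_of_sum_norm_le h1 hs)]
  congr 1
  ext n
  simp only [LSeries.convolution_def]
  rw [← normCoeff_mul_log φ hN hfin ψ n, LSeries.logMul, Complex.natCast_log, mul_comm]

open MeasureTheory Filter Topology Set in
theorem exists_tendsto_mul_of_mul_eq_neg_deriv {Z F : ℂ → ℂ} {c z : ℂ} (hz : 1 ≤ z.re)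
    (hZ : AnalyticAt ℂ Z z) (hne : ¬ ∀ᶠ s in 𝓝 z, Z s = 0)
    (hF : ∀ s, 1 < s.re → F s * Z s = -deriv Z s + c * Z s / (s - 1)) :
    ∃ m : ℕ, (m = 0 ↔ Z z ≠ 0) ∧ Tendsto (fun ε : ℝ => ε * F (z + ε)) (𝓝[>] 0)
      (𝓝 (-m + if z = 1 then c else 0)) := by
  obtain ⟨m, hm, hm0, hmt⟩ := exists_tendsto_mul_logDeriv hZ hne
  refine ⟨m, hm, ?_⟩
  have hmap : Tendsto (fun ε : ℝ => z + (ε : ℂ)) (𝓝[>] 0) (𝓝[≠] z) := by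
    refine tendsto_nhdsWithin_iff.2 ⟨?_, ?_⟩
    · have : Continuous fun ε : ℝ => z + (ε : ℂ) := by fun_prop
      have := this.tendsto 0
      simp only [Complex.ofReal_zero, add_zero] at this
      exact this.mono_left nhdsWithin_le_nhds
    · filter_upwards [self_mem_nhdsWithin] with ε hε
      simpa using (ne_of_gt hε)
  have h1 := (hmt.comp hmap).neg
  have h2 : Tendsto (fun ε : ℝ => c * (ε / (z - 1 + ε))) (𝓝[>] 0)
      (𝓝 (if z = 1 then c else 0)) := by
    split_ifs with h
    · refine tendsto_const_nhds.congr' ?_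
      filter_upwards [self_mem_nhdsWithin] with ε hε
      have : (ε : ℂ) ≠ 0 := by exact_mod_cast ne_of_gt hε
      rw [h, sub_self, zero_add, div_self this, mul_one]
    · have hc : ContinuousAt (fun ε : ℝ => c * (ε / (z - 1 + ε))) 0 := by
        have : z - 1 + ((0 : ℝ) : ℂ) ≠ 0 := by simpa using sub_ne_zero.2 h
        fun_prop (disch := assumption)
      have := hc.tendsto
      simp only [Complex.ofReal_zero, zero_div, mul_zero] at this
      exact this.mono_left nhdsWithin_le_nhds
  refine (h1.add h2).congr' ?_
  filter_upwards [self_mem_nhdsWithin, hmap.eventually hm0] with ε hε hZε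
  have h3 := hF (z + ε) (by simp only [Complex.add_re, Complex.ofReal_re]; linarith [mem_Ioi.1 hε])
  have h4 : F (z + ε) = -(deriv Z (z + ε) / Z (z + ε)) + c / (z + ε - 1) := by
    rw [eq_comm, ← mul_left_inj' hZε, h3]
    field_simp
  simp only [Function.comp]
  rw [h4]
  ring

open MeasureTheory Filter Topology Set in
/-- Nonvanishing on `Re z ≥ 1` of a family of Dirichlet series indexed by a group of characters
without elements of order two. -/
theorem ne_zero_of_mul_eq_neg_deriv {X : Type*} [AddCommGroup X] [DecidableEq X]
    {Z F : X → ℂ → ℂ}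
    (hZ : ∀ ψ, DifferentiableOn ℂ (Z ψ) {s | 1 / 2 < s.re})
    (hne : ∀ ψ z, 1 ≤ z.re → ¬ ∀ᶠ s in 𝓝 z, Z ψ s = 0)
    (hF : ∀ ψ s, 1 < s.re →
      F ψ s * Z ψ s = -deriv (Z ψ) s + (if ψ = 0 then 1 else 0) * Z ψ s / (s - 1))
    (hFc : ∀ ψ, ContinuousOn (F ψ) {s | 1 < s.re})
    (hZ1 : Z 0 1 ≠ 0) (htwo : ∀ ψ : X, ψ ≠ 0 → ψ + ψ ≠ 0)
    (hpos : ∀ ψ (t ε : ℝ), 0 < ε →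
      0 ≤ (3 * F 0 (1 + ε) + 4 * F ψ (1 + t * Complex.I + ε) +
        F (ψ + ψ) (1 + (2 * t : ℝ) * Complex.I + ε)).re) (ψ : X) {z : ℂ} (hz : 1 ≤ z.re) :
    Z ψ z ≠ 0 := by
  have hU : IsOpen {s : ℂ | 1 / 2 < s.re} := isOpen_lt continuous_const Complex.continuous_re
  have key (ψ : X) {z : ℂ} (hz : 1 ≤ z.re) := exists_tendsto_mul_of_mul_eq_neg_deriv hz
    ((hZ ψ).analyticAt (hU.mem_nhds (show 1 / 2 < z.re by linarith))) (hne ψ z hz) (hF ψ)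
  rcases hz.lt_or_eq with hz1 | hz1
  · obtain ⟨m, hm, ht⟩ := key ψ hz
    rw [← hm]
    rw [if_neg (by rintro rfl; simp at hz1)] at ht
    have hc : ContinuousAt (fun ε : ℝ => (ε : ℂ) * F ψ (z + ε)) 0 := by
      have h1 : ContinuousAt (F ψ) (z + ((0 : ℝ) : ℂ)) := by
        refine (hFc ψ).continuousAt ((isOpen_lt continuous_const Complex.continuous_re).mem_nhds ?_)
        simpa using hz1
      have h2 : ContinuousAt (fun ε : ℝ => z + (ε : ℂ)) 0 := by fun_prop
      exact Complex.continuous_ofReal.continuousAt.mul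
        (ContinuousAt.comp (f := fun ε : ℝ => z + (ε : ℂ)) (g := F ψ) h1 h2)
    have h3 := tendsto_nhds_unique ht (hc.tendsto.mono_left nhdsWithin_le_nhds)
    simpa using h3
  · by_cases h0 : ψ = 0 ∧ z = 1
    · rw [h0.1, h0.2]
      exact hZ1
    obtain ⟨t, ht⟩ : ∃ t : ℝ, z = 1 + t * Complex.I := by
      refine ⟨z.im, ?_⟩
      conv_lhs => rw [← Complex.re_add_im z, ← hz1]
      simp
    have hz0 : (if z = 1 then if ψ = 0 then (1 : ℂ) else 0 else 0) = 0 := by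
      split_ifs with h1 h2
      exacts [absurd ⟨h2, h1⟩ h0, rfl, rfl]
    have hz2 : (if 1 + ((2 * t : ℝ) : ℂ) * Complex.I = 1 then
        if ψ + ψ = 0 then (1 : ℂ) else 0 else 0) = 0 := by
      split_ifs with h1 h2
      · exfalso
        have h3 : t = 0 := by simpa using h1
        refine h0 ⟨by_contra fun h => htwo ψ h h2, ?_⟩
        rw [ht, h3]
        simp
      all_goals rfl
    obtain ⟨m, hm, hmt⟩ := key ψ hz
    obtain ⟨m₀, hm₀, hmt₀⟩ := key 0 (z := 1) (by simp)
    obtain ⟨m₂, -, hmt₂⟩ := key (ψ + ψ) (z := 1 + ((2 * t : ℝ) : ℂ) * Complex.I) (by simp)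
    rw [hz0] at hmt
    rw [hz2] at hmt₂
    rw [if_pos rfl, if_pos rfl, hm₀.2 hZ1] at hmt₀
    rw [← hm]
    have h1 := ((hmt₀.const_mul 3).add (hmt.const_mul 4)).add hmt₂
    have h2 := (Complex.continuous_re.tendsto _).comp h1
    have h3 : (0 : ℝ) ≤ _ := ge_of_tendsto h2 (by
      filter_upwards [self_mem_nhdsWithin] with ε hε
      have h4 := mul_nonneg (le_of_lt hε) (hpos ψ t ε hε)
      rw [← Complex.re_ofReal_mul] at h4
      convert h4 using 1
      simp only [Function.comp_apply, ht]
      congr 1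
      ring)
    simp only [Nat.cast_zero, neg_zero, zero_add, mul_one, add_zero, Complex.add_re,
      Complex.mul_re, Complex.neg_re, Complex.natCast_re, Complex.neg_im, Complex.natCast_im] at h3
    norm_num at h3
    have h5 : (4 : ℝ) * m ≤ 3 := by
      have : (0 : ℝ) ≤ m₂ := Nat.cast_nonneg _
      linarith
    by_contra h
    have : (1 : ℝ) ≤ m := by exact_mod_cast Nat.one_le_iff_ne_zero.2 h
    linarith

open MeasureTheory Filter Topology Set in
theorem exists_LSeries_normCoeff_mul_eq {P A : Type*} [AddCommGroup A] [Fintype A] {N : P → ℕ}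
    {φ : P → A}
    (hN : ∀ p, 2 ≤ N p) (hfin : ∀ n, {m : Multiset P | (m.map N).prod = n}.Finite) {κ K : ℝ}
    (hκ : 0 < κ)
    (hcount : ∀ (a : A) (x : ℕ), |({m : Multiset P | (m.map N).prod ≤ x ∧
      (m.map φ).sum = a}.ncard : ℝ) - κ * x| ≤ K * √x) [DecidableEq (AddChar A ℂ)]
    (ψ : AddChar A ℂ) :
    ∃ Z : ℂ → ℂ, DifferentiableOn ℂ Z {s | 1 / 2 < s.re} ∧
      (∀ s, 1 < s.re → Z s = LSeries (normCoeff N φ ψ) s * (if ψ = 0 then s - 1 else 1)) ∧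
      (ψ = 0 → Z 1 ≠ 0) := by
  have h1 : ∀ n : ℕ, ‖∑ k ∈ Finset.Icc 1 n, normCoeff N φ ψ k - (κ * ∑ a, ψ a) * n‖ ≤
      (Fintype.card A * K) * √n := by
    intro n
    rw [sum_normCoeff φ hN hfin, mul_assoc, Finset.sum_mul, Finset.mul_sum,
      ← Finset.sum_sub_distrib]
    have h2 : ∀ a ∈ Finset.univ, ‖ψ a * ({m : Multiset P | (m.map N).prod ≤ n ∧
        (m.map φ).sum = a}.ncard : ℂ) - κ * (ψ a * n)‖ ≤ K * √n := by
      intro a _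
      have : ψ a * ({m : Multiset P | (m.map N).prod ≤ n ∧
        (m.map φ).sum = a}.ncard : ℂ) - κ * (ψ a * n) = ψ a * ((({m : Multiset P |
          (m.map N).prod ≤ n ∧ (m.map φ).sum = a}.ncard : ℝ) - κ * n : ℝ) : ℂ) := by
        push_cast
        ring
      rw [this, norm_mul, AddChar.norm_apply, one_mul, Complex.norm_real]
      exact hcount a n
    refine (norm_sum_le_of_le _ h2).trans (le_of_eq ?_)
    rw [Finset.sum_const, Finset.card_univ, nsmul_eq_mul, mul_assoc]
  obtain ⟨E, hE, hLE⟩ := exists_LSeries_eq_add_div h1 (sum_norm_normCoeff_le hN hfin hcount ψ)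
  by_cases h0 : ψ = 0
  · refine ⟨fun s => (s - 1) * E s + κ * Fintype.card A, ?_, ?_, fun _ => ?_⟩
    · fun_prop
    · intro s hs
      rw [hLE s hs, if_pos h0, AddChar.sum_eq_ite, if_pos h0]
      have : s - 1 ≠ 0 := sub_ne_zero.2 (by rintro rfl; simp at hs)
      field_simp
    · simp [hκ.ne']
  · refine ⟨E, hE, fun s hs => ?_, fun h => absurd h h0⟩
    rw [hLE s hs, if_neg h0, AddChar.sum_eq_ite, if_neg h0]
    simp

open MeasureTheory Filter Topology Set in
theorem not_eventually_eq_zero_of_eq_LSeries {f : ℕ → ℂ} {C : ℝ} (h1 : f 1 = 1)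
    (hf : ∀ n : ℕ, ∑ k ∈ Finset.Icc 1 n, ‖f k‖ ≤ C * n) {Z w : ℂ → ℂ}
    (hZ : DifferentiableOn ℂ Z {s | 1 / 2 < s.re})
    (hw : ∀ s : ℂ, 1 < s.re → w s ≠ 0) (hZf : ∀ s, 1 < s.re → Z s = LSeries f s * w s)
    {z : ℂ} (hz : 1 ≤ z.re) : ¬ ∀ᶠ s in 𝓝 z, Z s = 0 := by
  intro h
  have hU : IsOpen {s : ℂ | 1 / 2 < s.re} := isOpen_lt continuous_const Complex.continuous_re
  have h2 := (hZ.analyticOnNhd hU).eqOn_zero_of_preconnected_of_eventuallyEq_zero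
    (convex_halfSpace_re_gt (1 / 2)).isPreconnected (show 1 / 2 < z.re by linarith) h
  have h3 : ∀ s : ℂ, 1 < s.re → LSeries f s = 0 := by
    intro s hs
    have h4 := h2 (show 1 / 2 < s.re by linarith)
    rw [hZf s hs] at h4
    exact (mul_eq_zero.1 h4).resolve_right (hw s hs)
  have h5 : (fun x : ℝ => LSeries f x) =ᶠ[atTop] 0 := by
    filter_upwards [eventually_gt_atTop 1] with x hx
    exact h3 x (by simpa using hx)
  rcases LSeries_eventually_eq_zero_iff'.1 h5 with h6 | h6
  · have := h6 1 one_ne_zero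
    rw [h1] at this
    exact one_ne_zero this
  · have := abscissaOfAbsConv_le_one_of_sum_norm_le hf
    rw [h6, top_le_iff] at this
    exact EReal.coe_ne_top 1 this

open MeasureTheory Filter Topology Set in
theorem LSeries_mangoldtCoeff_mul_eq_neg_deriv {P A : Type*} [AddCommGroup A] [Fintype A]
    {N : P → ℕ} {φ : P → A}
    (hN : ∀ p, 2 ≤ N p) (hfin : ∀ n, {m : Multiset P | (m.map N).prod = n}.Finite) {κ K C : ℝ}
    (hcount : ∀ (a : A) (x : ℕ), |({m : Multiset P | (m.map N).prod ≤ x ∧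
      (m.map φ).sum = a}.ncard : ℝ) - κ * x| ≤ K * √x)
    (hcheb : ∀ n, ∑ᶠ e ∈ {e : P × ℕ | 0 < e.2 ∧ N e.1 ^ e.2 = n}, Real.log (N e.1) ≤
      C * ArithmeticFunction.vonMangoldt n) [DecidableEq (AddChar A ℂ)] (ψ : AddChar A ℂ)
    {Z : ℂ → ℂ}
    (hZ : ∀ s, 1 < s.re → Z s = LSeries (normCoeff N φ ψ) s * (if ψ = 0 then s - 1 else 1))
    {s : ℂ} (hs : 1 < s.re) :
    LSeries (mangoldtCoeff N φ ψ) s * Z s =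
      -deriv Z s + (if ψ = 0 then 1 else 0) * Z s / (s - 1) := by
  have h1 := neg_deriv_LSeries_normCoeff hN hfin hcount hcheb ψ hs
  have hU : IsOpen {s : ℂ | 1 < s.re} := isOpen_lt continuous_const Complex.continuous_re
  have hd : DifferentiableAt ℂ (LSeries (normCoeff N φ ψ)) s := by
    refine ((LSeries_differentiableOn _).mono fun s (hs : 1 < s.re) => ?_).differentiableAt
      (hU.mem_nhds hs)
    exact (abscissaOfAbsConv_le_one_of_sum_norm_le
      (sum_norm_normCoeff_le hN hfin hcount ψ)).trans_lt (by exact_mod_cast hs)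
  have hs1 : s - 1 ≠ 0 := sub_ne_zero.2 (by rintro rfl; simp at hs)
  have h2 : Z =ᶠ[𝓝 s] fun s => LSeries (normCoeff N φ ψ) s * (if ψ = 0 then s - 1 else 1) := by
    filter_upwards [hU.mem_nhds hs] with z hz using hZ z hz
  rw [h2.deriv_eq, hZ s hs]
  split_ifs with h0
  · rw [deriv_fun_mul hd (by fun_prop)]
    simp only [deriv_sub_const, deriv_id'']
    rw [← mul_assoc, ← h1]
    field_simp
    ring
  · simp only [mul_one, zero_mul, zero_div, add_zero]
    rw [h1]

open MeasureTheory Filter Topology Set in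
theorem re_LSeries_mangoldtCoeff_nonneg {P A : Type*} [AddCommGroup A] [Fintype A]
    {N : P → ℕ} {φ : P → A}
    (hN : ∀ p, 2 ≤ N p) (hfin : ∀ n, {m : Multiset P | (m.map N).prod = n}.Finite) {C : ℝ}
    (hcheb : ∀ n, ∑ᶠ e ∈ {e : P × ℕ | 0 < e.2 ∧ N e.1 ^ e.2 = n}, Real.log (N e.1) ≤
      C * ArithmeticFunction.vonMangoldt n) (ψ : AddChar A ℂ) (t : ℝ) {ε : ℝ} (hε : 0 < ε) :
    0 ≤ (3 * LSeries (mangoldtCoeff N φ (0 : AddChar A ℂ)) (1 + ε) +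
      4 * LSeries (mangoldtCoeff N φ ψ) (1 + t * Complex.I + ε) +
      LSeries (mangoldtCoeff N φ (ψ + ψ : AddChar A ℂ)) (1 + (2 * t : ℝ) * Complex.I + ε)).re := by
  have hsum (ψ : AddChar A ℂ) (t : ℝ) :
      LSeriesSummable (mangoldtCoeff N φ ψ) (1 + t * Complex.I + ε) :=
    LSeriesSummable_of_sum_norm_le (sum_norm_mangoldtCoeff_le φ hN hfin hcheb ψ) (by simpa using hε)
  have h0 := hsum 0 0
  simp only [Complex.ofReal_zero, zero_mul, add_zero] at h0
  have h1 := ((h0.hasSum.mul_left 3).add ((hsum ψ t).hasSum.mul_left 4)).add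
    (hsum (ψ + ψ) (2 * t)).hasSum
  have h2 := Complex.hasSum_re h1
  simp only [LSeries]
  refine h2.nonneg fun n => ?_
  rcases Nat.eq_zero_or_pos n with rfl | hn
  · simp
  have hn' : (n : ℂ) ≠ 0 := by exact_mod_cast hn.ne'
  have hE := finite_primePowers_of_norm hfin n
  set u : ℂ := (n : ℂ) ^ (-(t * Complex.I) : ℂ) with hu
  have hun : ‖u‖ = 1 := by
    rw [hu, Complex.norm_natCast_cpow_of_pos hn]
    simp
  have hr : (n : ℂ) ^ (-(1 + ε) : ℂ) = ((n : ℝ) ^ (-(1 + ε)) : ℝ) := by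
    rw [Complex.ofReal_cpow (Nat.cast_nonneg n)]
    push_cast
    rfl
  have hu1 : (n : ℂ) ^ (-(1 + t * Complex.I + ε) : ℂ) = ((n : ℝ) ^ (-(1 + ε)) : ℝ) * u := by
    rw [← hr, hu, ← Complex.cpow_add _ _ hn']
    ring_nf
  have hu2 : (n : ℂ) ^ (-(1 + (2 * t : ℝ) * Complex.I + ε) : ℂ) =
      ((n : ℝ) ^ (-(1 + ε)) : ℝ) * (u * u) := by
    rw [← hr, hu, ← Complex.cpow_add _ _ hn', ← Complex.cpow_add _ _ hn']
    push_cast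
    ring_nf
  simp only [LSeries.term_of_ne_zero hn.ne', div_eq_mul_inv,
    ← Complex.cpow_neg]
  rw [hu1, hu2, hr]
  simp only [mangoldtCoeff, finsum_mem_eq_finite_toFinset_sum _ hE, AddChar.zero_apply,
    AddChar.add_apply]
  rw [Finset.sum_mul, Finset.sum_mul, Finset.sum_mul, Finset.mul_sum, Finset.mul_sum,
    ← Finset.sum_add_distrib, ← Finset.sum_add_distrib, Complex.re_sum]
  refine Finset.sum_nonneg fun e _ => ?_
  set w : ℂ := ψ (e.2 • φ e.1) * u with hw
  have hwn : ‖w‖ = 1 := by rw [hw, norm_mul, AddChar.norm_apply, hun, one_mul]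
  have hl : 0 ≤ Real.log (N e.1) :=
    Real.log_nonneg (by exact_mod_cast (by have := hN e.1; omega : 1 ≤ N e.1))
  have hR : 0 ≤ (n : ℝ) ^ (-(1 + ε)) := by positivity
  have : 3 * (1 * (Real.log (N e.1) : ℂ) * ((n : ℝ) ^ (-(1 + ε)) : ℝ)) +
      4 * (ψ (e.2 • φ e.1) * Real.log (N e.1) * (((n : ℝ) ^ (-(1 + ε)) : ℝ) * u)) +
      ψ (e.2 • φ e.1) * ψ (e.2 • φ e.1) * Real.log (N e.1) *
        (((n : ℝ) ^ (-(1 + ε)) : ℝ) * (u * u)) =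
      ((Real.log (N e.1) * (n : ℝ) ^ (-(1 + ε)) : ℝ) : ℂ) * (3 + 4 * w + w * w) := by
    rw [hw]
    push_cast
    ring
  rw [this, Complex.re_ofReal_mul]
  refine mul_nonneg (mul_nonneg hl hR) ?_
  have h3 : w.re * w.re + w.im * w.im = 1 := by
    rw [← Complex.normSq_apply, Complex.normSq_eq_norm_sq, hwn, one_pow]
  simp only [Complex.add_re, Complex.mul_re, Complex.re_ofNat, Complex.im_ofNat]
  nlinarith [sq_nonneg (w.re + 1)]

open scoped Classical in
theorem finsum_ite_mem_eq_sum_mangoldtCoeff {P A : Type*} [AddCommGroup A] [Fintype A]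
    {N : P → ℕ} (φ : P → A) (hfin : ∀ n, {m : Multiset P | (m.map N).prod = n}.Finite)
    (T : Finset A) (n : ℕ) :
    ((∑ᶠ e ∈ {e : P × ℕ | 0 < e.2 ∧ N e.1 ^ e.2 = n},
      if e.2 • φ e.1 ∈ T then Real.log (N e.1) else 0 : ℝ) : ℂ) =
    ∑ ψ : AddChar A ℂ, ((∑ a ∈ T, ψ (-a)) / Fintype.card A) * mangoldtCoeff N φ ψ n := by
  have hE := finite_primePowers_of_norm hfin n
  simp only [mangoldtCoeff, finsum_mem_eq_finite_toFinset_sum _ hE]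
  simp only [Finset.mul_sum]
  rw [Finset.sum_comm, Complex.ofReal_sum]
  refine Finset.sum_congr rfl fun e _ => ?_
  have hA : (Fintype.card A : ℂ) ≠ 0 := by exact_mod_cast Fintype.card_ne_zero
  calc _ = (∑ a ∈ T, if e.2 • φ e.1 + -a = 0 then (1 : ℂ) else 0) * Real.log (N e.1) := by
        simp only [← sub_eq_add_neg, sub_eq_zero]
        rw [Finset.sum_ite_eq]
        split_ifs <;> simp
    _ = (∑ a ∈ T, (∑ ψ : AddChar A ℂ, ψ (e.2 • φ e.1 + -a)) / Fintype.card A) *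
          Real.log (N e.1) := by
        congr 1
        refine Finset.sum_congr rfl fun a _ => ?_
        rw [AddChar.sum_apply_eq_ite]
        split_ifs
        · rw [div_self hA]
        · rw [zero_div]
    _ = _ := by
        rw [← Finset.sum_div, Finset.sum_comm, div_mul_eq_mul_div, Finset.sum_mul, Finset.sum_div]
        refine Finset.sum_congr rfl fun ψ _ => ?_
        simp only [AddChar.map_add_eq_mul]
        rw [← Finset.mul_sum]
        ring

open MeasureTheory Filter Topology Set in
open scoped Classical in
/-- An abstract prime number theorem: the primes of an arithmetic semigroup whose elements are
equidistributed over a group of odd order, with square root error term, are themselves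
equidistributed over that group. -/
theorem tendsto_sum_finsum_ite_mem_div {P A : Type*} [AddCommGroup A] [Fintype A]
    {N : P → ℕ} {φ : P → A}
    (hN : ∀ p, 2 ≤ N p) (hfin : ∀ n, {m : Multiset P | (m.map N).prod = n}.Finite) {κ K C : ℝ}
    (hκ : 0 < κ)
    (hcount : ∀ (a : A) (x : ℕ), |({m : Multiset P | (m.map N).prod ≤ x ∧
      (m.map φ).sum = a}.ncard : ℝ) - κ * x| ≤ K * √x)
    (hcheb : ∀ n, ∑ᶠ e ∈ {e : P × ℕ | 0 < e.2 ∧ N e.1 ^ e.2 = n}, Real.log (N e.1) ≤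
      C * ArithmeticFunction.vonMangoldt n) (hodd : Odd (Fintype.card A)) (T : Finset A) :
    Tendsto (fun n : ℕ => (∑ k ∈ Finset.Icc 1 n,
      ∑ᶠ e ∈ {e : P × ℕ | 0 < e.2 ∧ N e.1 ^ e.2 = k},
        if e.2 • φ e.1 ∈ T then Real.log (N e.1) else 0) / (n : ℝ)) atTop
      (𝓝 (T.card / Fintype.card A)) := by
  have hE := finite_primePowers_of_norm hfin
  have hlog (p : P) : 0 ≤ Real.log (N p) :=
    Real.log_nonneg (by exact_mod_cast (by have := hN p; omega : 1 ≤ N p))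
  have hM (ψ : AddChar A ℂ) := sum_norm_mangoldtCoeff_le φ hN hfin hcheb ψ
  have hMs (ψ : AddChar A ℂ) {s : ℂ} (hs : 1 < s.re) :
      LSeriesSummable (mangoldtCoeff N φ ψ) s := LSeriesSummable_of_sum_norm_le (hM ψ) hs
  have hpos (ψ : AddChar A ℂ) (s : ℂ) (hs : 1 < s.re) : (if ψ = 0 then s - 1 else 1) ≠ 0 := by
    split_ifs
    · exact sub_ne_zero.2 (by rintro rfl; simp at hs)
    · exact one_ne_zero
  choose Z hZd hZL hZ1 using exists_LSeries_normCoeff_mul_eq (φ := φ) hN hfin hκ hcount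
  have hne (ψ : AddChar A ℂ) (z : ℂ) (hz : 1 ≤ z.re) : ¬ ∀ᶠ s in 𝓝 z, Z ψ s = 0 :=
    not_eventually_eq_zero_of_eq_LSeries (normCoeff_one φ hN ψ)
      (sum_norm_normCoeff_le hN hfin hcount ψ) (hZd ψ) (hpos ψ) (hZL ψ) hz
  have hF (ψ : AddChar A ℂ) (s : ℂ) (hs : 1 < s.re) :=
    LSeries_mangoldtCoeff_mul_eq_neg_deriv hN hfin hcount hcheb ψ (hZL ψ) hs
  have htwo (ψ : AddChar A ℂ) (hψ : ψ ≠ 0) : ψ + ψ ≠ 0 := by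
    intro h
    refine hψ (DFunLike.ext _ _ fun a => ?_)
    have h1 : ψ a * ψ a = 1 := by rw [← AddChar.add_apply, h, AddChar.zero_apply]
    obtain ⟨k, hk⟩ := hodd
    have h2 : ψ a ^ Fintype.card A = 1 := by
      rw [← AddChar.map_nsmul_eq_pow, card_nsmul_eq_zero, AddChar.map_zero_eq_one]
    rw [hk, pow_succ, pow_mul, pow_two, h1, one_pow, one_mul] at h2
    rw [h2, AddChar.zero_apply]
  have hZne (ψ : AddChar A ℂ) {z : ℂ} (hz : 1 ≤ z.re) : Z ψ z ≠ 0 := by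
    refine ne_zero_of_mul_eq_neg_deriv (X := AddChar A ℂ) (Z := Z)
      (F := fun ψ => LSeries (mangoldtCoeff N φ ψ)) hZd hne hF
      (fun ψ => ?_) (hZ1 0 rfl) htwo
      (fun ψ t ε hε => re_LSeries_mangoldtCoeff_nonneg hN hfin hcheb ψ t hε) ψ hz
    refine ((LSeries_differentiableOn _).mono fun s (hs : 1 < s.re) => ?_).continuousOn
    exact (abscissaOfAbsConv_le_one_of_sum_norm_le (hM ψ)).trans_lt (by exact_mod_cast hs)
  set c : AddChar A ℂ → ℂ := fun ψ => (∑ a ∈ T, ψ (-a)) / Fintype.card A with hc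
  have hU : IsOpen {s : ℂ | 1 / 2 < s.re} := isOpen_lt continuous_const Complex.continuous_re
  have hsub : {s : ℂ | 1 ≤ s.re} ⊆ {s : ℂ | 1 / 2 < s.re} := fun s (hs : 1 ≤ s.re) => by
    simp only [mem_ofPred_eq]
    linarith
  have hsum := finsum_ite_mem_eq_sum_mangoldtCoeff φ hfin T
  refine tendsto_sum_div_of_LSeries_continuousOn
    (G := fun s => ∑ ψ, c ψ * -(deriv (Z ψ) s / Z ψ s)) (C := C * (Real.log 4 + 4))
    (fun n => ?_) (fun n => ?_) ?_ fun s hs => ?_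
  · rw [finsum_mem_eq_finite_toFinset_sum _ (hE n)]
    refine Finset.sum_nonneg fun e _ => ?_
    split_ifs
    exacts [hlog _, le_rfl]
  · have h0 : 0 ≤ C := by
      have := (norm_nonneg _).trans (norm_mangoldtCoeff_le φ hN hfin hcheb 0 2)
      rw [ArithmeticFunction.vonMangoldt_apply_prime Nat.prime_two] at this
      exact nonneg_of_mul_nonneg_left this (Real.log_pos (by norm_num))
    calc _ ≤ ∑ k ∈ Finset.Icc 1 n, C * ArithmeticFunction.vonMangoldt k := by
          refine Finset.sum_le_sum fun k _ => le_trans ?_ (hcheb k)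
          rw [finsum_mem_eq_finite_toFinset_sum _ (hE k),
            finsum_mem_eq_finite_toFinset_sum _ (hE k)]
          refine Finset.sum_le_sum fun e _ => ?_
          split_ifs
          exacts [le_rfl, hlog _]
      _ ≤ _ := by
          rw [← Finset.mul_sum, mul_assoc]
          exact mul_le_mul_of_nonneg_left (sum_Icc_vonMangoldt_le n) h0
  · refine continuousOn_finsetSum _ fun ψ _ => continuousOn_const.mul ?_
    exact ((((hZd ψ).deriv hU).continuousOn.mono hsub).div ((hZd ψ).continuousOn.mono hsub)
      fun s hs => hZne ψ hs).neg
  · have h1 : (fun n => ((∑ᶠ e ∈ {e : P × ℕ | 0 < e.2 ∧ N e.1 ^ e.2 = n},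
        if e.2 • φ e.1 ∈ T then Real.log (N e.1) else 0 : ℝ) : ℂ)) =
        ∑ ψ : AddChar A ℂ, c ψ • mangoldtCoeff N φ ψ := by
      ext n
      rw [hsum, Finset.sum_apply]
      rfl
    rw [h1, LSeries_sum fun ψ _ => (hMs ψ hs).smul _]
    simp only [LSeries_smul]
    have h2 : ∀ ψ : AddChar A ℂ, c ψ * LSeries (mangoldtCoeff N φ ψ) s =
        c ψ * -(deriv (Z ψ) s / Z ψ s) + if ψ = 0 then c ψ / (s - 1) else 0 := by
      intro ψ
      have h3 := hF ψ s hs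
      have h4 := hZne ψ hs.le
      have h5 : s - 1 ≠ 0 := sub_ne_zero.2 (by rintro rfl; simp at hs)
      rw [← mul_left_inj' h4, mul_assoc, h3]
      split_ifs <;> field_simp
      ring
    rw [Finset.sum_congr rfl fun ψ _ => h2 ψ, Finset.sum_add_distrib, Finset.sum_ite_eq',
      if_pos (Finset.mem_univ _), hc]
    simp

/-- An ideal dividing a nonzero principal ideal. -/
def Ideal.DvdPrincipal {R : Type*} [CommRing R] (I : Ideal R) : Prop :=
  ∃ (J : Ideal R) (x : R), x ≠ 0 ∧ I * J = Ideal.span {x}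

open scoped nonZeroDivisors in
theorem Ideal.DvdPrincipal.isUnit {R : Type*} [CommRing R] [IsDomain R] {I : Ideal R}
    (h : I.DvdPrincipal) : IsUnit (I : FractionalIdeal R⁰ (FractionRing R)) := by
  obtain ⟨J, x, hx, hJ⟩ := h
  have h1 : (I : FractionalIdeal R⁰ (FractionRing R)) * J =
      FractionalIdeal.spanSingleton R⁰ (algebraMap R (FractionRing R) x) := by
    rw [← FractionalIdeal.coeIdeal_mul, hJ, FractionalIdeal.coeIdeal_span_singleton]
  have hx' : algebraMap R (FractionRing R) x ≠ 0 := by simpa using hx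
  refine IsUnit.of_mul_eq_one
    ((J : FractionalIdeal R⁰ (FractionRing R)) *
      FractionalIdeal.spanSingleton R⁰ (algebraMap R (FractionRing R) x)⁻¹) ?_
  rw [← mul_assoc, h1, FractionalIdeal.spanSingleton_mul_spanSingleton, mul_inv_cancel₀ hx',
    FractionalIdeal.spanSingleton_one]

theorem Ideal.DvdPrincipal.mul {R : Type*} [CommRing R] [IsDomain R] {I J : Ideal R}
    (hI : I.DvdPrincipal) (hJ : J.DvdPrincipal) : (I * J).DvdPrincipal := by
  obtain ⟨I', x, hx, h1⟩ := hI
  obtain ⟨J', y, hy, h2⟩ := hJ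
  refine ⟨I' * J', x * y, mul_ne_zero hx hy, ?_⟩
  rw [mul_mul_mul_comm, h1, h2, Ideal.span_singleton_mul_span_singleton]

theorem Ideal.DvdPrincipal.mul_left_cancel {R : Type*} [CommRing R] [IsDomain R] {I A B : Ideal R}
    (hI : I.DvdPrincipal) (h : I * A = I * B) : A = B := by
  obtain ⟨J, x, hx, hJ⟩ := hI
  refine Ideal.span_singleton_mul_right_injective hx ?_
  simp only
  rw [← hJ, mul_comm I, mul_assoc, mul_assoc, h]

theorem Ideal.dvdPrincipal_span_singleton {R : Type*} [CommRing R] [IsDomain R] {x : R}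
    (hx : x ≠ 0) : (Ideal.span {x}).DvdPrincipal :=
  ⟨⊤, x, hx, Ideal.mul_top _⟩

open scoped Classical nonZeroDivisors in
/-- The class of an invertible ideal, and `1` for all other ideals. -/
noncomputable def idealClass {R : Type*} [CommRing R] [IsDomain R] (I : Ideal R) : ClassGroup R :=
  if h : IsUnit (I : FractionalIdeal R⁰ (FractionRing R)) then
    ClassGroup.mk (FractionRing R) h.unit else 1

theorem idealClass_mul {R : Type*} [CommRing R] [IsDomain R] {I J : Ideal R}
    (hI : I.DvdPrincipal) (hJ : J.DvdPrincipal) :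
    idealClass (I * J) = idealClass I * idealClass J := by
  rw [idealClass, idealClass, idealClass, dif_pos hI.isUnit, dif_pos hJ.isUnit,
    dif_pos (hI.mul hJ).isUnit, ← map_mul]
  congr 1
  ext1
  simp

theorem idealClass_eq_one_iff {R : Type*} [CommRing R] [IsDomain R] {I : Ideal R}
    (hI : I.DvdPrincipal) : idealClass I = 1 ↔ ∃ x : R, x ≠ 0 ∧ I = Ideal.span {x} := by
  rw [idealClass, dif_pos hI.isUnit]
  exact ClassGroup.mk_eq_one_of_coe_ideal hI.isUnit.unit_spec

open scoped nonZeroDivisors in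
theorem exists_idealClass_eq {R : Type*} [CommRing R] [IsDomain R] (c : ClassGroup R) :
    ∃ I : Ideal R, I.DvdPrincipal ∧ idealClass I = c := by
  refine ClassGroup.induction (FractionRing R) (fun u => ?_) c
  have hnum := FractionalIdeal.isUnit_num.2 u.isUnit
  refine ⟨(u : FractionalIdeal R⁰ (FractionRing R)).num, ?_, ?_⟩
  · refine ⟨((u⁻¹ : (FractionalIdeal R⁰ (FractionRing R))ˣ) :
      FractionalIdeal R⁰ (FractionRing R)).num,
      (u : FractionalIdeal R⁰ (FractionRing R)).den *
      ((u⁻¹ : (FractionalIdeal R⁰ (FractionRing R))ˣ) : FractionalIdeal R⁰ (FractionRing R)).den,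
      mul_ne_zero (nonZeroDivisors.ne_zero (Subtype.prop _))
        (nonZeroDivisors.ne_zero (Subtype.prop _)), ?_⟩
    rw [← FractionalIdeal.coeIdeal_inj (K := FractionRing R), FractionalIdeal.coeIdeal_mul,
      FractionalIdeal.coeIdeal_span_singleton, map_mul,
      ← FractionalIdeal.spanSingleton_mul_spanSingleton,
      ← FractionalIdeal.den_mul_self_eq_num', ← FractionalIdeal.den_mul_self_eq_num',
      mul_mul_mul_comm, Units.mul_inv, mul_one]
  · rw [idealClass, dif_pos hnum, ClassGroup.mk_eq_mk]
    have hd : algebraMap R (FractionRing R) (u : FractionalIdeal R⁰ (FractionRing R)).den ≠ 0 := by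
      simp
    refine ⟨(Units.mk0 _ hd)⁻¹, ?_⟩
    ext1
    rw [Units.val_mul, coe_toPrincipalIdeal, hnum.unit_spec,
      ← FractionalIdeal.den_mul_self_eq_num', mul_right_comm,
      FractionalIdeal.spanSingleton_mul_spanSingleton, Units.val_inv_eq_inv_val,
      Units.val_mk0, mul_inv_cancel₀ hd, FractionalIdeal.spanSingleton_one, one_mul]

/-- The order `ℤ[√-q]`. -/
abbrev ZsqrtNeg (q : ℕ) : Type := Zsqrtd (-(q : ℤ))

theorem ZsqrtNeg.norm_eq {q : ℕ} (z : ZsqrtNeg q) : z.norm = z.re ^ 2 + q * z.im ^ 2 := by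
  rw [Zsqrtd.norm_def]
  ring

theorem ZsqrtNeg.norm_eq_zero_iff {q : ℕ} [Fact q.Prime] (z : ZsqrtNeg q) :
    z.norm = 0 ↔ z = 0 := by
  refine Zsqrtd.norm_eq_zero_iff ?_ z
  have := (Fact.out : q.Prime).pos
  omega

instance ZsqrtNeg.isDomain (q : ℕ) [Fact q.Prime] : IsDomain (ZsqrtNeg q) :=
  have : NoZeroDivisors (ZsqrtNeg q) := ⟨fun {a b} h => by
    rw [← ZsqrtNeg.norm_eq_zero_iff, ← ZsqrtNeg.norm_eq_zero_iff b, ← mul_eq_zero,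
      ← Zsqrtd.norm_mul, h, Zsqrtd.norm_zero]⟩
  NoZeroDivisors.to_isDomain _

/-- The ideal of conjugates. -/
noncomputable def conjIdeal {q : ℕ} (I : Ideal (ZsqrtNeg q)) : Ideal (ZsqrtNeg q) :=
  I.map (starRingAut (R := ZsqrtNeg q))

theorem mem_conjIdeal {q : ℕ} {I : Ideal (ZsqrtNeg q)} {z : ZsqrtNeg q} :
    z ∈ conjIdeal I ↔ star z ∈ I := by
  rw [conjIdeal, Ideal.mem_map_of_equiv]
  constructor
  · rintro ⟨x, hx, rfl⟩
    simpa using hx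
  · exact fun h => ⟨_, h, by simp⟩

theorem conjIdeal_mul {q : ℕ} (I J : Ideal (ZsqrtNeg q)) :
    conjIdeal (I * J) = conjIdeal I * conjIdeal J := Ideal.map_mul _ _ _

theorem conjIdeal_span_singleton {q : ℕ} (z : ZsqrtNeg q) :
    conjIdeal (Ideal.span {z}) = Ideal.span {star z} := by
  rw [conjIdeal, Ideal.map_span, Set.image_singleton, starRingAut_apply]

theorem conjIdeal_conjIdeal {q : ℕ} (I : Ideal (ZsqrtNeg q)) : conjIdeal (conjIdeal I) = I := by
  ext z
  rw [mem_conjIdeal, mem_conjIdeal, star_star]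

/-- `I` is an invertible ideal of norm `n`. -/
def HasIdealNorm {q : ℕ} (I : Ideal (ZsqrtNeg q)) (n : ℕ) : Prop :=
  0 < n ∧ I * conjIdeal I = Ideal.span {(n : ZsqrtNeg q)}

section HasIdealNorm

variable {q : ℕ} {I J : Ideal (ZsqrtNeg q)} {m n : ℕ}

theorem natCast_mem_span_natCast_iff :
    (m : ZsqrtNeg q) ∈ Ideal.span {(n : ZsqrtNeg q)} ↔ n ∣ m := by
  rw [Ideal.mem_span_singleton]
  have := Zsqrtd.intCast_dvd_intCast (d := -(q : ℤ)) n m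
  rwa [Int.natCast_dvd_natCast, Int.cast_natCast, Int.cast_natCast] at this

theorem HasIdealNorm.unique (hm : HasIdealNorm I m) (hn : HasIdealNorm I n) : m = n := by
  have h : Ideal.span {(m : ZsqrtNeg q)} = Ideal.span {(n : ZsqrtNeg q)} := by rw [← hm.2, hn.2]
  refine Nat.dvd_antisymm ?_ ?_
  · rw [← natCast_mem_span_natCast_iff (q := q), h]
    exact Ideal.mem_span_singleton_self _
  · rw [← natCast_mem_span_natCast_iff (q := q), ← h]
    exact Ideal.mem_span_singleton_self _

theorem HasIdealNorm.mul (hI : HasIdealNorm I m) (hJ : HasIdealNorm J n) :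
    HasIdealNorm (I * J) (m * n) := by
  refine ⟨Nat.mul_pos hI.1 hJ.1, ?_⟩
  rw [conjIdeal_mul, mul_mul_mul_comm, hI.2, hJ.2, Ideal.span_singleton_mul_span_singleton,
    Nat.cast_mul]

theorem HasIdealNorm.conj (hI : HasIdealNorm I n) : HasIdealNorm (conjIdeal I) n :=
  ⟨hI.1, by rw [conjIdeal_conjIdeal, mul_comm, hI.2]⟩

theorem HasIdealNorm.natCast_mem (hI : HasIdealNorm I n) : (n : ZsqrtNeg q) ∈ I := by
  have h : (n : ZsqrtNeg q) ∈ I * conjIdeal I := by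
    rw [hI.2]
    exact Ideal.mem_span_singleton_self _
  have hle : I * conjIdeal I ≤ I := Ideal.mul_le_left
  exact hle h

theorem hasIdealNorm_top : HasIdealNorm (⊤ : Ideal (ZsqrtNeg q)) 1 :=
  ⟨one_pos, by rw [Ideal.top_mul, conjIdeal, Ideal.map_top, Nat.cast_one, Ideal.span_singleton_one]⟩

theorem HasIdealNorm.eq_one_iff (hI : HasIdealNorm I n) : n = 1 ↔ I = ⊤ := by
  constructor
  · rintro rfl
    exact (Ideal.eq_top_iff_one _).2 (by simpa using hI.natCast_mem)
  · rintro rfl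
    exact hI.unique hasIdealNorm_top

theorem hasIdealNorm_span_singleton [Fact q.Prime] {z : ZsqrtNeg q} (hz : z ≠ 0) :
    HasIdealNorm (Ideal.span {z}) z.norm.natAbs := by
  refine ⟨Int.natAbs_pos.2 fun h => hz ((ZsqrtNeg.norm_eq_zero_iff z).1 h), ?_⟩
  rw [conjIdeal_span_singleton, Ideal.span_singleton_mul_span_singleton,
    ← Zsqrtd.norm_eq_mul_conj]
  congr 2
  have : ((z.norm.natAbs : ℤ) : ZsqrtNeg q) = (z.norm : ZsqrtNeg q) := by
    rw [Int.natAbs_of_nonneg (Zsqrtd.norm_nonneg (by omega) _)]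
  rw [← this, Int.cast_natCast]

theorem HasIdealNorm.dvdPrincipal [Fact q.Prime] (hI : HasIdealNorm I n) : I.DvdPrincipal :=
  ⟨conjIdeal I, n, by exact_mod_cast hI.1.ne', hI.2⟩

theorem HasIdealNorm.natCast_ne_zero (hI : HasIdealNorm I n) : (n : ZsqrtNeg q) ≠ 0 := by
  exact_mod_cast hI.1.ne'

theorem HasIdealNorm.ne_bot (hI : HasIdealNorm I n) : I ≠ ⊥ := by
  rintro rfl
  exact hI.natCast_ne_zero (by simpa using hI.natCast_mem)

theorem Ideal.DvdPrincipal.exists_mul_eq {R : Type*} [CommRing R] [IsDomain R] {I J : Ideal R}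
    (hI : I.DvdPrincipal) (h : J ≤ I) : ∃ K, I * K = J := by
  obtain ⟨I', x, hx, hI'⟩ := hI
  have h1 : I' * J ≤ Ideal.span {x} := by
    rw [← hI', mul_comm]
    exact Ideal.mul_mono_left h
  set K : Ideal R := Submodule.comap (LinearMap.mulLeft R x) (I' * J) with hK
  refine ⟨K, ?_⟩
  have h2 : Ideal.span {x} * K = I' * J := by
    refine le_antisymm ?_ fun z hz => ?_
    · rw [Ideal.span_singleton_mul_le_iff]
      exact fun z hz => hz
    · rw [Ideal.mem_span_singleton_mul]
      obtain ⟨y, rfl⟩ := Ideal.mem_span_singleton.1 (h1 hz)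
      exact ⟨y, hz, rfl⟩
  refine Ideal.span_singleton_mul_right_injective hx ?_
  simp only
  rw [mul_left_comm, h2, ← hI', mul_assoc]

theorem HasIdealNorm.of_mul_eq [Fact q.Prime] {K : Ideal (ZsqrtNeg q)} (hI : HasIdealNorm I m)
    (hJ : HasIdealNorm J n) (h : I * K = J) : ∃ k, HasIdealNorm K k ∧ m * k = n := by
  have h1 : Ideal.span {(m : ZsqrtNeg q)} * (K * conjIdeal K) = Ideal.span {(n : ZsqrtNeg q)} := by
    rw [← hI.2, mul_mul_mul_comm, ← conjIdeal_mul, h, hJ.2]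
  obtain ⟨k, rfl⟩ : m ∣ n := by
    rw [← natCast_mem_span_natCast_iff (q := q)]
    have h2 : (n : ZsqrtNeg q) ∈ Ideal.span {(m : ZsqrtNeg q)} * (K * conjIdeal K) := by
      rw [h1]
      exact Ideal.mem_span_singleton_self _
    have hle : Ideal.span {(m : ZsqrtNeg q)} * (K * conjIdeal K) ≤ Ideal.span {(m : ZsqrtNeg q)} :=
      Ideal.mul_le_left
    exact hle h2
  refine ⟨k, ⟨Nat.pos_of_mul_pos_left hJ.1, ?_⟩, rfl⟩
  refine Ideal.span_singleton_mul_right_injective hI.natCast_ne_zero ?_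
  simp only
  rw [h1, Ideal.span_singleton_mul_span_singleton, Nat.cast_mul]

theorem HasIdealNorm.exists_mul_eq_span [Fact q.Prime] (hI : HasIdealNorm I m) {z : ZsqrtNeg q}
    (hz : z ∈ I) (hz0 : z ≠ 0) :
    ∃ K k, HasIdealNorm K k ∧ I * K = Ideal.span {z} ∧ m * k = z.norm.natAbs := by
  obtain ⟨K, hK⟩ := hI.dvdPrincipal.exists_mul_eq ((Ideal.span_singleton_le_iff_mem _).2 hz)
  obtain ⟨k, hk, hmk⟩ := hI.of_mul_eq (hasIdealNorm_span_singleton hz0) hK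
  exact ⟨K, k, hk, hK, hmk⟩

theorem idealClass_conjIdeal [Fact q.Prime] (hI : HasIdealNorm I n) :
    idealClass (conjIdeal I) = (idealClass I)⁻¹ := by
  rw [eq_inv_iff_mul_eq_one, mul_comm, ← idealClass_mul hI.dvdPrincipal hI.conj.dvdPrincipal,
    hI.2]
  exact (idealClass_eq_one_iff (Ideal.dvdPrincipal_span_singleton hI.natCast_ne_zero)).2
    ⟨n, hI.natCast_ne_zero, rfl⟩

theorem idealClass_span_singleton {R : Type*} [CommRing R] [IsDomain R] {x : R} (hx : x ≠ 0) :
    idealClass (Ideal.span {x}) = 1 :=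
  (idealClass_eq_one_iff (Ideal.dvdPrincipal_span_singleton hx)).2 ⟨x, hx, rfl⟩

end HasIdealNorm

/-- `I` has the `ℤ`-basis `d * a, d * (b + √-q)`, and `a * c = b ^ 2 + q`. -/
def HasIdealBasis {q : ℕ} (I : Ideal (ZsqrtNeg q)) (d a : ℕ) (b c : ℤ) : Prop :=
  0 < d ∧ 0 < a ∧ a * c = b ^ 2 + q ∧
    ∀ z, z ∈ I ↔ ∃ x y : ℤ, z = ⟨d * (x * a + y * b), d * y⟩

theorem AddSubgroup.exists_mem_iff_natCast_dvd (H : AddSubgroup ℤ) :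
    ∃ a : ℕ, ∀ x, x ∈ H ↔ (a : ℤ) ∣ x := by
  obtain ⟨a, rfl⟩ := Int.subgroup_cyclic H
  refine ⟨a.natAbs, fun x => ?_⟩
  rw [Int.natAbs_dvd, AddSubgroup.mem_closure_singleton]
  constructor
  · rintro ⟨n, rfl⟩
    exact ⟨n, by simp [mul_comm]⟩
  · rintro ⟨n, rfl⟩
    exact ⟨n, by simp [mul_comm]⟩

theorem exists_hasIdealBasis {q : ℕ} [Fact q.Prime] {I : Ideal (ZsqrtNeg q)} (hI : I ≠ ⊥) :
    ∃ d a b c, HasIdealBasis I d a b c := by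
  let f : ZsqrtNeg q →+ ℤ := ⟨⟨Zsqrtd.im, rfl⟩, fun _ _ => rfl⟩
  obtain ⟨d, hd⟩ := (I.toAddSubgroup.map f).exists_mem_iff_natCast_dvd
  obtain ⟨α, hα⟩ := (I.toAddSubgroup.comap
    (Int.castAddHom (ZsqrtNeg q))).exists_mem_iff_natCast_dvd
  have hd' : ∀ x : ℤ, (∃ z ∈ I, z.im = x) ↔ (d : ℤ) ∣ x := fun x => (hd x)
  have hα' : ∀ x : ℤ, (x : ZsqrtNeg q) ∈ I ↔ (α : ℤ) ∣ x := fun x => (hα x)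
  obtain ⟨z, hz, hz0⟩ := Submodule.exists_mem_ne_zero_of_ne_bot hI
  have hw : ∀ u ∈ I, (⟨-q * u.im, u.re⟩ : ZsqrtNeg q) ∈ I := by
    intro u hu
    convert I.mul_mem_left (⟨0, 1⟩ : ZsqrtNeg q) hu using 1
    ext <;> simp
  have hα0 : 0 < α := by
    rw [Nat.pos_iff_ne_zero]
    rintro rfl
    have h1 : ((z.norm : ℤ) : ZsqrtNeg q) ∈ I := by
      rw [Zsqrtd.norm_eq_mul_conj]
      exact I.mul_mem_right _ hz
    rw [hα', Nat.cast_zero, zero_dvd_iff, ZsqrtNeg.norm_eq_zero_iff] at h1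
    exact hz0 h1
  have hdα : (d : ℤ) ∣ α := by
    rw [← hd']
    exact ⟨_, hw _ ((hα' α).2 dvd_rfl), by simp⟩
  obtain ⟨a, rfl⟩ := Int.natCast_dvd_natCast.1 hdα
  obtain ⟨u, hu, hud⟩ := (hd' d).2 dvd_rfl
  obtain ⟨b, hb⟩ : (d : ℤ) ∣ u.re := by
    rw [← hd']
    exact ⟨_, hw _ hu, rfl⟩
  have hd0 : 0 < d := Nat.pos_of_mul_pos_right hα0
  have hu' : u = ⟨d * b, d⟩ := by
    ext
    · exact hb
    · exact hud
  have h2 : ((d : ℤ) * a) ∣ d * (b ^ 2 + q) := by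
    have h3 : ((d * (b ^ 2 + q) : ℤ) : ZsqrtNeg q) ∈ I := by
      convert I.mul_mem_left (⟨b, -1⟩ : ZsqrtNeg q) hu using 1
      rw [hu']
      ext <;> simp [-Int.cast_mul, -Int.cast_add]
      · ring
      · ring
    rw [hα'] at h3
    exact_mod_cast h3
  obtain ⟨c, hc⟩ := Int.dvd_of_mul_dvd_mul_left (by exact_mod_cast hd0.ne') h2
  refine ⟨d, a, b, c, hd0, Nat.pos_of_mul_pos_left hα0, hc.symm, fun z => ⟨fun hz => ?_, ?_⟩⟩
  · obtain ⟨y, hy⟩ := (hd' _).1 ⟨z, hz, rfl⟩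
    have h4 : ((z.re - y * (d * b) : ℤ) : ZsqrtNeg q) ∈ I := by
      convert I.sub_mem hz (I.mul_mem_left (y : ZsqrtNeg q) hu) using 1
      rw [hu']
      ext
      · simp [-Int.cast_mul, -Int.cast_sub]
      · simp [-Int.cast_mul, -Int.cast_sub, hy]
        ring
    obtain ⟨x, hx⟩ := (hα' _).1 h4
    refine ⟨x, y, ?_⟩
    ext
    · push_cast at hx
      linear_combination hx
    · exact hy
  · rintro ⟨x, y, rfl⟩
    have h5 := I.add_mem (I.mul_mem_left (x : ZsqrtNeg q) ((hα' _).2 (dvd_refl ((d * a : ℕ) : ℤ))))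
      (I.mul_mem_left (y : ZsqrtNeg q) hu)
    convert h5 using 1
    rw [hu']
    ext
    · simp
      ring
    · simp
      ring

section HasIdealBasis

variable {q : ℕ} {I : Ideal (ZsqrtNeg q)} {d a : ℕ} {b c : ℤ}

theorem HasIdealBasis.eq_span (h : HasIdealBasis I d a b c) :
    I = Ideal.span {(d : ZsqrtNeg q)} * Ideal.span {(a : ZsqrtNeg q), ⟨b, 1⟩} := by
  obtain ⟨-, -, -, h⟩ := h
  refine le_antisymm (fun z hz => ?_) ?_
  · obtain ⟨x, y, rfl⟩ := (h z).1 hz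
    rw [Ideal.mem_span_singleton_mul]
    refine ⟨_, Ideal.mem_span_pair.2 ⟨x, y, rfl⟩, ?_⟩
    ext <;> simp
  · rw [Ideal.span_singleton_mul_le_iff]
    intro z hz
    obtain ⟨x, y, rfl⟩ := Ideal.mem_span_pair.1 hz
    rw [mul_add, mul_left_comm, mul_left_comm _ y]
    refine I.add_mem (I.mul_mem_left _ ((h _).2 ⟨1, 0, ?_⟩))
      (I.mul_mem_left _ ((h _).2 ⟨0, 1, ?_⟩))
    · ext <;> simp
    · ext <;> simp

theorem HasIdealBasis.mul_conjIdeal (h : HasIdealBasis I d a b c) :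
    I * conjIdeal I = Ideal.span {((d ^ 2 * a : ℕ) : ZsqrtNeg q)} *
      Ideal.span {(a : ZsqrtNeg q), ⟨b, -1⟩, ⟨b, 1⟩, (c : ZsqrtNeg q)} := by
  have h1 : Ideal.span {(a : ZsqrtNeg q), ⟨b, 1⟩} * conjIdeal (Ideal.span {(a : ZsqrtNeg q), ⟨b, 1⟩})
      = Ideal.span {(a : ZsqrtNeg q)} *
        Ideal.span {(a : ZsqrtNeg q), ⟨b, -1⟩, ⟨b, 1⟩, (c : ZsqrtNeg q)} := by
    rw [conjIdeal, Ideal.map_span, Set.image_pair, Ideal.span_pair_mul_span_pair,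
      Ideal.span_mul_span', Set.singleton_mul]
    congr 1
    simp only [Set.image_insert_eq, Set.image_singleton, starRingAut_apply]
    have e1 : star (a : ZsqrtNeg q) = a := by ext <;> simp
    have e2 : star (⟨b, 1⟩ : ZsqrtNeg q) = ⟨b, -1⟩ := by ext <;> simp
    have e3 : (⟨b, 1⟩ : ZsqrtNeg q) * ⟨b, -1⟩ = a * c := by
      have : (a : ZsqrtNeg q) * c = ((a * c : ℤ) : ZsqrtNeg q) := by push_cast; rfl
      rw [this, h.2.2.1]
      ext
      · simp [-Int.cast_mul, -Int.cast_add]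
        ring
      · simp [-Int.cast_mul, -Int.cast_add]
    rw [e1, e2, e3, mul_comm (⟨b, 1⟩ : ZsqrtNeg q) (a : ZsqrtNeg q)]
  rw [h.eq_span, conjIdeal_mul, mul_mul_mul_comm, h1, conjIdeal_span_singleton,
    ← mul_assoc, Ideal.span_singleton_mul_span_singleton, Ideal.span_singleton_mul_span_singleton]
  congr 3
  have e1 : star (d : ZsqrtNeg q) = d := by ext <;> simp
  rw [e1]
  push_cast
  ring

theorem HasIdealBasis.norm_eq [Fact q.Prime] (h : HasIdealBasis I d a b c) {n : ℕ}
    (hn : HasIdealNorm I n) : n = d ^ 2 * a ∧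
      Ideal.span {(a : ZsqrtNeg q), ⟨b, -1⟩, ⟨b, 1⟩, (c : ZsqrtNeg q)} = ⊤ := by
  have h1 := h.mul_conjIdeal
  rw [hn.2] at h1
  have h0 : 0 < d ^ 2 * a := Nat.mul_pos (pow_pos h.1 _) h.2.1
  have h0' : ((d ^ 2 * a : ℕ) : ZsqrtNeg q) ≠ 0 := by exact_mod_cast h0.ne'
  obtain ⟨k, rfl⟩ : d ^ 2 * a ∣ n := by
    rw [← natCast_mem_span_natCast_iff (q := q)]
    have h2 := Ideal.mem_span_singleton_self (n : ZsqrtNeg q)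
    rw [h1] at h2
    have hle : Ideal.span {((d ^ 2 * a : ℕ) : ZsqrtNeg q)} * Ideal.span
      {(a : ZsqrtNeg q), ⟨b, -1⟩, ⟨b, 1⟩, (c : ZsqrtNeg q)} ≤
      Ideal.span {((d ^ 2 * a : ℕ) : ZsqrtNeg q)} := Ideal.mul_le_left
    exact hle h2
  rw [Nat.cast_mul, ← Ideal.span_singleton_mul_span_singleton] at h1
  have h2 := Ideal.span_singleton_mul_right_injective h0' h1
  have h3 : (⟨b, 1⟩ : ZsqrtNeg q) ∈ Ideal.span {(k : ZsqrtNeg q)} := by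
    rw [h2]
    exact Ideal.subset_span (by simp)
  obtain ⟨z, hz⟩ := Ideal.mem_span_singleton.1 h3
  have h4 : (k : ℤ) ∣ 1 := ⟨z.im, by simpa using congrArg Zsqrtd.im hz⟩
  have h5 : k = 1 := by
    rw [← Nat.dvd_one]
    exact_mod_cast h4
  subst h5
  rw [mul_one, ← h2, Nat.cast_one, Ideal.span_singleton_one]
  exact ⟨rfl, rfl⟩

theorem HasIdealBasis.hasIdealNorm (h : HasIdealBasis I d a b c) (ha : a.Coprime (2 * q)) :
    HasIdealNorm I (d ^ 2 * a) := by
  refine ⟨Nat.mul_pos (pow_pos h.1 _) h.2.1, ?_⟩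
  rw [h.mul_conjIdeal]
  set L := Ideal.span {(a : ZsqrtNeg q), ⟨b, -1⟩, ⟨b, 1⟩, (c : ZsqrtNeg q)} with hL
  have ha' : (a : ZsqrtNeg q) ∈ L := Ideal.subset_span (by simp)
  have h2b : (2 * b : ZsqrtNeg q) ∈ L := by
    have := L.add_mem (Ideal.subset_span (by simp) : (⟨b, 1⟩ : ZsqrtNeg q) ∈ L)
      (Ideal.subset_span (by simp) : (⟨b, -1⟩ : ZsqrtNeg q) ∈ L)
    convert this using 1
    ext
    · simp
      ring
    · simp
  have h4q : ((4 * q : ℕ) : ZsqrtNeg q) ∈ L := by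
    have h1 := L.sub_mem (L.mul_mem_left (4 * c : ZsqrtNeg q) ha') (L.mul_mem_left (2 * b) h2b)
    convert h1 using 1
    have := congrArg (fun t : ℤ => (t : ZsqrtNeg q)) h.2.2.1
    push_cast at this ⊢
    linear_combination -4 * this
  have hco : Nat.Coprime a (4 * q) := by
    have h2 : Nat.Coprime a 2 := ha.coprime_mul_right_right
    have h3 : Nat.Coprime a q := ha.coprime_mul_left_right
    have : Nat.Coprime a (2 * 2) := h2.mul_right h2
    exact this.mul_right h3
  have htop : L = ⊤ := by
    rw [Ideal.eq_top_iff_one]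
    obtain ⟨u, v, huv⟩ := Nat.isCoprime_iff_coprime.2 hco
    have := L.add_mem (L.mul_mem_left (u : ZsqrtNeg q) ha') (L.mul_mem_left (v : ZsqrtNeg q) h4q)
    convert this using 1
    exact_mod_cast congrArg (fun t : ℤ => (t : ZsqrtNeg q)) huv.symm
  rw [htop, Ideal.mul_top]

end HasIdealBasis

/-- `I` is an ideal of norm coprime to `2 * q`. -/
def HasCoprimeNorm {q : ℕ} (I : Ideal (ZsqrtNeg q)) : Prop :=
  ∃ n, HasIdealNorm I n ∧ n.Coprime (2 * q)

theorem hasCoprimeNorm_of_natCast_mem {q : ℕ} [Fact q.Prime] {I : Ideal (ZsqrtNeg q)} {m : ℕ}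
    (hm : (m : ZsqrtNeg q) ∈ I) (hmq : m.Coprime (2 * q)) : HasCoprimeNorm I := by
  have hI : I ≠ ⊥ := by
    rintro rfl
    have h0 : m = 0 := by exact_mod_cast (Ideal.mem_bot.1 hm)
    rw [h0, Nat.coprime_zero_left] at hmq
    omega
  obtain ⟨d, a, b, c, h⟩ := exists_hasIdealBasis hI
  obtain ⟨x, y, hxy⟩ := (h.2.2.2 _).1 hm
  have h1 := congrArg Zsqrtd.re hxy
  have h2 := congrArg Zsqrtd.im hxy
  simp only [Zsqrtd.re_natCast, Zsqrtd.im_natCast] at h1 h2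
  have hy : y = 0 := by
    rcases mul_eq_zero.1 h2.symm with h3 | h3
    · exact absurd (by exact_mod_cast h3) h.1.ne'
    · exact h3
  subst hy
  have h3 : d * a ∣ m := by
    rw [← Int.natCast_dvd_natCast]
    exact ⟨x, by rw [h1]; push_cast; ring⟩
  have h4 := hmq.coprime_dvd_left h3
  have hd := h4.coprime_mul_right
  have ha := h4.coprime_mul_left
  exact ⟨_, h.hasIdealNorm ha, (hd.pow_left 2).mul_left ha⟩

/-- Reduction modulo the ideal `(2, 1 + √-q)`. -/
def ZsqrtNeg.modTwo {q : ℕ} (hq : q % 2 = 1) : ZsqrtNeg q →+* ZMod 2 :=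
  Zsqrtd.lift ⟨1, by
    have : (q : ZMod 2) = 1 := by
      rw [← ZMod.natCast_mod, hq, Nat.cast_one]
    push_cast
    rw [this]
    decide⟩

/-- Reduction modulo the ideal `(√-q)`. -/
def ZsqrtNeg.modSelf (q : ℕ) : ZsqrtNeg q →+* ZMod q :=
  Zsqrtd.lift ⟨0, by simp⟩

theorem ZsqrtNeg.modTwo_apply {q : ℕ} (hq : q % 2 = 1) (z : ZsqrtNeg q) :
    modTwo hq z = z.re + z.im := by
  simp [modTwo]

theorem ZsqrtNeg.modSelf_apply {q : ℕ} (z : ZsqrtNeg q) : modSelf q z = z.re := by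
  simp [modSelf]

theorem ZsqrtNeg.norm_modTwo {q : ℕ} (hq : q % 2 = 1) (z : ZsqrtNeg q) :
    (z.norm : ZMod 2) = modTwo hq z ^ 2 := by
  have : (q : ZMod 2) = 1 := by
    rw [← ZMod.natCast_mod, hq, Nat.cast_one]
  have h2 : (2 : ZMod 2) = 0 := by decide
  rw [modTwo_apply, norm_eq]
  push_cast
  rw [this]
  linear_combination (-(z.re : ZMod 2) * z.im) * h2

theorem ZsqrtNeg.norm_modSelf {q : ℕ} (z : ZsqrtNeg q) :
    (z.norm : ZMod q) = modSelf q z ^ 2 := by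
  rw [modSelf_apply, norm_eq]
  push_cast
  simp

theorem Nat.coprime_two_mul_iff {q : ℕ} [Fact q.Prime] {n : ℕ} :
    n.Coprime (2 * q) ↔ (n : ZMod 2) ≠ 0 ∧ (n : ZMod q) ≠ 0 := by
  rw [Nat.coprime_mul_iff_right, Nat.coprime_comm, Nat.Prime.coprime_iff_not_dvd Nat.prime_two,
    Nat.coprime_comm, Nat.Prime.coprime_iff_not_dvd (Fact.out : q.Prime), ne_eq, ne_eq,
    ZMod.natCast_eq_zero_iff, ZMod.natCast_eq_zero_iff]

theorem ZsqrtNeg.natAbs_norm_cast {q : ℕ} (z : ZsqrtNeg q) (R : Type*) [Ring R] :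
    (z.norm.natAbs : R) = (z.norm : R) := by
  rw [← Int.cast_natCast, Int.natAbs_of_nonneg (Zsqrtd.norm_nonneg (by omega) _)]

theorem ZsqrtNeg.coprime_natAbs_norm_iff {q : ℕ} [Fact q.Prime] (hq : q % 2 = 1)
    {z : ZsqrtNeg q} :
    z.norm.natAbs.Coprime (2 * q) ↔ modTwo hq z ≠ 0 ∧ modSelf q z ≠ 0 := by
  rw [Nat.coprime_two_mul_iff, natAbs_norm_cast, natAbs_norm_cast, norm_modTwo hq, norm_modSelf]
  simp

theorem ZsqrtNeg.natAbs_norm_mem {q : ℕ} {I : Ideal (ZsqrtNeg q)} {z : ZsqrtNeg q} (hz : z ∈ I) :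
    (z.norm.natAbs : ZsqrtNeg q) ∈ I := by
  rw [natAbs_norm_cast, Zsqrtd.norm_eq_mul_conj]
  exact I.mul_mem_right _ hz

theorem exists_hasCoprimeNorm_idealClass_eq {q : ℕ} [Fact q.Prime] (hq : q % 2 = 1)
    (C : ClassGroup (ZsqrtNeg q)) :
    ∃ I : Ideal (ZsqrtNeg q), HasCoprimeNorm I ∧ idealClass I = C := by
  obtain ⟨I, ⟨J, x, hx, hIJ⟩, rfl⟩ := exists_idealClass_eq C
  have hI : I.DvdPrincipal := ⟨J, x, hx, hIJ⟩
  have hJ : J.DvdPrincipal := ⟨I, x, hx, by rw [mul_comm, hIJ]⟩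
  have hlt : ∀ P : Ideal (ZsqrtNeg q), P ≠ ⊤ → ¬ J ≤ J * P := fun P hP h =>
    hP (hJ.mul_left_cancel ((le_antisymm (Ideal.mul_mono_right le_top) (by rwa [Ideal.mul_top])) :
      J * P = J * ⊤))
  set P₂ := RingHom.ker (ZsqrtNeg.modTwo hq)
  set P₁ := RingHom.ker (ZsqrtNeg.modSelf q)
  have h1 : ¬ ((J : Set (ZsqrtNeg q)) ⊆ (J * P₂ : Ideal _) ∪ (J * P₁ : Ideal _)) := by
    rw [Ideal.subset_union, not_or]
    exact ⟨hlt _ (RingHom.ker_ne_top _), hlt _ (RingHom.ker_ne_top _)⟩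
  obtain ⟨α, hα, hα'⟩ := Set.not_subset.1 h1
  rw [Set.mem_union, not_or] at hα'
  have hα0 : α ≠ 0 := by
    rintro rfl
    exact hα'.1 (Submodule.zero_mem _)
  obtain ⟨K, hK⟩ := hJ.exists_mul_eq ((Ideal.span_singleton_le_iff_mem _).2 hα)
  have hαK : α ∈ J * K := by
    rw [hK]
    exact Ideal.mem_span_singleton_self α
  have h2 : ¬ ((K : Set (ZsqrtNeg q)) ⊆ P₂ ∪ P₁) := by
    rw [Ideal.subset_union, not_or]
    exact ⟨fun h => hα'.1 (Ideal.mul_mono_right h hαK), fun h => hα'.2 (Ideal.mul_mono_right h hαK)⟩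
  obtain ⟨k, hk, hk'⟩ := Set.not_subset.1 h2
  rw [Set.mem_union, not_or] at hk'
  refine ⟨K, hasCoprimeNorm_of_natCast_mem (ZsqrtNeg.natAbs_norm_mem hk)
    ((ZsqrtNeg.coprime_natAbs_norm_iff hq).2 hk'), ?_⟩
  have hKd : K.DvdPrincipal := ⟨J, α, hα0, by rw [mul_comm, hK]⟩
  have e1 := idealClass_mul hI hJ
  have e2 := idealClass_mul hKd hJ
  rw [hIJ, idealClass_span_singleton hx] at e1
  rw [mul_comm, hK, idealClass_span_singleton hα0, e1] at e2
  exact (mul_right_cancel e2).symm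

theorem finite_setOf_hasIdealNorm {q : ℕ} (n : ℕ) :
    {I : Ideal (ZsqrtNeg q) | HasIdealNorm I n}.Finite := by
  rcases Nat.eq_zero_or_pos n with rfl | hn
  · exact Set.Finite.subset Set.finite_empty fun I hI => absurd hI.1 (lt_irrefl 0)
  have : NeZero n := ⟨hn.ne'⟩
  let Φ : Ideal (ZsqrtNeg q) → Set (ZMod n × ZMod n) := fun I =>
    (fun z : ZsqrtNeg q => ((z.re : ZMod n), (z.im : ZMod n))) '' I
  have key : ∀ I J : Ideal (ZsqrtNeg q), HasIdealNorm J n → Φ I ⊆ Φ J → I ≤ J := by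
    intro I J hJ h z hz
    obtain ⟨z', hz', he⟩ := h ⟨z, hz, rfl⟩
    simp only [Prod.mk.injEq] at he
    obtain ⟨x, hx⟩ := (ZMod.intCast_eq_intCast_iff_dvd_sub _ _ _).1 he.1
    obtain ⟨y, hy⟩ := (ZMod.intCast_eq_intCast_iff_dvd_sub _ _ _).1 he.2
    have := J.add_mem (J.mul_mem_left (⟨x, y⟩ : ZsqrtNeg q) hJ.natCast_mem) hz'
    convert this using 1
    ext
    · simp
      linear_combination hx
    · simp
      linear_combination hy
  refine Set.Finite.of_finite_image (Set.toFinite (Φ '' _)) fun I hI J hJ h => ?_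
  exact le_antisymm (key I J hJ h.le) (key J I hI h.ge)

theorem exists_hasIdealNorm_le {q : ℕ} [Fact q.Prime] (hq : q % 2 = 1)
    (C : ClassGroup (ZsqrtNeg q)) :
    ∃ (I : Ideal (ZsqrtNeg q)) (m : ℕ), HasIdealNorm I m ∧ idealClass I = C ∧ m ≤ 2 * q := by
  classical
  have hex : ∃ m, ∃ I : Ideal (ZsqrtNeg q), HasIdealNorm I m ∧ idealClass I = C := by
    obtain ⟨I, ⟨n, hn, -⟩, hC⟩ := exists_hasCoprimeNorm_idealClass_eq hq C
    exact ⟨n, I, hn, hC⟩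
  obtain ⟨J, hJ, hC⟩ := Nat.find_spec hex
  set m := Nat.find hex with hm
  refine ⟨J, m, hJ, hC, ?_⟩
  have hmin : ∀ α ∈ J, α ≠ 0 → (m : ℤ) ^ 2 ≤ α.norm := by
    intro α hα hα0
    obtain ⟨K, k, hK, hJK, hmk⟩ := hJ.exists_mul_eq_span hα hα0
    have h1 : idealClass (conjIdeal K) = C := by
      have h2 := idealClass_mul hJ.dvdPrincipal hK.dvdPrincipal
      rw [hJK, idealClass_span_singleton hα0] at h2
      rw [idealClass_conjIdeal hK, ← hC, eq_comm, eq_inv_iff_mul_eq_one, ← h2]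
    have h3 : m ≤ k := Nat.find_min' hex ⟨_, hK.conj, h1⟩
    rw [← Int.natAbs_of_nonneg (Zsqrtd.norm_nonneg (by omega) α), ← hmk, sq]
    exact_mod_cast Nat.mul_le_mul_left m h3
  obtain ⟨d, a, b, c, hB⟩ := exists_hasIdealBasis hJ.ne_bot
  obtain ⟨hd, ha, hac, hmem⟩ := hB
  have hmda : m = d ^ 2 * a := (HasIdealBasis.norm_eq ⟨hd, ha, hac, hmem⟩ hJ).1
  have hq0 := (Fact.out : q.Prime).pos
  set k : ℤ := (2 * b + a) / (2 * a) with hk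
  have ha2 : (0 : ℤ) < 2 * a := by positivity
  have hk1 := Int.mul_ediv_add_emod (2 * b + a) (2 * a)
  have hk2 := Int.emod_nonneg (2 * b + a) ha2.ne'
  have hk3 := Int.emod_lt_of_pos (2 * b + a) ha2
  rw [← hk] at hk1
  have h4 := hmin ⟨d * (-k * a + 1 * b), d * 1⟩ ((hmem _).2 ⟨-k, 1, rfl⟩) (by
    intro h0
    have := congrArg Zsqrtd.im h0
    simp at this
    omega)
  rw [ZsqrtNeg.norm_eq, hmda] at h4
  push_cast at h4
  set e : ℤ := b - k * a with he
  have h5 : (2 * e) ^ 2 ≤ (a : ℤ) ^ 2 := by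
    refine sq_le_sq' ?_ ?_ <;> rw [he] <;> linarith
  have h6 : ((d : ℤ) ^ 2 * a) ^ 2 ≤ d ^ 2 * (e ^ 2 + q) := by
    rw [he]
    linarith
  have hd2 : (0 : ℤ) < (d : ℤ) ^ 2 := by positivity
  have h7 : (d : ℤ) ^ 2 * a ^ 2 ≤ e ^ 2 + q := by
    refine le_of_mul_le_mul_left ?_ hd2
    linarith
  have h8 : (1 : ℤ) ≤ (d : ℤ) ^ 2 := hd2
  have h9 : (a : ℤ) ≤ (a : ℤ) ^ 2 := by
    have : (1 : ℤ) ≤ a := by exact_mod_cast ha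
    nlinarith
  have h10 : (d : ℤ) ^ 2 * a ≤ 2 * q := by nlinarith
  rw [hmda]
  exact_mod_cast h10

theorem finite_classGroup {q : ℕ} [Fact q.Prime] (hq : q % 2 = 1) :
    Finite (ClassGroup (ZsqrtNeg q)) := by
  have hfin : (⋃ m ∈ Finset.range (2 * q + 1),
      {I : Ideal (ZsqrtNeg q) | HasIdealNorm I m}).Finite :=
    Set.Finite.biUnion (Finset.finite_toSet _) fun m _ => finite_setOf_hasIdealNorm m
  rw [← Set.finite_univ_iff]
  refine (hfin.image idealClass).subset fun C _ => ?_
  obtain ⟨I, m, hI, hC, hm⟩ := exists_hasIdealNorm_le hq C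
  refine ⟨I, ?_, hC⟩
  simp only [Set.mem_iUnion]
  exact ⟨m, Finset.mem_range.2 (by omega), hI⟩

theorem HasIdealBasis.odd_right {q : ℕ} [Fact q.Prime] (hq : q % 2 = 1) {I : Ideal (ZsqrtNeg q)}
    {d a n : ℕ} {b c : ℤ} (h : HasIdealBasis I d a b c) (hn : HasIdealNorm I n) (ha : 2 ∣ a) :
    c % 2 = 1 := by
  by_contra hc
  have hc2 : (2 : ℤ) ∣ c := by omega
  have ha2 : (2 : ℤ) ∣ a := by exact_mod_cast ha
  have hb : b % 2 = 1 := by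
    have h1 : (2 : ℤ) ∣ b ^ 2 + q := by
      rw [← h.2.2.1]
      exact Dvd.dvd.mul_right ha2 c
    rcases Int.emod_two_eq_zero_or_one b with h2 | h2
    · obtain ⟨k, rfl⟩ := Int.dvd_of_emod_eq_zero h2
      rw [mul_pow] at h1
      omega
    · exact h2
  have hle : Ideal.span {(a : ZsqrtNeg q), ⟨b, -1⟩, ⟨b, 1⟩, (c : ZsqrtNeg q)} ≤
      RingHom.ker (ZsqrtNeg.modTwo hq) := by
    rw [Ideal.span_le]
    have hb2 : (b : ZMod 2) = 1 := by
      have := (ZMod.intCast_eq_intCast_iff_dvd_sub 1 b 2).2 (by push_cast; omega)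
      rw [← this, Int.cast_one]
    have ha0 : (a : ZMod 2) = 0 := (ZMod.natCast_eq_zero_iff _ _).2 ha
    have hc0 : (c : ZMod 2) = 0 := (ZMod.intCast_zmod_eq_zero_iff_dvd _ 2).2 (by exact_mod_cast hc2)
    rintro z (rfl | rfl | rfl | rfl)
    · simp [RingHom.mem_ker, ha0]
    · rw [SetLike.mem_coe, RingHom.mem_ker, ZsqrtNeg.modTwo_apply, hb2]
      simp only [Int.cast_neg, Int.cast_one]
      decide
    · rw [SetLike.mem_coe, RingHom.mem_ker, ZsqrtNeg.modTwo_apply, hb2, Int.cast_one]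
      decide
    · simp [RingHom.mem_ker, hc0]
  rw [(h.norm_eq hn).2, top_le_iff] at hle
  exact RingHom.ker_ne_top _ hle

theorem idealClass_eq_one_of_conjIdeal_eq {q : ℕ} [Fact q.Prime] (hq : q % 4 = 3)
    {J : Ideal (ZsqrtNeg q)} {n : ℕ} (hJ : HasIdealNorm J n) (hconj : conjIdeal J = J) :
    idealClass J = 1 := by
  obtain ⟨d, a, b, c, h⟩ := exists_hasIdealBasis hJ.ne_bot
  have hd : (d : ℤ) ≠ 0 := by exact_mod_cast h.1.ne'
  have hac := h.2.2.1
  have h2b : (a : ℤ) ∣ 2 * b := by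
    have h1 : (⟨d * (0 * a + 1 * b), d * 1⟩ : ZsqrtNeg q) ∈ J := (h.2.2.2 _).2 ⟨0, 1, rfl⟩
    have h2 := h1
    rw [← hconj, mem_conjIdeal] at h2
    obtain ⟨x, y, hxy⟩ := (h.2.2.2 _).1 (J.add_mem h1 h2)
    have e1 := congrArg Zsqrtd.re hxy
    have e2 := congrArg Zsqrtd.im hxy
    simp only [Zsqrtd.re_add, Zsqrtd.im_add, Zsqrtd.re_star, Zsqrtd.im_star] at e1 e2
    have hy : y = 0 := by
      refine (mul_eq_zero.1 ?_).resolve_left hd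
      rw [← e2]
      ring
    subst hy
    refine ⟨x, mul_left_cancel₀ hd ?_⟩
    linear_combination e1
  rcases Nat.even_or_odd a with hae | hao
  · exfalso
    have hc := h.odd_right (by omega) hJ hae.two_dvd
    obtain ⟨a', rfl⟩ := hae.two_dvd
    have hb : b % 2 = 1 := by
      rcases Int.emod_two_eq_zero_or_one b with h2 | h2
      · obtain ⟨k, rfl⟩ := Int.dvd_of_emod_eq_zero h2
        push_cast at hac
        have : 2 * (a' * c - 2 * k ^ 2) = (q : ℤ) := by linear_combination hac
        omega
      · exact h2
    obtain ⟨k, hk⟩ : ∃ k, b = 2 * k + 1 := ⟨b / 2, by omega⟩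
    obtain ⟨l, hl⟩ : ∃ l, c = 2 * l + 1 := ⟨c / 2, by omega⟩
    obtain ⟨t, ht⟩ : ∃ t : ℤ, (q : ℤ) = 4 * t + 3 := ⟨q / 4, by omega⟩
    have e1 : (a' : ℤ) = 2 * (k ^ 2 + k + t + 1 - a' * l) := by
      rw [hk, hl, ht] at hac
      push_cast at hac
      linarith
    obtain ⟨y, hy⟩ := h2b
    push_cast at hy
    have e2 : b = 2 * ((k ^ 2 + k + t + 1 - a' * l) * y) := by
      rw [e1] at hy
      linarith
    omega
  · have hb : (a : ℤ) ∣ b :=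
      IsCoprime.dvd_of_dvd_mul_left (Int.isCoprime_iff_gcd_eq_one.2 (by
        have : Nat.Coprime a 2 := hao.coprime_two_right
        simpa [Int.gcd] using this)) h2b
    have haq : a ∣ q := by
      have : (a : ℤ) ∣ q := by
        rw [← dvd_add_right (Dvd.dvd.pow hb two_ne_zero), ← hac]
        exact Dvd.intro _ rfl
      exact_mod_cast this
    have hd' : (d : ZsqrtNeg q) ≠ 0 := by exact_mod_cast h.1.ne'
    have hprin : ∃ x : ZsqrtNeg q, x ≠ 0 ∧
        Ideal.span {(a : ZsqrtNeg q), ⟨b, 1⟩} = Ideal.span {x} := by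
      rcases (Nat.dvd_prime (Fact.out : q.Prime)).1 haq with rfl | rfl
      · refine ⟨1, one_ne_zero, ?_⟩
        rw [Ideal.span_singleton_one, Ideal.eq_top_iff_one]
        exact Ideal.subset_span (by simp)
      · obtain ⟨b', rfl⟩ := hb
        refine ⟨⟨0, 1⟩, fun h0 => one_ne_zero (congrArg Zsqrtd.im h0), le_antisymm ?_ ?_⟩
        · rw [Ideal.span_le]
          rintro z (rfl | rfl)
          · refine Ideal.mem_span_singleton.2 ⟨⟨0, -1⟩, ?_⟩
            ext <;> simp
          · refine Ideal.mem_span_singleton.2 ⟨⟨1, -b'⟩, ?_⟩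
            ext <;> simp
        · rw [Ideal.span_singleton_le_iff_mem, Ideal.mem_span_pair]
          refine ⟨-b', 1, ?_⟩
          ext
          · simp
            ring
          · simp
    obtain ⟨x, hx, hxs⟩ := hprin
    rw [h.eq_span, hxs, Ideal.span_singleton_mul_span_singleton]
    exact idealClass_span_singleton (mul_ne_zero hd' hx)

theorem odd_card_classGroup {q : ℕ} [Fact q.Prime] (hq : q % 4 = 3) :
    Odd (Nat.card (ClassGroup (ZsqrtNeg q))) := by
  have : Finite (ClassGroup (ZsqrtNeg q)) := finite_classGroup (by omega)
  rw [← Nat.not_even_iff_odd, even_iff_two_dvd]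
  intro h2
  have : Fact (Nat.Prime 2) := ⟨Nat.prime_two⟩
  obtain ⟨C, hC⟩ := exists_prime_orderOf_dvd_card' 2 h2
  obtain ⟨I, n, hI, hIC, -⟩ := exists_hasIdealNorm_le (by omega) C
  have hC1 : C ≠ 1 := fun h => by simp [h] at hC
  have hCC : C * C = 1 := by rw [← sq, ← hC, pow_orderOf_eq_one]
  obtain ⟨α, hα, hIα⟩ := (idealClass_eq_one_iff (hI.mul hI).dvdPrincipal).1 (by
    rw [idealClass_mul hI.dvdPrincipal hI.dvdPrincipal, hIC, hCC])
  have hN : α.norm.natAbs = n * n := by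
    refine (hasIdealNorm_span_singleton hα).unique ?_
    rw [← hIα]
    exact hI.mul hI
  have hN' : α * star α = n * n := by
    rw [← Zsqrtd.norm_eq_mul_conj, ← ZsqrtNeg.natAbs_norm_cast, hN, Nat.cast_mul]
  have key : Ideal.span {α} * conjIdeal I = Ideal.span {(n : ZsqrtNeg q)} * I := by
    rw [← hIα, ← hI.2]
    ring
  refine hC1 ?_
  by_cases hδ : α = -n
  · rw [hδ, Ideal.span_singleton_neg] at key
    rw [← hIC]
    exact idealClass_eq_one_of_conjIdeal_eq hq hI
      (Ideal.span_singleton_mul_right_injective hI.natCast_ne_zero key)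
  · have hδ0 : (n : ZsqrtNeg q) + star α ≠ 0 := by
      intro h0
      apply hδ
      have := congrArg star h0
      rw [star_add, star_star, star_zero] at this
      rw [eq_neg_iff_add_eq_zero, ← this, add_comm]
      ext <;> simp
    have hJ := (hasIdealNorm_span_singleton hδ0).mul hI
    have h3 := idealClass_eq_one_of_conjIdeal_eq hq hJ (by
      refine Ideal.span_singleton_mul_right_injective hα ?_
      simp only
      have hsn : star (n : ZsqrtNeg q) = n := by ext <;> simp
      rw [conjIdeal_mul, conjIdeal_span_singleton, mul_left_comm, key, star_add, star_star, hsn,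
        ← mul_assoc, ← mul_assoc, Ideal.span_singleton_mul_span_singleton,
        Ideal.span_singleton_mul_span_singleton]
      congr 3
      linear_combination -hN')
    rwa [idealClass_mul (Ideal.dvdPrincipal_span_singleton hδ0) hI.dvdPrincipal,
      idealClass_span_singleton hδ0, one_mul, hIC] at h3

open scoped Classical in
/-- The norm of an invertible ideal (`0` for other ideals). -/
noncomputable def idealNorm {q : ℕ} (I : Ideal (ZsqrtNeg q)) : ℕ :=
  if h : ∃ n, HasIdealNorm I n then h.choose else 0

theorem HasIdealNorm.idealNorm_eq {q n : ℕ} {I : Ideal (ZsqrtNeg q)} (h : HasIdealNorm I n) :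
    idealNorm I = n := by
  have hex : ∃ n, HasIdealNorm I n := ⟨n, h⟩
  rw [idealNorm, dif_pos hex]
  exact hex.choose_spec.unique h

theorem HasCoprimeNorm.hasIdealNorm {q : ℕ} {I : Ideal (ZsqrtNeg q)} (h : HasCoprimeNorm I) :
    HasIdealNorm I (idealNorm I) := by
  obtain ⟨n, hn, -⟩ := h
  rwa [hn.idealNorm_eq]

theorem HasCoprimeNorm.coprime {q : ℕ} {I : Ideal (ZsqrtNeg q)} (h : HasCoprimeNorm I) :
    (idealNorm I).Coprime (2 * q) := by
  obtain ⟨n, hn, hc⟩ := h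
  rwa [hn.idealNorm_eq]

theorem HasCoprimeNorm.mul {q : ℕ} {I J : Ideal (ZsqrtNeg q)} (hI : HasCoprimeNorm I)
    (hJ : HasCoprimeNorm J) : HasCoprimeNorm (I * J) :=
  ⟨_, hI.hasIdealNorm.mul hJ.hasIdealNorm, hI.coprime.mul_left hJ.coprime⟩

theorem hasCoprimeNorm_top {q : ℕ} : HasCoprimeNorm (⊤ : Ideal (ZsqrtNeg q)) :=
  ⟨1, hasIdealNorm_top, Nat.coprime_one_left _⟩

theorem HasCoprimeNorm.mono {q : ℕ} [Fact q.Prime] {I J : Ideal (ZsqrtNeg q)}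
    (hI : HasCoprimeNorm I) (h : I ≤ J) : HasCoprimeNorm J :=
  hasCoprimeNorm_of_natCast_mem (h hI.hasIdealNorm.natCast_mem) hI.coprime

/-- The prime ideals of norm coprime to `2 * q`. -/
def CoprimePrime (q : ℕ) : Type :=
  {P : Ideal (ZsqrtNeg q) // P.IsPrime ∧ HasCoprimeNorm P}

namespace CoprimePrime

variable {q : ℕ}

/-- The underlying ideal. -/
def ideal (P : CoprimePrime q) : Ideal (ZsqrtNeg q) := P.1

theorem ideal_injective : Function.Injective (ideal : CoprimePrime q → _) :=
  Subtype.val_injective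

theorem isPrime (P : CoprimePrime q) : P.ideal.IsPrime := P.2.1

theorem hasCoprimeNorm (P : CoprimePrime q) : HasCoprimeNorm P.ideal := P.2.2

/-- The norm of a prime ideal. -/
noncomputable def norm (P : CoprimePrime q) : ℕ := idealNorm P.ideal

theorem hasIdealNorm (P : CoprimePrime q) : HasIdealNorm P.ideal P.norm :=
  P.hasCoprimeNorm.hasIdealNorm

theorem two_le_norm (P : CoprimePrime q) : 2 ≤ P.norm := by
  have h1 := P.hasIdealNorm.1
  have h2 : P.norm ≠ 1 := fun h => P.isPrime.ne_top (P.hasIdealNorm.eq_one_iff.1 h)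
  omega

/-- The product of a multiset of prime ideals. -/
noncomputable def prod (m : Multiset (CoprimePrime q)) : Ideal (ZsqrtNeg q) :=
  (m.map ideal).prod

@[simp]
theorem prod_zero : prod (0 : Multiset (CoprimePrime q)) = ⊤ := by
  rw [prod, Multiset.map_zero, Multiset.prod_zero, Ideal.one_eq_top]

@[simp]
theorem prod_cons (P : CoprimePrime q) (m : Multiset (CoprimePrime q)) :
    prod (P ::ₘ m) = P.ideal * prod m := by
  rw [prod, Multiset.map_cons, Multiset.prod_cons, prod]

theorem hasCoprimeNorm_prod (m : Multiset (CoprimePrime q)) : HasCoprimeNorm (prod m) := by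
  induction m using Multiset.induction with
  | empty => simpa using hasCoprimeNorm_top
  | cons P m ih => simpa using P.hasCoprimeNorm.mul ih

theorem idealNorm_prod (m : Multiset (CoprimePrime q)) :
    idealNorm (prod m) = (m.map norm).prod := by
  induction m using Multiset.induction with
  | empty => simpa using (hasIdealNorm_top (q := q)).idealNorm_eq
  | cons P m ih =>
    rw [prod_cons, Multiset.map_cons, Multiset.prod_cons, ← ih]
    exact (P.hasIdealNorm.mul (hasCoprimeNorm_prod m).hasIdealNorm).idealNorm_eq

variable [Fact q.Prime]

theorem eq_of_ideal_le {P Q : CoprimePrime q} (h : P.ideal ≤ Q.ideal) : P = Q := by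
  obtain ⟨K, hK⟩ := Q.hasIdealNorm.dvdPrincipal.exists_mul_eq h
  rcases P.isPrime.mul_le.1 hK.le with h1 | h1
  · exact ideal_injective (le_antisymm h h1)
  · exfalso
    have h2 : P.ideal ≤ K := hK ▸ Ideal.mul_le_right
    obtain rfl : K = P.ideal := le_antisymm h1 h2
    refine Q.isPrime.ne_top (P.hasIdealNorm.dvdPrincipal.mul_left_cancel ?_)
    rw [mul_comm, hK, Ideal.mul_top]

theorem mem_of_prod_le {P : CoprimePrime q} {m : Multiset (CoprimePrime q)}
    (h : prod m ≤ P.ideal) : P ∈ m := by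
  induction m using Multiset.induction with
  | empty =>
    rw [prod_zero, top_le_iff] at h
    exact absurd h P.isPrime.ne_top
  | cons Q m ih =>
    rw [prod_cons] at h
    rcases P.isPrime.mul_le.1 h with h1 | h1
    · rw [eq_of_ideal_le h1]
      exact Multiset.mem_cons_self _ _
    · exact Multiset.mem_cons_of_mem (ih h1)

theorem prod_injective : Function.Injective (prod : Multiset (CoprimePrime q) → _) := by
  intro m
  induction m using Multiset.induction with
  | empty =>
    intro m' h
    by_contra hne
    obtain ⟨P, hP⟩ := Multiset.exists_mem_of_ne_zero (Ne.symm hne)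
    obtain ⟨m'', rfl⟩ := Multiset.exists_cons_of_mem hP
    rw [prod_zero, prod_cons] at h
    exact P.isPrime.ne_top (top_le_iff.1 (h.le.trans Ideal.mul_le_left))
  | cons P m ih =>
    intro m' h
    have hP : P ∈ m' := mem_of_prod_le (by
      rw [← h, prod_cons]
      exact Ideal.mul_le_left)
    obtain ⟨m'', rfl⟩ := Multiset.exists_cons_of_mem hP
    rw [prod_cons, prod_cons] at h
    rw [ih (P.hasIdealNorm.dvdPrincipal.mul_left_cancel h)]

theorem exists_prod_eq {I : Ideal (ZsqrtNeg q)} (hI : HasCoprimeNorm I) :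
    ∃ m : Multiset (CoprimePrime q), prod m = I := by
  obtain ⟨n, hn, hc⟩ := hI
  induction n using Nat.strong_induction_on generalizing I with
  | _ n ih =>
    by_cases hI : I = ⊤
    · exact ⟨0, by rw [prod_zero, hI]⟩
    · obtain ⟨P', hP', hIP⟩ := Ideal.exists_le_maximal I hI
      let P : CoprimePrime q := ⟨P', hP'.isPrime, HasCoprimeNorm.mono ⟨n, hn, hc⟩ hIP⟩
      obtain ⟨K, hK⟩ := P.hasIdealNorm.dvdPrincipal.exists_mul_eq hIP
      obtain ⟨k, hk, hkn⟩ := P.hasIdealNorm.of_mul_eq hn hK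
      have h2 := P.two_le_norm
      have h3 := hk.1
      obtain ⟨m, hm⟩ := ih k (by nlinarith) hk (hc.coprime_dvd_left (Dvd.intro_left _ hkn))
      exact ⟨P ::ₘ m, by rw [prod_cons, hm, hK]⟩

theorem finite_prod_norm_eq (n : ℕ) :
    {m : Multiset (CoprimePrime q) | (m.map norm).prod = n}.Finite := by
  refine Set.Finite.of_finite_image ((finite_setOf_hasIdealNorm (q := q) n).subset ?_)
    prod_injective.injOn
  rintro _ ⟨m, rfl, rfl⟩
  rw [Set.mem_ofPred_eq, ← idealNorm_prod]
  exact (hasCoprimeNorm_prod m).hasIdealNorm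

theorem norm_natCast {p : ℕ} (hp : p.Coprime (2 * q)) :
    HasIdealNorm (Ideal.span {(p : ZsqrtNeg q)}) (p ^ 2) := by
  have hp0 : (p : ZsqrtNeg q) ≠ 0 := by
    intro h
    have : p = 0 := by exact_mod_cast h
    rw [this, Nat.coprime_zero_left] at hp
    omega
  have := hasIdealNorm_span_singleton hp0
  rwa [ZsqrtNeg.norm_eq, Zsqrtd.re_natCast, Zsqrtd.im_natCast, zero_pow two_ne_zero, mul_zero,
    add_zero, Int.natAbs_pow, Int.natAbs_natCast] at this

theorem exists_prime_mem (P : CoprimePrime q) :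
    ∃ p : ℕ, p.Prime ∧ p.Coprime (2 * q) ∧ (p : ZsqrtNeg q) ∈ P.ideal ∧ P.norm ∣ p ^ 2 := by
  have h1 := P.hasIdealNorm.natCast_mem
  have h0 : P.norm ≠ 0 := P.hasIdealNorm.1.ne'
  have h2 : ((P.norm.primeFactorsList.map (Nat.cast : ℕ → ZsqrtNeg q) :
      Multiset (ZsqrtNeg q)).prod) ∈ P.ideal := by
    rwa [Multiset.prod_coe, ← Nat.cast_list_prod, Nat.prod_primeFactorsList h0]
  obtain ⟨x, hx, hxP⟩ := (P.isPrime.multiset_prod_mem_iff_exists_mem _).1 h2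
  obtain ⟨p, hp, rfl⟩ := List.mem_map.1 (Multiset.mem_coe.1 hx)
  have hpp := Nat.prime_of_mem_primeFactorsList hp
  have hpc := P.hasCoprimeNorm.coprime.coprime_dvd_left (Nat.dvd_of_mem_primeFactorsList hp)
  refine ⟨p, hpp, hpc, hxP, ?_⟩
  obtain ⟨K, hK⟩ := P.hasIdealNorm.dvdPrincipal.exists_mul_eq
    ((Ideal.span_singleton_le_iff_mem _).2 hxP)
  obtain ⟨k, -, hk⟩ := P.hasIdealNorm.of_mul_eq (norm_natCast hpc) hK
  exact Dvd.intro _ hk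

theorem prod_norm_dvd {p : ℕ} (hp : p.Coprime (2 * q)) (F : Finset (CoprimePrime q))
    (hF : ∀ P ∈ F, (p : ZsqrtNeg q) ∈ P.ideal) : ∏ P ∈ F, P.norm ∣ p ^ 2 := by
  have h1 := norm_natCast hp
  have h2 : HasCoprimeNorm (Ideal.span {(p : ZsqrtNeg q)}) := ⟨_, h1, hp.pow_left 2⟩
  obtain ⟨m, hm⟩ := exists_prod_eq h2
  have h3 : F.val ≤ m := by
    rw [Multiset.le_iff_subset F.nodup]
    intro P hP
    refine mem_of_prod_le ?_
    rw [hm, Ideal.span_singleton_le_iff_mem]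
    exact hF P hP
  rw [← h1.idealNorm_eq, ← hm, idealNorm_prod]
  exact Multiset.prod_dvd_prod_of_le (Multiset.map_le_map h3)

theorem finsum_log_norm_le (n : ℕ) :
    ∑ᶠ e ∈ {e : CoprimePrime q × ℕ | 0 < e.2 ∧ e.1.norm ^ e.2 = n}, Real.log e.1.norm ≤
      2 * ArithmeticFunction.vonMangoldt n := by
  classical
  set E := {e : CoprimePrime q × ℕ | 0 < e.2 ∧ e.1.norm ^ e.2 = n} with hE
  have hfin : E.Finite := finite_primePowers_of_norm finite_prod_norm_eq n
  rcases E.eq_empty_or_nonempty with h0 | ⟨e₀, he₀⟩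
  · rw [h0]
    simp [ArithmeticFunction.vonMangoldt_nonneg]
  obtain ⟨p, hp, hpc, -, hpd⟩ := e₀.1.exists_prime_mem
  obtain ⟨j, -, hj⟩ := (Nat.dvd_prime_pow hp).1 hpd
  have hn : n = p ^ (j * e₀.2) := by rw [← he₀.2, hj, pow_mul]
  have hj0 : j * e₀.2 ≠ 0 := by
    refine mul_ne_zero ?_ he₀.1.ne'
    rintro rfl
    have := e₀.1.two_le_norm
    rw [hj, pow_zero] at this
    omega
  have hΛ : ArithmeticFunction.vonMangoldt n = Real.log p := by
    rw [hn, ArithmeticFunction.vonMangoldt_apply_pow hj0,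
      ArithmeticFunction.vonMangoldt_apply_prime hp]
  have hmem : ∀ e ∈ E, (p : ZsqrtNeg q) ∈ e.1.ideal := by
    intro e he
    obtain ⟨p', hp', -, hp'm, hp'd⟩ := e.1.exists_prime_mem
    obtain ⟨i, -, hi⟩ := (Nat.dvd_prime_pow hp').1 hp'd
    have hi0 : i ≠ 0 := by
      rintro rfl
      have := e.1.two_le_norm
      rw [hi, pow_zero] at this
      omega
    have h1 : p' ∣ p ^ (j * e₀.2) := by
      rw [← hn, ← he.2, hi, ← pow_mul]
      exact dvd_pow_self _ (mul_ne_zero hi0 he.1.ne')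
    rwa [← (Nat.prime_dvd_prime_iff_eq hp' hp).1 (hp'.dvd_of_dvd_pow h1)]
  have hinj : Set.InjOn Prod.fst (hfin.toFinset : Set (CoprimePrime q × ℕ)) := by
    rintro ⟨P, k⟩ h1 ⟨P', k'⟩ h2 h
    obtain rfl : P = P' := h
    have h1' := ((Set.Finite.mem_toFinset hfin).1 h1).2
    have h2' := ((Set.Finite.mem_toFinset hfin).1 h2).2
    rw [← h2'] at h1'
    obtain rfl : k = k' := Nat.pow_right_injective P.two_le_norm h1'
    rfl
  have hd := prod_norm_dvd hpc (hfin.toFinset.image Prod.fst) (by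
    intro P hP
    obtain ⟨e, he, rfl⟩ := Finset.mem_image.1 hP
    exact hmem e ((Set.Finite.mem_toFinset hfin).1 he))
  have hle : ∏ P ∈ hfin.toFinset.image Prod.fst, P.norm ≤ p ^ 2 :=
    Nat.le_of_dvd (pow_pos hp.pos 2) hd
  rw [finsum_mem_eq_finite_toFinset_sum _ hfin, hΛ,
    ← Finset.sum_image (f := fun P : CoprimePrime q => Real.log P.norm) hinj,
    ← Real.log_prod (fun P _ => by exact_mod_cast P.hasIdealNorm.1.ne')]
  have hpos : 0 < ∏ P ∈ hfin.toFinset.image Prod.fst, P.norm :=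
    Finset.prod_pos fun P _ => P.hasIdealNorm.1
  calc Real.log (∏ P ∈ hfin.toFinset.image Prod.fst, (P.norm : ℝ))
      ≤ Real.log ((p : ℝ) ^ 2) := by
        refine Real.log_le_log (by exact_mod_cast hpos) ?_
        exact_mod_cast hle
    _ = 2 * Real.log p := by
        rw [Real.log_pow]
        norm_num

end CoprimePrime

/-- The group of pairs of an ideal class and a nonzero square modulo `q`. -/
abbrev LabelGroup (q : ℕ) [Fact q.Prime] : Type :=
  Additive (ClassGroup (ZsqrtNeg q) × (powMonoidHom 2 : (ZMod q)ˣ →* (ZMod q)ˣ).range)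

open scoped Classical in
/-- The class of an ideal together with its norm modulo `q`. -/
noncomputable def idealLabel {q : ℕ} [Fact q.Prime] (I : Ideal (ZsqrtNeg q)) : LabelGroup q :=
  Additive.ofMul (idealClass I,
    if h : ∃ u : (powMonoidHom 2 : (ZMod q)ˣ →* (ZMod q)ˣ).range,
      ((u : (ZMod q)ˣ) : ZMod q) = idealNorm I then h.choose else 1)

section idealLabel

variable {q : ℕ} [Fact q.Prime]

theorem HasCoprimeNorm.isUnit {I : Ideal (ZsqrtNeg q)} (hI : HasCoprimeNorm I) :
    IsUnit (idealNorm I : ZMod q) :=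
  (ZMod.isUnit_iff_coprime _ _).2 hI.coprime.coprime_mul_left_right

theorem HasCoprimeNorm.exists_square (hq : q % 4 = 3) {I : Ideal (ZsqrtNeg q)}
    (hI : HasCoprimeNorm I) : ∃ u : (ZMod q)ˣ, ((u ^ 2 : (ZMod q)ˣ) : ZMod q) = idealNorm I := by
  have : Finite (ClassGroup (ZsqrtNeg q)) := finite_classGroup (by omega)
  obtain ⟨k, hk⟩ := odd_card_classGroup hq
  set h := Nat.card (ClassGroup (ZsqrtNeg q)) with hh
  have hpow : ∀ j, HasIdealNorm (I ^ j) (idealNorm I ^ j) ∧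
      idealClass (I ^ j) = idealClass I ^ j := by
    intro j
    induction j with
    | zero =>
      rw [pow_zero, pow_zero, pow_zero, Ideal.one_eq_top]
      refine ⟨hasIdealNorm_top, ?_⟩
      rw [← Ideal.span_singleton_one]
      exact idealClass_span_singleton one_ne_zero
    | succ j ih =>
      rw [pow_succ, pow_succ, pow_succ]
      exact ⟨ih.1.mul hI.hasIdealNorm,
        by rw [idealClass_mul ih.1.dvdPrincipal hI.hasIdealNorm.dvdPrincipal, ih.2]⟩
  obtain ⟨α, hα, hIα⟩ := (idealClass_eq_one_iff (hpow h).1.dvdPrincipal).1 (by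
    rw [(hpow h).2, hh, pow_card_eq_one'])
  have h1 : idealNorm I ^ h = α.norm.natAbs := by
    refine (hpow h).1.unique ?_
    rw [hIα]
    exact hasIdealNorm_span_singleton hα
  obtain ⟨v, hv⟩ := hI.isUnit
  have h2 : (v : ZMod q) ^ h = ZsqrtNeg.modSelf q α ^ 2 := by
    rw [hv, ← Nat.cast_pow, h1, ZsqrtNeg.natAbs_norm_cast, ZsqrtNeg.norm_modSelf]
  have h3 : IsUnit (ZsqrtNeg.modSelf q α) := by
    refine (isUnit_pow_iff two_ne_zero).1 ?_
    rw [← h2]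
    exact v.isUnit.pow _
  obtain ⟨s, hs⟩ := h3
  refine ⟨s * (v ^ k)⁻¹, ?_⟩
  rw [← hv]
  congr 1
  have h4 : v ^ h = s ^ 2 := by
    ext
    push_cast
    rw [h2, hs]
  rw [mul_pow, ← h4, hk, inv_pow, ← pow_mul, mul_comm k 2, pow_succ, mul_right_comm, mul_inv_cancel,
    one_mul]

theorem idealLabel_fst (I : Ideal (ZsqrtNeg q)) : (idealLabel I).toMul.1 = idealClass I := rfl

theorem HasCoprimeNorm.idealLabel_snd (hq : q % 4 = 3) {I : Ideal (ZsqrtNeg q)}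
    (hI : HasCoprimeNorm I) :
    (((idealLabel I).toMul.2 : (ZMod q)ˣ) : ZMod q) = idealNorm I := by
  obtain ⟨u, hu⟩ := hI.exists_square hq
  have hex : ∃ u : (powMonoidHom 2 : (ZMod q)ˣ →* (ZMod q)ˣ).range,
      ((u : (ZMod q)ˣ) : ZMod q) = idealNorm I := ⟨⟨u ^ 2, u, rfl⟩, hu⟩
  simp only [idealLabel, toMul_ofMul]
  rw [dif_pos hex]
  exact hex.choose_spec

theorem HasCoprimeNorm.idealLabel_eq_iff (hq : q % 4 = 3) {I : Ideal (ZsqrtNeg q)}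
    (hI : HasCoprimeNorm I) (a : LabelGroup q) :
    idealLabel I = a ↔ idealClass I = a.toMul.1 ∧
      (idealNorm I : ZMod q) = ((a.toMul.2 : (ZMod q)ˣ) : ZMod q) := by
  rw [← hI.idealLabel_snd hq, ← idealLabel_fst, ← Additive.toMul.injective.eq_iff, Prod.ext_iff,
    Units.val_inj, Subtype.val_inj]

theorem idealLabel_mul (hq : q % 4 = 3) {I J : Ideal (ZsqrtNeg q)} (hI : HasCoprimeNorm I)
    (hJ : HasCoprimeNorm J) : idealLabel (I * J) = idealLabel I + idealLabel J := by
  rw [(hI.mul hJ).idealLabel_eq_iff hq, toMul_add, Prod.fst_mul, Prod.snd_mul, Subgroup.coe_mul,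
    Units.val_mul, hI.idealLabel_snd hq, hJ.idealLabel_snd hq, idealLabel_fst, idealLabel_fst,
    (hI.hasIdealNorm.mul hJ.hasIdealNorm).idealNorm_eq, Nat.cast_mul]
  exact ⟨idealClass_mul hI.hasIdealNorm.dvdPrincipal hJ.hasIdealNorm.dvdPrincipal, rfl⟩

theorem idealLabel_top (hq : q % 4 = 3) : idealLabel (⊤ : Ideal (ZsqrtNeg q)) = 0 := by
  have h := idealLabel_mul hq (hasCoprimeNorm_top (q := q)) hasCoprimeNorm_top
  rwa [Ideal.top_mul, left_eq_add] at h

namespace CoprimePrime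

/-- The label of a prime ideal. -/
noncomputable def label (P : CoprimePrime q) : LabelGroup q := idealLabel P.ideal

theorem idealLabel_prod (hq : q % 4 = 3) (m : Multiset (CoprimePrime q)) :
    idealLabel (prod m) = (m.map label).sum := by
  induction m using Multiset.induction with
  | empty => rw [prod_zero, idealLabel_top hq, Multiset.map_zero, Multiset.sum_zero]
  | cons P m ih =>
    rw [prod_cons, Multiset.map_cons, Multiset.sum_cons, ← ih]
    exact (idealLabel_mul hq P.hasCoprimeNorm (hasCoprimeNorm_prod m) :)

theorem ncard_prod_norm_le (hq : q % 4 = 3) (a : LabelGroup q) (x : ℕ) :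
    {m : Multiset (CoprimePrime q) | (m.map norm).prod ≤ x ∧ (m.map label).sum = a}.ncard =
      {I : Ideal (ZsqrtNeg q) | HasCoprimeNorm I ∧ idealNorm I ≤ x ∧ idealLabel I = a}.ncard := by
  rw [← Set.ncard_image_of_injective _ prod_injective]
  congr 1
  ext I
  constructor
  · rintro ⟨m, ⟨h1, h2⟩, rfl⟩
    exact ⟨hasCoprimeNorm_prod m, by rwa [idealNorm_prod], by rwa [idealLabel_prod hq]⟩
  · rintro ⟨h0, h1, h2⟩
    obtain ⟨m, rfl⟩ := exists_prod_eq h0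
    exact ⟨m, ⟨by rwa [← idealNorm_prod], by rwa [← idealLabel_prod hq]⟩, rfl⟩

end CoprimePrime

end idealLabel

theorem card_range_powMonoidHom_two {g : ℕ} [Fact (2 * g + 1).Prime] :
    Nat.card (powMonoidHom 2 : (ZMod (2 * g + 1))ˣ →* (ZMod (2 * g + 1))ˣ).range = g := by
  rw [IsCyclic.card_powMonoidHom_range, Nat.card_eq_fintype_card, ZMod.card_units,
    Nat.add_sub_cancel, Nat.gcd_mul_right_left, Nat.mul_div_cancel_left _ two_pos]

namespace CoprimePrime

theorem natCast_mem_iff_of_prime_norm {q : ℕ} {P : CoprimePrime q} (hP : P.norm.Prime) (n : ℕ) :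
    (n : ZsqrtNeg q) ∈ P.ideal ↔ P.norm ∣ n := by
  constructor
  · intro hn
    by_contra h
    obtain ⟨u, v, huv⟩ := Nat.isCoprime_iff_coprime.2 ((Nat.Prime.coprime_iff_not_dvd hP).2 h)
    refine P.isPrime.ne_top ((Ideal.eq_top_iff_one _).2 ?_)
    have := P.ideal.add_mem (P.ideal.mul_mem_left (u : ZsqrtNeg q) P.hasIdealNorm.natCast_mem)
      (P.ideal.mul_mem_left (v : ZsqrtNeg q) hn)
    convert this using 1
    exact_mod_cast congrArg (fun t : ℤ => (t : ZsqrtNeg q)) huv.symm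
  · rintro ⟨k, rfl⟩
    rw [Nat.cast_mul]
    exact P.ideal.mul_mem_right _ P.hasIdealNorm.natCast_mem

theorem finsum_primePowers_eq {q : ℕ} {M : Type*} [AddCommMonoid M] {p : ℕ} (hp : p.Prime)
    (f : CoprimePrime q × ℕ → M) :
    ∑ᶠ e ∈ {e : CoprimePrime q × ℕ | 0 < e.2 ∧ e.1.norm ^ e.2 = p}, f e =
      ∑ᶠ P ∈ {P : CoprimePrime q | P.norm = p}, f (P, 1) := by
  have h : {e : CoprimePrime q × ℕ | 0 < e.2 ∧ e.1.norm ^ e.2 = p} =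
      (fun P => (P, 1)) '' {P : CoprimePrime q | P.norm = p} := by
    ext ⟨P, k⟩
    constructor
    · rintro ⟨h1, h2⟩
      simp only at h1 h2
      have h3 : k = 1 := Nat.Prime.eq_one_of_pow (h2 ▸ hp)
      subst h3
      exact ⟨P, by simpa using h2, rfl⟩
    · rintro ⟨P', h1, h2⟩
      obtain ⟨rfl, rfl⟩ := Prod.mk.inj h2
      exact ⟨one_pos, by simpa using h1⟩
  rw [h, finsum_mem_image]
  intro P _ P' _ h
  exact (Prod.mk.inj h).1

variable {q : ℕ} [Fact q.Prime]

theorem exists_ideal_eq_of_prime_norm {I : Ideal (ZsqrtNeg q)} {p : ℕ} (hp : p.Prime)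
    (hI : HasIdealNorm I p) (hpc : p.Coprime (2 * q)) : ∃ P : CoprimePrime q, P.ideal = I := by
  obtain ⟨m, hm⟩ := exists_prod_eq ⟨p, hI, hpc⟩
  have h1 : (m.map norm).prod = p := by
    rw [← idealNorm_prod, hm, hI.idealNorm_eq]
  rcases Multiset.empty_or_exists_mem m with rfl | ⟨P, hP⟩
  · rw [Multiset.map_zero, Multiset.prod_zero] at h1
    exact absurd h1.symm hp.ne_one
  · obtain ⟨m', rfl⟩ := Multiset.exists_cons_of_mem hP
    rw [Multiset.map_cons, Multiset.prod_cons] at h1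
    have h2 : P.norm = p := by
      rcases (Nat.dvd_prime hp).1 (Dvd.intro _ h1) with h | h
      · have := P.two_le_norm
        omega
      · exact h
    refine ⟨P, ?_⟩
    have h3 : (m'.map norm).prod = 1 := by
      rw [h2] at h1
      exact Nat.eq_of_mul_eq_mul_left hp.pos (by rw [h1, mul_one])
    rw [← idealNorm_prod] at h3
    have h4 := ((hasCoprimeNorm_prod m').hasIdealNorm.eq_one_iff).1 h3
    rw [← hm, prod_cons, h4, Ideal.mul_top]

theorem setOf_norm_eq_prime {p : ℕ} (hp : p.Prime) (hpq : p.Coprime (2 * q)) {x y : ℤ}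
    (hxy : (p : ℤ) = x ^ 2 + q * y ^ 2) :
    ∃ P P' : CoprimePrime q, P ≠ P' ∧ idealClass P.ideal = 1 ∧ idealClass P'.ideal = 1 ∧
      {P : CoprimePrime q | P.norm = p} = {P, P'} := by
  set α : ZsqrtNeg q := ⟨x, y⟩ with hα
  have hN : α.norm = p := by rw [ZsqrtNeg.norm_eq, hxy]
  have hα0 : α ≠ 0 := by
    intro h
    rw [h, Zsqrtd.norm_zero] at hN
    exact hp.ne_zero (by exact_mod_cast hN.symm)
  have hI := hasIdealNorm_span_singleton hα0
  rw [hN, Int.natAbs_natCast] at hI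
  obtain ⟨P, hP⟩ := exists_ideal_eq_of_prime_norm hp hI hpq
  obtain ⟨P', hP'⟩ := exists_ideal_eq_of_prime_norm hp hI.conj hpq
  have hPn : P.norm = p := (hP ▸ P.hasIdealNorm).unique hI
  have hPn' : P'.norm = p := (hP' ▸ P'.hasIdealNorm).unique hI.conj
  have hc : idealClass P.ideal = 1 := by
    rw [hP]
    exact idealClass_span_singleton hα0
  refine ⟨P, P', ?_, hc, ?_, ?_⟩
  · rintro rfl
    have h1 : α ∈ P.ideal := by
      rw [hP]
      exact Ideal.mem_span_singleton_self _
    have h2 : star α ∈ P.ideal := by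
      rw [hP', mem_conjIdeal, star_star, ← hP]
      exact h1
    have h3 : (((2 * x).natAbs : ℕ) : ZsqrtNeg q) ∈ P.ideal := by
      have h4 : ((2 * x : ℤ) : ZsqrtNeg q) ∈ P.ideal := by
        convert P.ideal.add_mem h1 h2 using 1
        ext
        · simp [hα, -Int.cast_mul]
          ring
        · simp [hα, -Int.cast_mul]
      rcases Int.natAbs_eq (2 * x) with h | h
      · rw [h, Int.cast_natCast] at h4
        exact h4
      · rw [h, Int.cast_neg, Int.cast_natCast, Ideal.neg_mem_iff] at h4
        exact h4
    rw [natCast_mem_iff_of_prime_norm (by rwa [hPn]), hPn, Int.natAbs_mul, hp.dvd_mul] at h3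
    have h5 : p ∣ x.natAbs := by
      refine h3.resolve_left fun h => ?_
      have h6 := (Nat.prime_dvd_prime_iff_eq hp Nat.prime_two).1 h
      rw [h6] at hpq
      exact absurd hpq.coprime_mul_right_right (by decide)
    have hx0 : x = 0 := by
      by_contra hx
      have h7 := Nat.le_of_dvd (Int.natAbs_pos.2 hx) h5
      have h8 : x ^ 2 ≤ p := by
        rw [hxy]
        nlinarith [sq_nonneg y, (Nat.cast_nonneg q : (0 : ℤ) ≤ q)]
      rw [← Int.natAbs_sq] at h8
      have h9 : x.natAbs ^ 2 ≤ p := by exact_mod_cast h8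
      have := hp.two_le
      nlinarith
    rw [hx0, zero_pow two_ne_zero, zero_add] at hxy
    have h10 : q ∣ p := by
      rw [← Int.natCast_dvd_natCast]
      exact ⟨_, hxy⟩
    have h11 := (Fact.out : q.Prime).coprime_iff_not_dvd.1 hpq.coprime_mul_left_right.symm
    exact h11 h10
  · rw [hP', idealClass_conjIdeal hI, ← hP, hc, inv_one]
  · ext Q
    constructor
    · intro hQ
      have h1 : P.ideal * P'.ideal ≤ Q.ideal := by
        rw [hP, hP', hI.2, Ideal.span_singleton_le_iff_mem, ← (hQ : Q.norm = p)]
        exact Q.hasIdealNorm.natCast_mem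
      rcases Q.isPrime.mul_le.1 h1 with h | h
      · exact Or.inl (eq_of_ideal_le h).symm
      · exact Or.inr (eq_of_ideal_le h).symm
    · rintro (rfl | rfl)
      · exact hPn
      · exact hPn'

open scoped Classical in
theorem finsum_ite_label (hq : q % 4 = 3) {p : ℕ} (hp : p.Prime) (T : Finset (LabelGroup q))
    (hT : ∀ a, a ∈ T ↔ a.toMul.1 = 1 ∧ a.toMul.2 ≠ 1) :
    (∑ᶠ e ∈ {e : CoprimePrime q × ℕ | 0 < e.2 ∧ e.1.norm ^ e.2 = p},
      if e.2 • e.1.label ∈ T then Real.log e.1.norm else 0) =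
    if (∃ x y : ℤ, (p : ℤ) = x ^ 2 + q * y ^ 2) ∧ p ≠ q ∧ p % q ≠ 1 then 2 * Real.log p
      else 0 := by
  have hmod : (p : ZMod q) = 1 ↔ p % q = 1 := by
    have h := ZMod.natCast_eq_natCast_iff' p 1 q
    rwa [Nat.cast_one, Nat.mod_eq_of_lt (Fact.out : q.Prime).one_lt] at h
  have hlab : ∀ P : CoprimePrime q, P.norm = p →
      (P.label ∈ T ↔ idealClass P.ideal = 1 ∧ p % q ≠ 1) := by
    intro P hP
    have h1 := P.hasCoprimeNorm.idealLabel_snd hq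
    rw [show idealNorm P.ideal = p from hP] at h1
    rw [hT, label, idealLabel_fst, ne_eq, ne_eq, ← hmod, ← h1]
    refine and_congr_right fun _ => not_congr ?_
    rw [Units.val_eq_one, OneMemClass.coe_eq_one]
  rw [finsum_primePowers_eq hp]
  simp only [one_smul]
  split_ifs with h
  · obtain ⟨⟨x, y, hxy⟩, hpq, hp1⟩ := h
    have hpc : p.Coprime (2 * q) := by
      refine Nat.Coprime.mul_right ((Nat.coprime_primes hp Nat.prime_two).2 ?_)
        ((Nat.coprime_primes hp Fact.out).2 hpq)
      rintro rfl
      have hq2 : (3 : ℤ) ≤ q := by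
        have : 3 ≤ q := by omega
        exact_mod_cast this
      have hy : y = 0 := by
        by_contra hy
        have : 0 < y ^ 2 := by positivity
        push_cast at hxy
        nlinarith [sq_nonneg x]
      subst hy
      push_cast at hxy
      have h1 : x < 2 := by nlinarith
      have h2 : -2 < x := by nlinarith
      interval_cases x <;> omega
    obtain ⟨P, P', hne, h1, h2, hset⟩ := setOf_norm_eq_prime hp hpc hxy
    have hP : P.norm = p := by
      have : P ∈ {P : CoprimePrime q | P.norm = p} := by simp [hset]
      exact this
    have hP' : P'.norm = p := by
      have : P' ∈ {P : CoprimePrime q | P.norm = p} := by simp [hset]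
      exact this
    rw [hset, finsum_mem_pair hne, if_pos ((hlab P hP).2 ⟨h1, hp1⟩),
      if_pos ((hlab P' hP').2 ⟨h2, hp1⟩), hP, hP', two_mul]
  · refine finsum_mem_eq_zero_of_forall_eq_zero fun P hP => if_neg fun hPT => h ?_
    have hP' : P.norm = p := hP
    obtain ⟨h1, h2⟩ := (hlab P hP).1 hPT
    obtain ⟨α, hα, hPα⟩ := (idealClass_eq_one_iff P.hasIdealNorm.dvdPrincipal).1 h1
    refine ⟨⟨α.re, α.im, ?_⟩, ?_, h2⟩
    · rw [← ZsqrtNeg.norm_eq, ← hP',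
        P.hasIdealNorm.unique (hPα ▸ hasIdealNorm_span_singleton hα),
        Int.natAbs_of_nonneg (Zsqrtd.norm_nonneg (by omega) _)]
    · rintro rfl
      have h3 := P.hasCoprimeNorm.coprime.coprime_mul_left_right
      rw [show idealNorm P.ideal = p from hP, Nat.coprime_self] at h3
      exact hp.ne_one h3

end CoprimePrime

theorem abs_ncard_modEq_sq_le_sub_le {M : ℕ} (hM : 0 < M) (t : ℤ) {R : ℝ} (hR : 0 ≤ R) :
    {u : ℤ | u ≡ t [ZMOD M] ∧ (u : ℝ) ^ 2 ≤ R}.Finite ∧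
    |({u : ℤ | u ≡ t [ZMOD M] ∧ (u : ℝ) ^ 2 ≤ R}.ncard : ℝ) - 2 / M * √R| ≤ 1 := by
  have hM' : (0 : ℝ) < M := by exact_mod_cast hM
  set A : ℝ := (√R - t) / M with hA
  set B : ℝ := (-√R - t) / M with hB
  have hset : {u : ℤ | u ≡ t [ZMOD M] ∧ (u : ℝ) ^ 2 ≤ R} =
      (fun k : ℤ => t + M * k) '' (Finset.Icc ⌈B⌉ ⌊A⌋ : Finset ℤ) := by
    ext u
    rw [Set.mem_ofPred_eq, ← Real.sqrt_le_sqrt_iff hR, Real.sqrt_sq_eq_abs, abs_le]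
    simp only [Set.mem_image, Finset.coe_Icc, Set.mem_Icc, Int.ceil_le, Int.le_floor]
    rw [hA, hB]
    constructor
    · rintro ⟨h1, h2, h3⟩
      obtain ⟨k, hk⟩ := h1.symm.dvd
      obtain rfl : u = t + M * k := by linarith
      refine ⟨k, ⟨?_, ?_⟩, rfl⟩
      · rw [div_le_iff₀ hM']
        push_cast at h2
        linarith
      · rw [le_div_iff₀ hM']
        push_cast at h3
        linarith
    · rintro ⟨k, ⟨h1, h2⟩, rfl⟩
      rw [div_le_iff₀ hM'] at h1
      rw [le_div_iff₀ hM'] at h2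
      refine ⟨?_, ?_, ?_⟩
      · exact Int.add_modEq_left_iff.2 (dvd_mul_right _ _)
      · push_cast
        linarith
      · push_cast
        linarith
  have hAB : A - B = 2 / M * √R := by
    rw [hA, hB]
    field_simp
    ring
  have hAB0 : 0 ≤ A - B := by
    rw [hAB]
    positivity
  have hinj : Function.Injective (fun k : ℤ => t + M * k) := by
    intro k l h
    have h' : (M : ℤ) * k = M * l := by simpa using h
    exact mul_left_cancel₀ (by exact_mod_cast hM.ne') h'
  rw [hset]
  refine ⟨(Finset.finite_toSet _).image _, ?_⟩
  rw [Set.ncard_image_of_injective _ hinj, Set.ncard_coe_finset, Int.card_Icc, ← hAB]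
  have h1 := Int.floor_le A
  have h2 := Int.lt_floor_add_one A
  have h3 := Int.le_ceil B
  have h4 := Int.ceil_lt_add_one B
  have h5 : 0 ≤ ⌊A⌋ + 1 - ⌈B⌉ := by
    have : (-1 : ℝ) < ((⌊A⌋ + 1 - ⌈B⌉ : ℤ) : ℝ) := by
      push_cast
      linarith
    have : (-1 : ℤ) < ⌊A⌋ + 1 - ⌈B⌉ := by exact_mod_cast this
    omega
  have h6 : (((⌊A⌋ + 1 - ⌈B⌉).toNat : ℕ) : ℝ) = ⌊A⌋ + 1 - ⌈B⌉ := by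
    have : (((⌊A⌋ + 1 - ⌈B⌉).toNat : ℤ) : ℝ) = ((⌊A⌋ + 1 - ⌈B⌉ : ℤ) : ℝ) := by
      rw [Int.toNat_of_nonneg h5]
    push_cast at this
    exact_mod_cast this
  rw [h6, abs_le]
  constructor <;> linarith

theorem antitoneOn_sqrt_sub_sq (Z : ℝ) :
    AntitoneOn (fun y : ℝ => √(Z ^ 2 - y ^ 2)) (Set.Ici 0) := by
  intro x hx y hy hxy
  refine Real.sqrt_le_sqrt ?_
  have := pow_le_pow_left₀ hx hxy 2
  linarith

theorem integral_sqrt_sub_sq {Z : ℝ} (hZ : 0 < Z) {b : ℝ} (hb : Z ≤ b) :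
    ∫ y in (0 : ℝ)..b, √(Z ^ 2 - y ^ 2) = Z ^ 2 * ∫ u in (0 : ℝ)..1, √(1 - u ^ 2) := by
  have hint : ∀ a b : ℝ, IntervalIntegrable (fun y : ℝ => √(Z ^ 2 - y ^ 2))
      MeasureTheory.volume a b := fun a b => Continuous.intervalIntegrable (by fun_prop) a b
  rw [← intervalIntegral.integral_add_adjacent_intervals (hint 0 Z) (hint Z b)]
  have h1 : ∫ y in Z..b, √(Z ^ 2 - y ^ 2) = ∫ y in Z..b, (0 : ℝ) := by
    refine intervalIntegral.integral_congr fun y hy => ?_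
    rw [Set.uIcc_of_le hb] at hy
    exact Real.sqrt_eq_zero_of_nonpos (by nlinarith [hy.1])
  have h2 := intervalIntegral.mul_integral_comp_mul_left (a := 0) (b := 1)
    (f := fun y : ℝ => √(Z ^ 2 - y ^ 2)) Z
  rw [mul_zero, mul_one] at h2
  rw [h1, intervalIntegral.integral_zero, add_zero, ← h2, sq, mul_assoc]
  congr 1
  rw [← intervalIntegral.integral_const_mul]
  refine intervalIntegral.integral_congr fun u _ => ?_
  rw [show Z * Z - (Z * u) ^ 2 = Z ^ 2 * (1 - u ^ 2) by ring, Real.sqrt_mul (sq_nonneg Z),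
    Real.sqrt_sq hZ.le]

theorem abs_sum_sqrt_sub_sq_sub_le {Z : ℝ} (hZ : 0 < Z) :
    |∑ y ∈ Finset.Icc (-(⌊Z⌋₊ : ℤ)) ⌊Z⌋₊, √(Z ^ 2 - (y : ℝ) ^ 2) -
      2 * (∫ u in (0 : ℝ)..1, √(1 - u ^ 2)) * Z ^ 2| ≤ Z := by
  set N := ⌊Z⌋₊ with hN
  have hZN : Z ≤ N + 1 := (Nat.lt_floor_add_one Z).le
  have hanti := antitoneOn_sqrt_sub_sq Z
  have hI := integral_sqrt_sub_sq hZ hZN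
  set c := ∫ u in (0 : ℝ)..1, √(1 - u ^ 2) with hc
  have hsum : ∀ n : ℕ, ∑ y ∈ Finset.Icc (-(n : ℤ)) n, √(Z ^ 2 - (y : ℝ) ^ 2) =
      Z + 2 * ∑ i ∈ Finset.range n, √(Z ^ 2 - ((i : ℝ) + 1) ^ 2) := by
    intro n
    induction n with
    | zero => simp [hZ.le]
    | succ n ih =>
      have h1 : Finset.Icc (-((n + 1 : ℕ) : ℤ)) (n + 1 : ℕ) =
          insert (-((n : ℤ) + 1)) (insert ((n : ℤ) + 1) (Finset.Icc (-(n : ℤ)) n)) := by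
        ext y
        simp only [Finset.mem_Icc, Finset.mem_insert]
        omega
      rw [h1, Finset.sum_insert, Finset.sum_insert, ih, Finset.sum_range_succ]
      · push_cast
        rw [neg_sq]
        ring
      · simp
      · simp
        omega
  have h1 := (hanti.mono (Set.Icc_subset_Ici_self : Set.Icc (0 : ℝ) (0 + (N + 1 : ℕ)) ⊆ _)).sum_le_integral
  have h2 := (hanti.mono (Set.Icc_subset_Ici_self : Set.Icc (0 : ℝ) (0 + (N + 1 : ℕ)) ⊆ _)).integral_le_sum
  have h0 : √(Z ^ 2 - ((N : ℝ) + 1) ^ 2) = 0 := by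
    refine Real.sqrt_eq_zero_of_nonpos ?_
    have := pow_le_pow_left₀ hZ.le hZN 2
    linarith
  simp only [zero_add] at h1 h2
  push_cast at h1 h2
  rw [hI, Finset.sum_range_succ, h0, add_zero] at h1
  rw [hI, Finset.sum_range_succ'] at h2
  push_cast at h2
  rw [zero_pow two_ne_zero, sub_zero, Real.sqrt_sq hZ.le] at h2
  rw [hsum, abs_le]
  constructor <;> linarith

theorem ncard_eq_sum_ncard_fiber {S : Set (ℤ × ℤ)} {F : Finset ℤ} (hF : ∀ e ∈ S, e.2 ∈ F)
    (hfin : ∀ y, {u | (u, y) ∈ S}.Finite) :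
    S.Finite ∧ S.ncard = ∑ y ∈ F, {u | (u, y) ∈ S}.ncard := by
  classical
  have hS : S = ((F.biUnion fun y => (hfin y).toFinset.image fun u => (u, y) :
      Finset (ℤ × ℤ)) : Set (ℤ × ℤ)) := by
    ext ⟨u, y⟩
    simp only [Finset.coe_biUnion, Finset.coe_image, Set.Finite.coe_toFinset, Set.mem_iUnion,
      Set.mem_image, Set.mem_ofPred_eq, Finset.mem_coe]
    constructor
    · exact fun h => ⟨y, hF _ h, u, h, rfl⟩
    · rintro ⟨y', -, u', h, he⟩
      rwa [← he]
  refine ⟨by rw [hS]; exact Finset.finite_toSet _, ?_⟩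
  conv_lhs => rw [hS, Set.ncard_coe_finset]
  rw [Finset.card_biUnion]
  · refine Finset.sum_congr rfl fun y _ => ?_
    rw [Finset.card_image_of_injective _ fun u v h => (Prod.mk.inj h).1,
      Set.ncard_eq_toFinset_card _ (hfin y)]
  · intro y _ y' _ hne
    rw [Function.onFun, Finset.disjoint_left]
    intro e he he'
    obtain ⟨u, -, rfl⟩ := Finset.mem_image.1 he
    obtain ⟨u', -, he''⟩ := Finset.mem_image.1 he'
    exact hne (Prod.mk.inj he'').2.symm

theorem abs_ncard_modEq_or_modEq_sub_le {M : ℕ} (hM : 0 < M) {s t : ℤ} (hst : ¬ s ≡ t [ZMOD M])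
    {R : ℝ} (hR : 0 ≤ R) :
    {u : ℤ | (u ≡ s [ZMOD M] ∨ u ≡ t [ZMOD M]) ∧ (u : ℝ) ^ 2 ≤ R}.Finite ∧
    |({u : ℤ | (u ≡ s [ZMOD M] ∨ u ≡ t [ZMOD M]) ∧ (u : ℝ) ^ 2 ≤ R}.ncard : ℝ) - 4 / M * √R|
      ≤ 2 := by
  obtain ⟨hf1, h1⟩ := abs_ncard_modEq_sq_le_sub_le hM s hR
  obtain ⟨hf2, h2⟩ := abs_ncard_modEq_sq_le_sub_le hM t hR
  have hset : {u : ℤ | (u ≡ s [ZMOD M] ∨ u ≡ t [ZMOD M]) ∧ (u : ℝ) ^ 2 ≤ R} =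
      {u : ℤ | u ≡ s [ZMOD M] ∧ (u : ℝ) ^ 2 ≤ R} ∪ {u : ℤ | u ≡ t [ZMOD M] ∧ (u : ℝ) ^ 2 ≤ R} := by
    ext u
    exact or_and_right
  rw [hset]
  refine ⟨hf1.union hf2, ?_⟩
  rw [Set.ncard_union_eq ?_ hf1 hf2]
  · rw [abs_le] at h1 h2 ⊢
    push_cast
    have : 4 / (M : ℝ) * √R = 2 / M * √R + 2 / M * √R := by ring
    constructor <;> linarith
  · rw [Set.disjoint_left]
    exact fun u hu hu' => hst (hu.1.symm.trans hu'.1)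

theorem exists_abs_ncard_lattice_sub_le {M q : ℕ} (hM : 0 < M) (hq : 0 < q) {s t : ℤ → ℤ}
    (hst : ∀ y, ¬ s y ≡ t y [ZMOD M]) :
    ∃ K, ∀ R : ℝ, 0 < R →
      {e : ℤ × ℤ | (e.1 ≡ s e.2 [ZMOD M] ∨ e.1 ≡ t e.2 [ZMOD M]) ∧
        (e.1 : ℝ) ^ 2 + q * (e.2 : ℝ) ^ 2 ≤ R}.Finite ∧
      |({e : ℤ × ℤ | (e.1 ≡ s e.2 [ZMOD M] ∨ e.1 ≡ t e.2 [ZMOD M]) ∧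
        (e.1 : ℝ) ^ 2 + q * (e.2 : ℝ) ^ 2 ≤ R}.ncard : ℝ) -
        8 * (∫ u in (0 : ℝ)..1, √(1 - u ^ 2)) / (M * √q) * R| ≤ K * √R + 2 := by
  have hq' : (0 : ℝ) < q := by exact_mod_cast hq
  have hM' : (0 : ℝ) < M := by exact_mod_cast hM
  set c := ∫ u in (0 : ℝ)..1, √(1 - u ^ 2) with hc
  refine ⟨4 / M + 4 / √q, fun R hR => ?_⟩
  set Z := √(R / q) with hZdef
  have hZ : 0 < Z := Real.sqrt_pos.2 (div_pos hR hq')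
  have hZ2 : Z ^ 2 = R / q := Real.sq_sqrt (div_pos hR hq').le
  set S := {e : ℤ × ℤ | (e.1 ≡ s e.2 [ZMOD M] ∨ e.1 ≡ t e.2 [ZMOD M]) ∧
    (e.1 : ℝ) ^ 2 + q * (e.2 : ℝ) ^ 2 ≤ R} with hS
  set F := Finset.Icc (-(⌊Z⌋₊ : ℤ)) ⌊Z⌋₊ with hF
  have hmemF : ∀ y : ℤ, y ∈ F ↔ q * (y : ℝ) ^ 2 ≤ R := by
    intro y
    have h1 : q * (y : ℝ) ^ 2 ≤ R ↔ |(y : ℝ)| ≤ Z := by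
      rw [← abs_of_pos hZ, ← sq_le_sq, hZ2, le_div_iff₀ hq', mul_comm]
    rw [h1, hF, Finset.mem_Icc, ← abs_le, ← Int.natCast_natAbs, Nat.cast_le, Nat.le_floor_iff hZ.le,
      Nat.cast_natAbs, Int.cast_abs]
  have hfib : ∀ y, {u | (u, y) ∈ S} = {u : ℤ | (u ≡ s y [ZMOD M] ∨ u ≡ t y [ZMOD M]) ∧
      (u : ℝ) ^ 2 ≤ R - q * (y : ℝ) ^ 2} := by
    intro y
    ext u
    simp only [hS, Set.mem_ofPred_eq, le_sub_iff_add_le]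
  have hcount : ∀ y ∈ F, |({u | (u, y) ∈ S}.ncard : ℝ) - 4 / M * √(R - q * (y : ℝ) ^ 2)| ≤ 2 := by
    intro y hy
    rw [hfib]
    exact (abs_ncard_modEq_or_modEq_sub_le hM (hst y) (sub_nonneg.2 ((hmemF y).1 hy))).2
  have hSF : ∀ e ∈ S, e.2 ∈ F := by
    intro e he
    rw [hmemF]
    nlinarith [he.2, sq_nonneg (e.1 : ℝ)]
  obtain ⟨hSfin, hScard⟩ := ncard_eq_sum_ncard_fiber (S := S) hSF (by
    intro y
    by_cases hy : y ∈ F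
    · rw [hfib]
      exact (abs_ncard_modEq_or_modEq_sub_le hM (hst y) (sub_nonneg.2 ((hmemF y).1 hy))).1
    · convert Set.finite_empty
      exact Set.eq_empty_of_forall_notMem fun u hu => hy (hSF _ hu))
  refine ⟨hSfin, ?_⟩
  have hcardF : (F.card : ℝ) ≤ 2 * Z + 1 := by
    rw [hF, Int.card_Icc]
    have h1 : ((⌊Z⌋₊ : ℤ) + 1 - -(⌊Z⌋₊ : ℤ)).toNat = 2 * ⌊Z⌋₊ + 1 := by omega
    rw [h1]
    push_cast
    linarith [Nat.floor_le hZ.le]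
  have hsq : ∀ y : ℤ, √(R - q * (y : ℝ) ^ 2) = √q * √(Z ^ 2 - (y : ℝ) ^ 2) := by
    intro y
    rw [← Real.sqrt_mul hq'.le, hZ2]
    congr 1
    field_simp
  have h1 : |(S.ncard : ℝ) - 4 / M * √q * ∑ y ∈ F, √(Z ^ 2 - (y : ℝ) ^ 2)| ≤ 2 * (2 * Z + 1) := by
    rw [hScard, Finset.mul_sum]
    push_cast
    rw [← Finset.sum_sub_distrib]
    refine (Finset.abs_sum_le_sum_abs _ _).trans ?_
    calc ∑ y ∈ F, |({u | (u, y) ∈ S}.ncard : ℝ) - 4 / M * √q * √(Z ^ 2 - (y : ℝ) ^ 2)|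
        ≤ ∑ y ∈ F, (2 : ℝ) := by
          refine Finset.sum_le_sum fun y hy => ?_
          rw [mul_assoc, ← hsq]
          exact hcount y hy
      _ = 2 * F.card := by
          rw [Finset.sum_const, nsmul_eq_mul, mul_comm]
      _ ≤ 2 * (2 * Z + 1) := by linarith
  have h2 := abs_sum_sqrt_sub_sq_sub_le hZ
  rw [← hF, ← hc] at h2
  have h3 : |4 / M * √q * ∑ y ∈ F, √(Z ^ 2 - (y : ℝ) ^ 2) - 8 * c / (M * √q) * R| ≤
      4 / M * √q * Z := by
    have h4 : 8 * c / (M * √q) * R = 4 / M * √q * (2 * c * Z ^ 2) := by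
      rw [hZ2]
      have h5 : √(q : ℝ) ≠ 0 := (Real.sqrt_pos.2 hq').ne'
      have h6 : (q : ℝ) = √q ^ 2 := (Real.sq_sqrt hq'.le).symm
      have h7 : R / (q : ℝ) = R / √q ^ 2 := by rw [← h6]
      rw [h7]
      field_simp
      ring
    rw [h4, ← mul_sub, abs_mul, abs_of_nonneg (by positivity : (0 : ℝ) ≤ 4 / M * √q)]
    exact mul_le_mul_of_nonneg_left h2 (by positivity)
  have h8 : Z = √R / √q := by rw [hZdef, Real.sqrt_div hR.le]
  have h9 : 4 / M * √q * Z = 4 / M * √R := by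
    have h5 : √(q : ℝ) ≠ 0 := (Real.sqrt_pos.2 hq').ne'
    rw [h8]
    field_simp
  calc |(S.ncard : ℝ) - 8 * c / (M * √q) * R|
      ≤ |(S.ncard : ℝ) - 4 / M * √q * ∑ y ∈ F, √(Z ^ 2 - (y : ℝ) ^ 2)| +
        |4 / M * √q * ∑ y ∈ F, √(Z ^ 2 - (y : ℝ) ^ 2) - 8 * c / (M * √q) * R| :=
        abs_sub_le _ _ _
    _ ≤ 2 * (2 * Z + 1) + 4 / M * √R := by
        rw [← h9]
        exact add_le_add h1 h3
    _ = (4 / M + 4 / √q) * √R + 2 := by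
        rw [h8]
        ring

theorem Int.exists_forall_modEq_mul_iff {m n : ℤ} (h : IsCoprime m n) (a b : ℤ) :
    ∃ c, ∀ u, u ≡ c [ZMOD m * n] ↔ u ≡ a [ZMOD m] ∧ u ≡ b [ZMOD n] := by
  obtain ⟨x, y, hxy⟩ := id h
  have h1 : a * (y * n) + b * (x * m) ≡ a [ZMOD m] :=
    (Int.modEq_iff_dvd.2 ⟨x * (b - a), by linear_combination a * hxy⟩).symm
  have h2 : a * (y * n) + b * (x * m) ≡ b [ZMOD n] :=
    (Int.modEq_iff_dvd.2 ⟨y * (a - b), by linear_combination b * hxy⟩).symm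
  refine ⟨a * (y * n) + b * (x * m), fun u => ⟨fun hu => ?_, fun ⟨hu1, hu2⟩ => ?_⟩⟩
  · exact ⟨(hu.of_mul_right n).trans h1, (hu.of_mul_left m).trans h2⟩
  · exact Int.modEq_iff_dvd.2 (h.mul_dvd (Int.modEq_iff_dvd.1 (hu1.trans h1.symm))
      (Int.modEq_iff_dvd.1 (hu2.trans h2.symm)))

theorem ZsqrtNeg.eq_one_or_neg_one_of_isUnit {q : ℕ} [Fact q.Prime] {z : ZsqrtNeg q}
    (hz : IsUnit z) : z = 1 ∨ z = -1 := by
  have h := Zsqrtd.norm_eq_one_iff.2 hz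
  have hq := (Fact.out : q.Prime).two_le
  have h0 := Zsqrtd.norm_nonneg (by omega : -(q : ℤ) ≤ 0) z
  have h1 : z.re ^ 2 + q * z.im ^ 2 = 1 := by
    rw [← ZsqrtNeg.norm_eq]
    omega
  have him : z.im = 0 := by
    by_contra hne
    have : 0 < z.im ^ 2 := by positivity
    have hq' : (2 : ℤ) ≤ q := by exact_mod_cast hq
    nlinarith [sq_nonneg z.re]
  have hre : z.re ^ 2 = 1 := by simpa [him] using h1
  rcases mul_self_eq_one_iff.1 ((sq _).symm.trans hre) with h | h
  · left
    ext <;> simp [h, him]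
  · right
    ext <;> simp [h, him]

section count

variable {q : ℕ} [Fact q.Prime]

theorem ncard_mem_norm_le_eq_two_mul (hq : q % 4 = 3) (a : LabelGroup q) (x : ℕ)
    {B : Ideal (ZsqrtNeg q)} (hB : HasCoprimeNorm B) (hBa : idealClass B = a.toMul.1⁻¹)
    (hfin : {z : ZsqrtNeg q | z ∈ B ∧ z.norm ≤ idealNorm B * x ∧ (z.norm : ZMod 2) ≠ 0 ∧
      (z.norm : ZMod q) = ((a.toMul.2 : (ZMod q)ˣ) : ZMod q) * idealNorm B}.Finite) :
    {z : ZsqrtNeg q | z ∈ B ∧ z.norm ≤ idealNorm B * x ∧ (z.norm : ZMod 2) ≠ 0 ∧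
      (z.norm : ZMod q) = ((a.toMul.2 : (ZMod q)ˣ) : ZMod q) * idealNorm B}.ncard =
      2 * {I : Ideal (ZsqrtNeg q) | HasCoprimeNorm I ∧ idealNorm I ≤ x ∧ idealLabel I = a}.ncard := by
  set S := {z : ZsqrtNeg q | z ∈ B ∧ z.norm ≤ idealNorm B * x ∧ (z.norm : ZMod 2) ≠ 0 ∧
      (z.norm : ZMod q) = ((a.toMul.2 : (ZMod q)ˣ) : ZMod q) * idealNorm B} with hS
  set T := {I : Ideal (ZsqrtNeg q) | HasCoprimeNorm I ∧ idealNorm I ≤ x ∧ idealLabel I = a} with hT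
  have hn0 := hB.hasIdealNorm.1
  have hgen : ∀ I, ∃ z : ZsqrtNeg q, I ∈ T → z ≠ 0 ∧ B * I = Ideal.span {z} := by
    intro I
    by_cases hI : I ∈ T
    · obtain ⟨z, hz⟩ := (idealClass_eq_one_iff
        (hB.hasIdealNorm.dvdPrincipal.mul hI.1.hasIdealNorm.dvdPrincipal)).1 (by
          rw [idealClass_mul hB.hasIdealNorm.dvdPrincipal hI.1.hasIdealNorm.dvdPrincipal, hBa,
            ((hI.1.idealLabel_eq_iff hq a).1 hI.2.2).1, inv_mul_cancel])
      exact ⟨z, fun _ => hz⟩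
    · exact ⟨0, fun h => absurd h hI⟩
  choose γ hγ using hgen
  have hnorm : ∀ I ∈ T, (γ I).norm = idealNorm B * idealNorm I := by
    intro I hI
    have h1 := hB.hasIdealNorm.mul hI.1.hasIdealNorm
    rw [(hγ I hI).2] at h1
    have h2 := h1.unique (hasIdealNorm_span_singleton (hγ I hI).1)
    have h0 := Zsqrtd.norm_nonneg (by omega : -(q : ℤ) ≤ 0) (γ I)
    zify at h2
    rw [h2, abs_of_nonneg h0]
  have hmem : ∀ I ∈ T, γ I ∈ S := by
    intro I hI
    refine ⟨?_, ?_, ?_, ?_⟩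
    · have hle : B * I ≤ B := Ideal.mul_le_left
      exact hle ((hγ I hI).2 ▸ Ideal.mem_span_singleton_self _)
    · rw [hnorm I hI]
      exact_mod_cast Nat.mul_le_mul_left _ hI.2.1
    · rw [hnorm I hI]
      have h3 := (Nat.coprime_two_mul_iff.1 (hB.mul hI.1).coprime).1
      rw [(hB.hasIdealNorm.mul hI.1.hasIdealNorm).idealNorm_eq] at h3
      exact_mod_cast h3
    · rw [hnorm I hI]
      push_cast
      rw [((hI.1.idealLabel_eq_iff hq a).1 hI.2.2).2, mul_comm]
  have hnegmem : ∀ z ∈ S, -z ∈ S := fun z hz => by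
    simp only [hS, Set.mem_ofPred_eq, Zsqrtd.norm_neg, neg_mem_iff] at hz ⊢
    exact hz
  have hspan : ∀ I ∈ T, ∀ J ∈ T, Ideal.span {γ I} = Ideal.span {γ J} → I = J := by
    intro I hI J hJ h
    rw [← (hγ I hI).2, ← (hγ J hJ).2] at h
    exact hB.hasIdealNorm.dvdPrincipal.mul_left_cancel h
  have hinj : Set.InjOn γ T := fun I hI J hJ h => hspan I hI J hJ (by rw [h])
  have hinj' : Set.InjOn (fun I => -γ I) T := fun I hI J hJ h => hinj hI hJ (neg_injective h)
  have hdisj : Disjoint (γ '' T) ((fun I => -γ I) '' T) := by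
    rw [Set.disjoint_left]
    rintro _ ⟨I, hI, rfl⟩ ⟨J, hJ, h⟩
    have h1 : J = I := hspan J hJ I hI (by rw [← h, Ideal.span_singleton_neg])
    rw [h1] at h
    have h2 : (2 : ZsqrtNeg q) * γ I = 0 := by linear_combination -h
    rcases mul_eq_zero.1 h2 with h3 | h3
    · exact two_ne_zero (congrArg Zsqrtd.re h3)
    · exact (hγ I hI).1 h3
  have hunion : S = γ '' T ∪ (fun I => -γ I) '' T := by
    refine Set.Subset.antisymm (fun z hz => ?_) ?_
    · have hz2 := hz.2.2.1
      have hz0 : z ≠ 0 := by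
        rintro rfl
        simp at hz2
      obtain ⟨K, k, hK, hBK, hk⟩ := hB.hasIdealNorm.exists_mul_eq_span hz.1 hz0
      have h0 := Zsqrtd.norm_nonneg (by omega : -(q : ℤ) ≤ 0) z
      have hk' : z.norm = idealNorm B * k := by
        zify at hk
        rw [hk, abs_of_nonneg h0]
      have hKa : (k : ZMod q) = ((a.toMul.2 : (ZMod q)ˣ) : ZMod q) := by
        have h1 := hz.2.2.2
        rw [hk', mul_comm] at h1
        push_cast at h1
        exact hB.isUnit.mul_right_cancel h1
      have hKc : HasCoprimeNorm K := by
        refine ⟨k, hK, Nat.coprime_two_mul_iff.2 ⟨fun h => hz2 ?_, ?_⟩⟩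
        · rw [hk']
          push_cast
          rw [h, mul_zero]
        · rw [hKa]
          exact Units.ne_zero _
      have hKT : K ∈ T := by
        refine ⟨hKc, ?_, ?_⟩
        · rw [hK.idealNorm_eq]
          have h1 := hz.2.1
          rw [hk'] at h1
          exact_mod_cast le_of_mul_le_mul_left h1 (by exact_mod_cast hn0)
        · rw [hKc.idealLabel_eq_iff hq, hK.idealNorm_eq]
          refine ⟨?_, hKa⟩
          have h1 := idealClass_mul hB.hasIdealNorm.dvdPrincipal hK.dvdPrincipal
          rw [hBK, idealClass_span_singleton hz0, hBa] at h1
          exact (inv_mul_eq_one.1 h1.symm).symm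
      have h1 : Ideal.span {γ K} = Ideal.span {z} := by rw [← (hγ K hKT).2, hBK]
      obtain ⟨u, hu⟩ := Ideal.span_singleton_eq_span_singleton.1 h1
      rcases ZsqrtNeg.eq_one_or_neg_one_of_isUnit u.isUnit with h | h
      · exact Or.inl ⟨K, hKT, by rw [← hu, h, mul_one]⟩
      · exact Or.inr ⟨K, hKT, by rw [← hu, h, mul_neg, mul_one]⟩
    · rintro _ (⟨I, hI, rfl⟩ | ⟨I, hI, rfl⟩)
      · exact hmem I hI
      · exact hnegmem _ (hmem I hI)
  have hf1 : (γ '' T).Finite := hfin.subset (hunion ▸ Set.subset_union_left)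
  have hf2 : ((fun I => -γ I) '' T).Finite := hfin.subset (hunion ▸ Set.subset_union_right)
  rw [hunion, Set.ncard_union_eq hdisj hf1 hf2, hinj.ncard_image,
    hinj'.ncard_image, two_mul]

theorem exists_ncard_eq_ncard_lattice (hq : q % 4 = 3) {B : Ideal (ZsqrtNeg q)}
    (hB : HasCoprimeNorm B) {r : (ZMod q)ˣ}
    (hr : r ∈ (powMonoidHom 2 : (ZMod q)ˣ →* (ZMod q)ˣ).range) :
    ∃ a : ℕ, 0 < a ∧ ∃ s t : ℤ → ℤ, (∀ y, ¬ s y ≡ t y [ZMOD (2 * q * a : ℕ)]) ∧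
      ∀ x : ℕ, ∃ f : ℤ × ℤ → ZsqrtNeg q, Function.Injective f ∧
        {z : ZsqrtNeg q | z ∈ B ∧ z.norm ≤ idealNorm B * x ∧ (z.norm : ZMod 2) ≠ 0 ∧
          (z.norm : ZMod q) = (r : ZMod q) * idealNorm B} =
        f '' {e : ℤ × ℤ | (e.1 ≡ s e.2 [ZMOD (2 * q * a : ℕ)] ∨
          e.1 ≡ t e.2 [ZMOD (2 * q * a : ℕ)]) ∧
          (e.1 : ℝ) ^ 2 + q * (e.2 : ℝ) ^ 2 ≤ ((a * x : ℕ) : ℝ)} := by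
  have hqp := (Fact.out : q.Prime)
  obtain ⟨d, a, b, c, hbasis⟩ := exists_hasIdealBasis hB.hasIdealNorm.ne_bot
  have hn := (hbasis.norm_eq hB.hasIdealNorm).1
  obtain ⟨hd, ha, -, hmem⟩ := hbasis
  have hcop := hB.coprime
  rw [hn] at hcop
  have hdc : d.Coprime (2 * q) := by
    have := hcop.coprime_mul_right
    exact (Nat.coprime_pow_left_iff two_pos _ _).1 this
  have hac : a.Coprime (2 * q) := hcop.coprime_mul_left
  have hdq : (d : ZMod q) ≠ 0 := (Nat.coprime_two_mul_iff.1 hdc).2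
  have haq : (a : ZMod q) ≠ 0 := (Nat.coprime_two_mul_iff.1 hac).2
  have hd2 : (d : ZMod 2) ≠ 0 := (Nat.coprime_two_mul_iff.1 hdc).1
  obtain ⟨v, rfl⟩ := hr
  obtain ⟨w, hw⟩ := hB.exists_square hq
  rw [hn] at hw
  obtain ⟨σ, hσ⟩ := ZMod.intCast_surjective ((v : ZMod q) * (w : ZMod q) / (d : ZMod q))
  have hσ2 : (σ : ZMod q) ^ 2 = (v : ZMod q) ^ 2 * a := by
    rw [hσ]
    push_cast at hw
    rw [div_pow, mul_pow, hw]
    field_simp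
  have hσ0 : (σ : ZMod q) ≠ 0 := by
    intro h
    rw [h, zero_pow two_ne_zero] at hσ2
    exact mul_ne_zero (pow_ne_zero _ v.ne_zero) haq hσ2.symm
  have hqodd : Nat.Coprime 2 q := by
    rw [Nat.coprime_two_left]
    exact Nat.odd_iff.2 (by omega)
  have h2q : IsCoprime (2 : ℤ) q := by exact_mod_cast Nat.isCoprime_iff_coprime.2 hqodd
  have h2qa : IsCoprime ((2 : ℤ) * q) a := by
    exact_mod_cast Nat.isCoprime_iff_coprime.2 hac.symm
  have hcrt : ∀ τ y : ℤ, ∃ e : ℤ, ∀ u, u ≡ e [ZMOD (2 * q * a : ℕ)] ↔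
      (u ≡ y + 1 [ZMOD 2] ∧ u ≡ τ [ZMOD q]) ∧ u ≡ y * b [ZMOD a] := by
    intro τ y
    obtain ⟨e₁, he₁⟩ := Int.exists_forall_modEq_mul_iff h2q (y + 1) τ
    obtain ⟨e, he⟩ := Int.exists_forall_modEq_mul_iff h2qa e₁ (y * b)
    refine ⟨e, fun u => ?_⟩
    push_cast
    rw [he, he₁]
  choose s hs using hcrt σ
  choose t ht using hcrt (-σ)
  refine ⟨a, ha, s, t, fun y hy => ?_, fun x => ⟨fun e => ⟨d * e.1, d * e.2⟩, ?_, ?_⟩⟩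
  · have h1 := ((hs y (s y)).1 rfl).1.2
    have h2 := ((ht y (s y)).1 hy).1.2
    have h3 := (ZMod.intCast_eq_intCast_iff _ _ _).2 (h1.symm.trans h2)
    push_cast at h3
    have h4 : (2 : ZMod q) * σ = 0 := by linear_combination h3
    rcases mul_eq_zero.1 h4 with h5 | h5
    · have h6 : ((2 : ℕ) : ZMod q) = 0 := by exact_mod_cast h5
      rw [ZMod.natCast_eq_zero_iff] at h6
      have := Nat.le_of_dvd two_pos h6
      have := hqp.two_le
      omega
    · exact hσ0 h5
  · rintro ⟨u, y⟩ ⟨u', y'⟩ h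
    have hd' : (d : ℤ) ≠ 0 := by exact_mod_cast hd.ne'
    have h1 := congrArg Zsqrtd.re h
    have h2 := congrArg Zsqrtd.im h
    exact Prod.ext (mul_left_cancel₀ hd' h1) (mul_left_cancel₀ hd' h2)
  · have hq2 : (q : ZMod 2) = 1 := by
      rw [← ZMod.natCast_mod, show q % 2 = 1 by omega, Nat.cast_one]
    have hd2' : (d : ZMod 2) = 1 := by
      have : ∀ z : ZMod 2, z ≠ 0 → z = 1 := by decide
      exact this _ hd2
    have key : ∀ u y : ℤ, ((⟨d * u, d * y⟩ : ZsqrtNeg q).norm ≤ idealNorm B * x ∧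
        ((⟨d * u, d * y⟩ : ZsqrtNeg q).norm : ZMod 2) ≠ 0 ∧
        ((⟨d * u, d * y⟩ : ZsqrtNeg q).norm : ZMod q) =
          ((powMonoidHom 2 v : (ZMod q)ˣ) : ZMod q) * idealNorm B) ↔
        (u ≡ y + 1 [ZMOD 2] ∧ (u ≡ σ [ZMOD q] ∨ u ≡ -σ [ZMOD q])) ∧
          (u : ℝ) ^ 2 + q * (y : ℝ) ^ 2 ≤ ((a * x : ℕ) : ℝ) := by
      intro u y
      have hN : (⟨d * u, d * y⟩ : ZsqrtNeg q).norm = d ^ 2 * (u ^ 2 + q * y ^ 2) := by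
        rw [ZsqrtNeg.norm_eq]
        ring
      have e1 : (⟨d * u, d * y⟩ : ZsqrtNeg q).norm ≤ idealNorm B * x ↔
          (u : ℝ) ^ 2 + q * (y : ℝ) ^ 2 ≤ ((a * x : ℕ) : ℝ) := by
        have h1 : ((idealNorm B : ℤ) * x) = d ^ 2 * (a * x) := by
          rw [hn]
          push_cast
          ring
        rw [hN, h1, mul_le_mul_iff_right₀ (by positivity)]
        exact_mod_cast Iff.rfl
      have e2 : ((⟨d * u, d * y⟩ : ZsqrtNeg q).norm : ZMod 2) ≠ 0 ↔ u ≡ y + 1 [ZMOD 2] := by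
        have h2 : u ≡ y + 1 [ZMOD 2] ↔ (u : ZMod 2) = ((y + 1 : ℤ) : ZMod 2) :=
          (ZMod.intCast_eq_intCast_iff u (y + 1) 2).symm
        rw [hN, h2]
        push_cast
        rw [hq2, hd2']
        generalize (u : ZMod 2) = u'
        generalize (y : ZMod 2) = y'
        revert u' y'
        decide
      have e3 : ((⟨d * u, d * y⟩ : ZsqrtNeg q).norm : ZMod q) =
          ((powMonoidHom 2 v : (ZMod q)ˣ) : ZMod q) * idealNorm B ↔
          (u ≡ σ [ZMOD q] ∨ u ≡ -σ [ZMOD q]) := by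
        rw [hN, hn, ← ZMod.intCast_eq_intCast_iff, ← ZMod.intCast_eq_intCast_iff]
        push_cast
        rw [ZMod.natCast_self, zero_mul, add_zero, powMonoidHom_apply, Units.val_pow_eq_pow_val,
          mul_left_comm, mul_right_inj' (pow_ne_zero 2 hdq), ← hσ2, sq_eq_sq_iff_eq_or_eq_neg]
      rw [e1, e2, e3]
      tauto
    ext z
    constructor
    · rintro ⟨hzB, hz⟩
      obtain ⟨x₀, y, rfl⟩ := (hmem z).1 hzB
      obtain ⟨⟨h1, h2⟩, h3⟩ := (key _ _).1 hz
      have h4 : x₀ * a + y * b ≡ y * b [ZMOD a] :=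
        Int.modEq_iff_dvd.2 ⟨-x₀, by ring⟩
      refine ⟨(x₀ * a + y * b, y), ⟨?_, h3⟩, rfl⟩
      rcases h2 with h2 | h2
      · exact Or.inl ((hs y _).2 ⟨⟨h1, h2⟩, h4⟩)
      · exact Or.inr ((ht y _).2 ⟨⟨h1, h2⟩, h4⟩)
    · rintro ⟨⟨u, y⟩, ⟨h1, h3⟩, rfl⟩
      have h5 : (u ≡ y + 1 [ZMOD 2] ∧ (u ≡ σ [ZMOD q] ∨ u ≡ -σ [ZMOD q])) ∧
          u ≡ y * b [ZMOD a] := by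
        rcases h1 with h1 | h1
        · obtain ⟨⟨h6, h7⟩, h8⟩ := (hs y u).1 h1
          exact ⟨⟨h6, Or.inl h7⟩, h8⟩
        · obtain ⟨⟨h6, h7⟩, h8⟩ := (ht y u).1 h1
          exact ⟨⟨h6, Or.inr h7⟩, h8⟩
      refine ⟨(hmem _).2 ?_, (key u y).2 ⟨h5.1, h3⟩⟩
      obtain ⟨k, hk⟩ := Int.modEq_iff_dvd.1 h5.2
      exact ⟨-k, y, by rw [show u = -k * a + y * b by linear_combination -hk]⟩

theorem exists_abs_ncard_idealLabel_sub_le (hq : q % 4 = 3) (a : LabelGroup q) :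
    ∃ K : ℝ, ∀ x : ℕ,
      |({I : Ideal (ZsqrtNeg q) | HasCoprimeNorm I ∧ idealNorm I ≤ x ∧ idealLabel I = a}.ncard : ℝ) -
        2 * (∫ u in (0 : ℝ)..1, √(1 - u ^ 2)) / (q * √q) * x| ≤ K * √x := by
  have hqp := (Fact.out : q.Prime).pos
  obtain ⟨B, hB, hBa⟩ := exists_hasCoprimeNorm_idealClass_eq (by omega) a.toMul.1⁻¹
  obtain ⟨m, hm, s, t, hst, hf⟩ := exists_ncard_eq_ncard_lattice hq hB a.toMul.2.2
  obtain ⟨K, hK⟩ := exists_abs_ncard_lattice_sub_le (by positivity) hqp hst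
  refine ⟨|K| * √m + 1, fun x => ?_⟩
  rcases Nat.eq_zero_or_pos x with rfl | hx
  · have : {I : Ideal (ZsqrtNeg q) | HasCoprimeNorm I ∧ idealNorm I ≤ 0 ∧ idealLabel I = a} = ∅ := by
      refine Set.eq_empty_of_forall_notMem fun I hI => ?_
      have := hI.1.hasIdealNorm.1
      have := hI.2.1
      omega
    rw [this]
    simp
  obtain ⟨f, hfinj, hfS⟩ := hf x
  obtain ⟨hfin, hle⟩ := hK ((m * x : ℕ) : ℝ) (by positivity)
  have hcard := ncard_mem_norm_le_eq_two_mul hq a x hB hBa (by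
    rw [hfS]
    exact hfin.image f)
  rw [hfS, Set.ncard_image_of_injective _ hfinj] at hcard
  rw [hcard] at hle
  set c := ∫ u in (0 : ℝ)..1, √(1 - u ^ 2)
  set T : ℝ := ({I : Ideal (ZsqrtNeg q) |
    HasCoprimeNorm I ∧ idealNorm I ≤ x ∧ idealLabel I = a}.ncard : ℝ) with hT
  have hq' : (0 : ℝ) < q := by exact_mod_cast hqp
  have hm' : (0 : ℝ) < m := by exact_mod_cast hm
  have hsq : √(q : ℝ) ≠ 0 := (Real.sqrt_pos.2 hq').ne'
  have h1 : 8 * c / ((2 * q * m : ℕ) * √q) * ((m * x : ℕ) : ℝ) = 2 * (2 * c / (q * √q) * x) := by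
    push_cast
    field_simp
    ring
  have hx1 : (1 : ℝ) ≤ √x := Real.one_le_sqrt.2 (by exact_mod_cast hx)
  rw [h1, Nat.cast_mul, Nat.cast_two, ← hT, ← mul_sub, abs_mul, abs_two, Nat.cast_mul,
    Real.sqrt_mul hm'.le] at hle
  have h2 : K * (√m * √x) ≤ |K| * (√m * √x) :=
    mul_le_mul_of_nonneg_right (le_abs_self K) (by positivity)
  have h3 : 0 ≤ |K| * (√m * √x) := by positivity
  linarith

theorem CoprimePrime.exists_forall_abs_ncard_sub_le (hq : q % 4 = 3) :
    ∃ κ > (0 : ℝ), ∃ K : ℝ, ∀ (a : LabelGroup q) (x : ℕ),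
      |({m : Multiset (CoprimePrime q) | (m.map norm).prod ≤ x ∧ (m.map label).sum = a}.ncard : ℝ) -
        κ * x| ≤ K * √x := by
  have hqp := (Fact.out : q.Prime).pos
  have : Finite (ClassGroup (ZsqrtNeg q)) := finite_classGroup (by omega)
  have := Fintype.ofFinite (LabelGroup q)
  choose K hK using exists_abs_ncard_idealLabel_sub_le (q := q) hq
  refine ⟨2 * (∫ u in (0 : ℝ)..1, √(1 - u ^ 2)) / (q * √q), ?_, ∑ a, |K a|, fun a x => ?_⟩
  · have hq' : (0 : ℝ) < q := by exact_mod_cast hqp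
    have : 0 < ∫ u in (0 : ℝ)..1, √(1 - u ^ 2) := by
      refine intervalIntegral.intervalIntegral_pos_of_pos_on ?_ (fun u hu => ?_) one_pos
      · exact Continuous.intervalIntegrable (by fun_prop) _ _
      · exact Real.sqrt_pos.2 (by nlinarith [hu.1, hu.2])
    positivity
  · rw [ncard_prod_norm_le hq]
    refine (hK a x).trans (mul_le_mul_of_nonneg_right ?_ (Real.sqrt_nonneg _))
    exact (le_abs_self _).trans
      (Finset.single_le_sum (f := fun a => |K a|) (fun i _ => abs_nonneg _) (Finset.mem_univ a))

end count

theorem natCard_classGroup_adjoin (q : ℕ) [Fact q.Prime] {s : ℝ} (hs : s = q) :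
    Nat.card (ClassGroup (Algebra.adjoin ℤ {(Real.sqrt s : ℂ) * Complex.I})) =
      Nat.card (ClassGroup (ZsqrtNeg q)) := by
  subst hs
  have hr : (Real.sqrt q : ℂ) * Complex.I * ((Real.sqrt q : ℂ) * Complex.I) =
      ((-(q : ℤ) : ℤ) : ℂ) := by
    rw [mul_mul_mul_comm, Complex.I_mul_I, ← Complex.ofReal_mul,
      Real.mul_self_sqrt (Nat.cast_nonneg q)]
    push_cast
    ring
  set φ : ZsqrtNeg q →ₐ[ℤ] ℂ := (Zsqrtd.lift ⟨_, hr⟩).toIntAlgHom with hφ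
  have happ : ∀ z, φ z = z.re + z.im * ((Real.sqrt q : ℂ) * Complex.I) := fun _ => rfl
  have hinj : Function.Injective φ := by
    refine Zsqrtd.lift_injective _ fun n hn => ?_
    have := (Fact.out : q.Prime).pos
    nlinarith [mul_self_nonneg n]
  have hrange : φ.range = Algebra.adjoin ℤ {(Real.sqrt q : ℂ) * Complex.I} := by
    refine le_antisymm ?_ (Algebra.adjoin_le (Set.singleton_subset_iff.2 ⟨⟨0, 1⟩, ?_⟩))
    · rintro _ ⟨z, rfl⟩
      refine add_mem (intCast_mem _ _) (mul_mem (intCast_mem _ _) ?_)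
      exact Algebra.subset_adjoin rfl
    · change φ _ = _
      rw [happ]
      simp
  let e : ZsqrtNeg q ≃ₐ[ℤ] Algebra.adjoin ℤ {(Real.sqrt q : ℂ) * Complex.I} :=
    (AlgEquiv.ofInjective φ hinj).trans (Subalgebra.equivOfEq _ _ hrange)
  exact (Nat.card_congr (ClassGroup.mulEquiv e.toRingEquiv).toEquiv).symm

section density

variable {q : ℕ} [Fact q.Prime]

open scoped Classical in
theorem CoprimePrime.abs_finsum_ite_le (T : Finset (LabelGroup q)) (k : ℕ) :
    |∑ᶠ e ∈ {e : CoprimePrime q × ℕ | 0 < e.2 ∧ e.1.norm ^ e.2 = k},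
      if e.2 • e.1.label ∈ T then Real.log e.1.norm else 0| ≤
      2 * ArithmeticFunction.vonMangoldt k := by
  have hfin := finite_primePowers_of_norm (CoprimePrime.finite_prod_norm_eq (q := q)) k
  have hlog : ∀ P : CoprimePrime q, 0 ≤ Real.log P.norm := fun P => Real.log_natCast_nonneg _
  refine le_trans ?_ (CoprimePrime.finsum_log_norm_le (q := q) k)
  rw [finsum_mem_eq_finite_toFinset_sum _ hfin, finsum_mem_eq_finite_toFinset_sum _ hfin,
    abs_of_nonneg (Finset.sum_nonneg fun e _ => by split_ifs <;> simp [hlog])]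
  exact Finset.sum_le_sum fun e _ => by split_ifs <;> simp [hlog]

theorem tendsto_ncard_prime_eq_sq_add_div (hq : q % 4 = 3) :
    Filter.Tendsto (fun N : ℕ =>
      ({p : ℕ | p ≤ N ∧ p.Prime ∧ (∃ x y : ℤ, (p : ℤ) = x ^ 2 + q * y ^ 2) ∧ p ≠ q ∧
        p % q ≠ 1}.ncard : ℝ) / ({p : ℕ | p ≤ N ∧ p.Prime}.ncard : ℝ)) Filter.atTop
      (nhds ((Nat.card (powMonoidHom 2 : (ZMod q)ˣ →* (ZMod q)ˣ).range - 1) /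
        (Nat.card (ClassGroup (ZsqrtNeg q)) *
          Nat.card (powMonoidHom 2 : (ZMod q)ˣ →* (ZMod q)ˣ).range) / 2)) := by
  classical
  have : Finite (ClassGroup (ZsqrtNeg q)) := finite_classGroup (by omega)
  have := Fintype.ofFinite (ClassGroup (ZsqrtNeg q))
  have := Fintype.ofFinite (powMonoidHom 2 : (ZMod q)ˣ →* (ZMod q)ˣ).range
  have := Fintype.ofFinite (LabelGroup q)
  set G := (powMonoidHom 2 : (ZMod q)ˣ →* (ZMod q)ˣ).range with hG
  let T : Finset (LabelGroup q) :=
    Finset.univ.filter fun a => a.toMul.1 = 1 ∧ a.toMul.2 ≠ 1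
  have hT : ∀ a, a ∈ T ↔ a.toMul.1 = 1 ∧ a.toMul.2 ≠ 1 := fun a => by simp [T]
  have hcard : Fintype.card (LabelGroup q) = Nat.card (ClassGroup (ZsqrtNeg q)) * Nat.card G := by
    rw [← Nat.card_eq_fintype_card, ← Nat.card_prod]
    rfl
  have hTcard : (T.card : ℝ) = Nat.card G - 1 := by
    have h1 : T = (Finset.univ.erase (1 : G)).map
        ⟨fun r => (Additive.ofMul (1, r) : LabelGroup q), fun r s h => by simpa using h⟩ := by
      ext a
      rw [hT, Finset.mem_map]
      constructor
      · rintro ⟨h1, h2⟩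
        exact ⟨a.toMul.2, by simpa using h2, by
          rw [← h1]
          rfl⟩
      · rintro ⟨r, hr, rfl⟩
        exact ⟨rfl, Finset.ne_of_mem_erase hr⟩
    rw [h1, Finset.card_map, Finset.card_erase_of_mem (Finset.mem_univ _), Finset.card_univ,
      Nat.card_eq_fintype_card, Nat.cast_sub Fintype.card_pos, Nat.cast_one]
  have hGodd : Odd (Nat.card G) := by
    obtain ⟨g, rfl⟩ : ∃ g, q = 2 * g + 1 := ⟨q / 2, by omega⟩
    rw [hG, card_range_powMonoidHom_two]
    exact Nat.odd_iff.2 (by omega)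
  obtain ⟨κ, hκ, K, hK⟩ := CoprimePrime.exists_forall_abs_ncard_sub_le hq
  have hmain := tendsto_sum_finsum_ite_mem_div CoprimePrime.two_le_norm
    CoprimePrime.finite_prod_norm_eq hκ hK CoprimePrime.finsum_log_norm_le
    (by rw [hcard]; exact (odd_card_classGroup hq).mul hGodd) T
  rw [hcard, hTcard, Nat.cast_mul] at hmain
  refine tendsto_ncard_prime_div (CoprimePrime.abs_finsum_ite_le T) ?_ two_pos
    (fun p hp h => ?_) (fun p hp h => ?_)
  · convert hmain
  · rw [CoprimePrime.finsum_ite_label hq hp T hT, if_pos h]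
  · rw [CoprimePrime.finsum_ite_label hq hp T hT, if_neg h]

end density

/-- Let `g ≥ 5` be a Sophie Germain prime and `h` the cardinality of the class group of the
order `ℤ[√-(2g+1)]` (realized as the subring of `ℂ` generated by `√(2g+1)·i`).  Then the
proportion, among primes `p ≤ N`, of primes of the form `p = x² + (2g+1)y²` with `p ≠ 2g+1`
and `p ≢ 1 (mod 2g+1)` tends to `(1/(2h))·(1 − 1/g)` as `N → ∞`. -/
theorem stmt_1 (g : ℕ) (hg5 : 5 ≤ g) (hg : Nat.Prime g) (hsg : Nat.Prime (2 * g + 1))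
    (h : ℕ)
    (hh : h = Nat.card (ClassGroup
      (Algebra.adjoin ℤ {(Real.sqrt (2 * g + 1) : ℂ) * Complex.I}))) :
    Filter.Tendsto
      (fun N : ℕ =>
        (({p : ℕ | p ≤ N ∧ p.Prime ∧ (∃ x y : ℤ, (p : ℤ) = x ^ 2 + (2 * g + 1) * y ^ 2) ∧
            p ≠ 2 * g + 1 ∧ p % (2 * g + 1) ≠ 1}.ncard : ℝ)) /
          ({p : ℕ | p ≤ N ∧ p.Prime}.ncard : ℝ))
      Filter.atTop
      (nhds ((1 / (2 * (h : ℝ))) * (1 - 1 / (g : ℝ)))) := by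
  have : Fact (2 * g + 1).Prime := ⟨hsg⟩
  have hgodd : g % 2 = 1 := (hg.eq_two_or_odd).resolve_left (by omega)
  have hcl := natCard_classGroup_adjoin (2 * g + 1) (s := 2 * g + 1) (by push_cast; rfl)
  have hmain := tendsto_ncard_prime_eq_sq_add_div (q := 2 * g + 1) (by omega)
  rw [card_range_powMonoidHom_two, ← hcl, ← hh] at hmain
  push_cast at hmain
  convert hmain using 2
  have hg0 : (g : ℝ) ≠ 0 := by positivity
  rw [one_sub_div hg0, div_mul_div_comm, one_mul, div_div]
  congr 1
  ring
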